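/- Let χ be a non-principal Dirichlet character modulo q and assume GRH for χ, χχ₋₄, χ² and χ²χ₋₄. Fix c ∈ (0,1/8) and let T ≥ 2. Then there exist T', T'' with T − 1 ≤ T', T'' ≤ T such that, writing 1/2 + iγ₁, …, 1/2 + iγ_m for the points which are either zeros of L(s,χ)L(s,χχ₋₄) with imaginary part in (−T'', T'), or the point 1/2 if χ² or χ²χ₋₄ is principal (listed without multiplicity), one has Σ_{n ≤ x, n ∈ S} χ(n) = Σ_{j=1}^m (1/2πi) ∫_{H_{1/2+iγ_j}} F(s,χ) x^s ds/s + O(1 + x·log(xT)/T + (x + max{x,T}^{1/2} + x^{1/2−c} T^{c+1}) · exp(A·log T/log log T)/T), where the truncated Hankel loops have radius r chosen sufficiently small, and the implied constant and A depend only on χ and c. -/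

import Mathlib

open Complex Filter
open scoped Classical

noncomputable section

/-- `n` is a sum of two squares. -/
def IsSum2Sq (n : ℕ) : Prop := ∃ a b : ℕ, n = a ^ 2 + b ^ 2

/-- The Dirichlet L-function `L(s,χ)` (junk value `0` if the modulus is `0`). -/
noncomputable def LVal {N : ℕ} (χ : DirichletCharacter ℂ N) (s : ℂ) : ℂ :=
  if h : N = 0 then 0 else
    haveI : NeZero N := ⟨h⟩
    DirichletCharacter.LFunction χ s

/-- GRH for `L(s,χ)`: all zeros with `0 < Re s < 1` have real part `1/2`. -/
def GRH {N : ℕ} (χ : DirichletCharacter ℂ N) : Prop :=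
  ∀ s : ℂ, 0 < s.re → s.re < 1 → LVal χ s = 0 → s.re = 1 / 2

/-- The unique non-principal Dirichlet character modulo 4. -/
noncomputable def chiNeg4 : DirichletCharacter ℂ 4 := ZMod.χ₄.ringHomComp (Int.castRingHom ℂ)

/-- The product `χ ⋅ χ₋₄`, as a Dirichlet character modulo `4q`. -/
noncomputable def mulChiNeg4 {q : ℕ} (χ : DirichletCharacter ℂ q) : DirichletCharacter ℂ (4 * q) :=
  DirichletCharacter.changeLevel (dvd_mul_left q 4) χ *
    DirichletCharacter.changeLevel (dvd_mul_right 4 q) chiNeg4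

/-- `S(x;q,a)`, the number of sums of two squares `n ≤ x` with `n ≡ a (mod q)`. -/
noncomputable def Scount (q a : ℕ) (x : ℝ) : ℕ :=
  ((Finset.Icc 1 ⌊x⌋₊).filter (fun m => IsSum2Sq m ∧ (m : ZMod q) = (a : ZMod q))).card

/-- The sequence `n ↦ 1_S(n) χ(n)`. -/
noncomputable def STwist {q : ℕ} (χ : DirichletCharacter ℂ q) (n : ℕ) : ℂ :=
  if IsSum2Sq n then χ (n : ZMod q) else 0

/-- `∑_{n ≤ x, n ∈ S} χ(n)`. -/
noncomputable def SSum {q : ℕ} (χ : DirichletCharacter ℂ q) (x : ℝ) : ℂ :=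
  ∑ n ∈ Finset.Icc 1 ⌊x⌋₊, STwist χ n

/-- A set of positive integers has natural density one. -/
def HasDensityOne (P : ℕ → Prop) : Prop :=
  Tendsto (fun n : ℕ => (((Finset.Icc 1 n).filter P).card : ℝ) / n) atTop (nhds 1)

/-- The integral of `f` over the truncated Hankel contour around `ρ`, with horizontal extent
`c` and radius `r`; the two horizontal segments are taken as boundary values from below
(lower segment, traversed rightwards, `arg(s-ρ) = -π`) and from above (upper segment,
traversed leftwards, `arg(s-ρ) = π`), and the circle `|s-ρ| = r` is traversed
anticlockwise. -/
noncomputable def hankelIntegral (f : ℂ → ℂ) (ρ : ℂ) (c r : ℝ) : ℂ :=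
  limUnder (nhdsWithin (0 : ℝ) (Set.Ioi 0)) (fun ε =>
    ((∫ σ in (ρ.re - c)..(ρ.re - r), f (σ + (ρ.im - ε) * I))
      + ∫ θ in (-Real.pi)..Real.pi, f (ρ + r * Complex.exp (θ * I)) * (I * r * Complex.exp (θ * I)))
      - ∫ σ in (ρ.re - c)..(ρ.re - r), f (σ + (ρ.im + ε) * I))

/-- The integral `∫ g(s) |ds|` of a nonnegative density `g` over the truncated Hankel
contour around `ρ` (horizontal extent `c`, radius `r`), horizontal segments again taken
as boundary values from below resp. above. -/
noncomputable def hankelAbsIntegral (g : ℂ → ℝ) (ρ : ℂ) (c r : ℝ) : ℝ :=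
  limUnder (nhdsWithin (0 : ℝ) (Set.Ioi 0)) (fun ε =>
    (∫ σ in (ρ.re - c)..(ρ.re - r), g (σ + (ρ.im - ε) * I))
      + (∫ θ in (-Real.pi)..Real.pi, g (ρ + r * Complex.exp (θ * I)) * r)
      + ∫ σ in (ρ.re - c)..(ρ.re - r), g (σ + (ρ.im + ε) * I))

/-- The constant `C_q` of the paper. -/
noncomputable def Cconst (q : ℕ) : ℝ :=
  (2 * Real.pi ^ (-(1 / 4 : ℝ)) / Real.Gamma (1 / 4)) *
    (∏' p : Nat.Primes, if (p : ℕ) % 4 = 3 then (1 - (p : ℝ) ^ (-(2:ℝ))) ^ (-(1 / 4 : ℝ)) else 1) *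
    ∏ p ∈ q.primeFactors.filter (fun p => p % 4 = 3), (1 - 1 / (p : ℝ)) ^ ((1 : ℝ) / 2)

/-- Hadamard's three circles theorem, with the bound on the outer circle normalised to `1`. -/
lemma norm_le_rpow_of_three_circles {h : ℂ → ℂ} {z₀ z : ℂ} {r R a : ℝ} (hr : 0 < r) (hrR : r < R)
    (hd : ∀ w, ‖w - z₀‖ ≤ R → DifferentiableAt ℂ h w)
    (ha : ∀ w, ‖w - z₀‖ = r → ‖h w‖ ≤ a) (hb : ∀ w, ‖w - z₀‖ ≤ R → ‖h w‖ ≤ 1)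
    (hrz : r ≤ ‖z - z₀‖) (hzR : ‖z - z₀‖ ≤ R) :
    ‖h z‖ ≤ a ^ (Real.log (R / ‖z - z₀‖) / Real.log (R / r)) := by
  have hR : 0 < R := hr.trans hrR
  have hz0 : 0 < ‖z - z₀‖ := hr.trans_le hrz
  have hlog : Real.log r < Real.log R := Real.log_lt_log hr hrR
  have hn : ∀ w : ℂ, ‖z₀ + cexp w - z₀‖ = Real.exp w.re := fun w => by
    rw [add_sub_cancel_left, Complex.norm_exp]
  have hcl : ∀ w : ℂ, w.re ≤ Real.log R → ‖z₀ + cexp w - z₀‖ ≤ R := fun w hw => by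
    rw [hn, ← Real.exp_log hR]; exact Real.exp_le_exp.2 hw
  have hdg : ∀ w : ℂ, w.re ≤ Real.log R → DifferentiableAt ℂ (fun w => h (z₀ + cexp w)) w :=
    fun w hw => DifferentiableAt.fun_comp' w (hd _ (hcl w hw)) (by fun_prop)
  have key := Complex.HadamardThreeLines.norm_le_interp_of_mem_verticalClosedStrip'
    (f := fun w => h (z₀ + cexp w)) (z := Complex.log (z - z₀)) (a := a) (b := 1) hlog
    (by
      simp only [HadamardThreeLines.verticalClosedStrip, Set.mem_preimage, Complex.log_re, Set.mem_Icc]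
      exact ⟨Real.log_le_log hr hrz, Real.log_le_log hz0 hzR⟩)
    (by
      apply DifferentiableOn.diffContOnCl
      intro w hw
      apply (hdg w _).differentiableWithinAt
      have : closure (HadamardThreeLines.verticalStrip (Real.log r) (Real.log R)) ⊆
          {w : ℂ | w.re ≤ Real.log R} :=
        closure_minimal (fun w hw => hw.2.le) (isClosed_le continuous_re continuous_const)
      exact this hw)
    (by
      refine ⟨1, ?_⟩
      rintro _ ⟨w, hw, rfl⟩
      exact hb _ (hcl w hw.2))
    (by
      intro w hw
      apply ha
      rw [hn, show w.re = Real.log r from hw, Real.exp_log hr])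
    (by
      intro w hw
      exact hb _ (hcl w (le_of_eq hw)))
  have hne : z - z₀ ≠ 0 := norm_pos_iff.1 hz0
  simp only [Complex.exp_log hne, add_sub_cancel, Real.one_rpow, mul_one, Complex.log_re] at key
  convert key using 2
  rw [Real.log_div hR.ne' hz0.ne', Real.log_div hR.ne' hr.ne']
  have : Real.log R - Real.log r ≠ 0 := (sub_pos.2 hlog).ne'
  field_simp
  ring

/-- A Borel–Carathéodory estimate without loss near the boundary, for functions which are known
to be small on a smaller disc. -/
lemma norm_le_of_re_le_of_norm_le {f : ℂ → ℂ} {z₀ z : ℂ} {Q B δ : ℝ} (hB : 0 < B) (hBQ : B ≤ Q)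
    (hd : ∀ w, ‖w - z₀‖ < 3 / 2 → DifferentiableAt ℂ f w)
    (hre : ∀ w, ‖w - z₀‖ < 3 / 2 → (f w).re ≤ Q)
    (hnb : ∀ w, ‖w - z₀‖ ≤ 9 / 10 → ‖f w‖ ≤ B)
    (hδ : 0 < δ) (hδ' : δ ≤ 3 / 5) (hz : ‖z - z₀‖ ≤ 3 / 2 - δ)
    (hη : (B / Q) ^ (δ / 2) ≤ 1 / 2) : ‖f z‖ ≤ 4 * Q * (B / Q) ^ (δ / 2) := by
  have hQ : 0 < Q := hB.trans_le hBQ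
  have hBQ1 : B / Q ≤ 1 := (div_le_one hQ).2 hBQ
  have hBQ0 : 0 < B / Q := div_pos hB hQ
  rcases le_total ‖z - z₀‖ (9 / 10) with hz9 | hz9
  · have h1 : B / Q ≤ (B / Q) ^ (δ / 2) := by
      conv_lhs => rw [← Real.rpow_one (B / Q)]
      exact Real.rpow_le_rpow_of_exponent_ge hBQ0 hBQ1 (by linarith)
    calc ‖f z‖ ≤ B := hnb z hz9
      _ = Q * (B / Q) := by field_simp
      _ ≤ Q * (B / Q) ^ (δ / 2) := by gcongr
      _ ≤ 4 * Q * (B / Q) ^ (δ / 2) := by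
        have : 0 ≤ Q * (B / Q) ^ (δ / 2) := by positivity
        linarith
  set R : ℝ := 3 / 2 - δ / 2 with hRdef
  have hden : ∀ w, ‖w - z₀‖ < 3 / 2 → 0 < ((2 * Q : ℂ) - f w).re := fun w hw => by
    have := hre w hw
    simp
    linarith
  have hne : ∀ w, ‖w - z₀‖ < 3 / 2 → (2 * Q : ℂ) - f w ≠ 0 := fun w hw h => by
    have := hden w hw
    rw [h] at this
    simp at this
  have hh1 : ∀ w, ‖w - z₀‖ ≤ R → ‖f w / (2 * Q - f w)‖ ≤ 1 := fun w hw => by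
    have hw' : ‖w - z₀‖ < 3 / 2 := by linarith
    rw [norm_div]
    apply div_le_one_of_le₀ _ (norm_nonneg _)
    apply le_of_sq_le_sq _ (norm_nonneg _)
    rw [Complex.sq_norm, Complex.sq_norm, Complex.normSq_apply, Complex.normSq_apply]
    have := hre w hw'
    simp
    nlinarith
  have key := norm_le_rpow_of_three_circles (h := fun w => f w / (2 * Q - f w)) (z₀ := z₀) (z := z)
    (r := 9 / 10) (R := R) (a := B / Q) (by norm_num) (by linarith)
    (fun w hw => ((hd w (by linarith)).div ((differentiableAt_const _).sub (hd w (by linarith)))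
      (hne w (by linarith))))
    (by
      intro w hw
      have hfw := hnb w hw.le
      rw [norm_div]
      apply div_le_div₀ hB.le hfw hQ
      calc Q ≤ 2 * Q - ‖f w‖ := by linarith
        _ = ‖(2 * Q : ℂ)‖ - ‖f w‖ := by simp [abs_of_pos hQ]
        _ ≤ _ := norm_sub_norm_le _ _)
    hh1 hz9 (by linarith)
  have hz0 : 0 < ‖z - z₀‖ := by linarith
  have hRpos : 0 < R := by linarith
  have hexp : δ / 2 ≤ Real.log (R / ‖z - z₀‖) / Real.log (R / (9 / 10)) := by
    have h1 : Real.log (R / (9 / 10)) ≤ 2 / 3 := by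
      have := Real.log_le_sub_one_of_pos (show 0 < R / (9 / 10) by positivity)
      linarith
    have h1' : 0 < Real.log (R / (9 / 10)) := Real.log_pos (by rw [lt_div_iff₀ (by norm_num)]; linarith)
    have h2 : δ / 3 ≤ Real.log (R / ‖z - z₀‖) := by
      have := Real.one_sub_inv_le_log_of_pos (show 0 < R / ‖z - z₀‖ by positivity)
      rw [inv_div] at this
      have h3 : ‖z - z₀‖ / R ≤ 1 - δ / 3 := by
        rw [div_le_iff₀ hRpos]
        nlinarith
      linarith
    rw [le_div_iff₀ h1']
    nlinarith
  set η := (B / Q) ^ (δ / 2) with hηdef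
  have hη0 : 0 < η := by positivity
  have key2 : ‖f z / (2 * Q - f z)‖ ≤ η :=
    key.trans (Real.rpow_le_rpow_of_exponent_ge hBQ0 hBQ1 hexp)
  rw [norm_div, div_le_iff₀ (norm_pos_iff.2 (hne z (by linarith)))] at key2
  have h4 : ‖(2 * Q : ℂ) - f z‖ ≤ 2 * Q + ‖f z‖ := by
    refine (norm_sub_le _ _).trans ?_
    simp [abs_of_pos hQ]
  nlinarith [norm_nonneg (f z)]

/-- A nonvanishing holomorphic function on a disc has a holomorphic logarithm. -/
lemma exists_log_on_ball {G : ℂ → ℂ} {z₀ : ℂ} {r : ℝ} (hr : 0 < r)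
    (hd : ∀ w, ‖w - z₀‖ < r → DifferentiableAt ℂ G w) (hne : ∀ w, ‖w - z₀‖ < r → G w ≠ 0) :
    ∃ f : ℂ → ℂ, f z₀ = 0 ∧ (∀ w, ‖w - z₀‖ < r → HasDerivAt f (deriv G w / G w) w) ∧
      ∀ w, ‖w - z₀‖ < r → cexp (f w) = G w / G z₀ := by
  have hball : ∀ w, w ∈ Metric.ball z₀ r ↔ ‖w - z₀‖ < r := fun w => by
    rw [Metric.mem_ball, dist_eq_norm]
  have hdG : DifferentiableOn ℂ G (Metric.ball z₀ r) := fun w hw =>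
    (hd w ((hball w).1 hw)).differentiableWithinAt
  have hq : DifferentiableOn ℂ (fun w => deriv G w / G w) (Metric.ball z₀ r) :=
    (hdG.deriv Metric.isOpen_ball).div hdG fun w hw => hne w ((hball w).1 hw)
  obtain ⟨f, hf0, hf⟩ := (hq.isExactOn_ball).with_val_at z₀ 0
  refine ⟨f, hf0, fun w hw => hf w ((hball w).2 hw), fun w hw => ?_⟩
  have hconst : ∀ w ∈ Metric.ball z₀ r, HasDerivAt (fun w => cexp (-f w) * G w) 0 w := by
    intro w hw
    have h1 := ((hf w hw).neg.cexp).mul (hd w ((hball w).1 hw)).hasDerivAt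
    refine h1.congr_deriv ?_
    rw [mul_assoc, neg_mul, div_mul_cancel₀ _ (hne w ((hball w).1 hw))]
    ring
  have heq : cexp (-f w) * G w = cexp (-f z₀) * G z₀ := by
    apply (convex_ball z₀ r).is_const_of_fderivWithin_eq_zero (𝕜 := ℂ)
      (f := fun w => cexp (-f w) * G w)
      (fun w hw => (hconst w hw).differentiableAt.differentiableWithinAt) _ ((hball w).2 hw)
      (Metric.mem_ball_self hr)
    intro w hw
    rw [fderivWithin_of_isOpen Metric.isOpen_ball hw]
    ext
    simp [(hconst w hw).deriv]
  have hz0 : G z₀ ≠ 0 := hne z₀ (by simpa using hr)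
  rw [hf0, neg_zero, Complex.exp_zero, one_mul] at heq
  rw [← heq, Complex.exp_neg]
  have : G w ≠ 0 := hne w hw
  field_simp

/-- Two-sided bounds for a nonvanishing holomorphic function on a disc, in terms of a one-sided
bound on the whole disc and a bound for the logarithmic derivative on a smaller disc. -/
lemma norm_div_bounds_of_nonvanishing {G : ℂ → ℂ} {z₀ z : ℂ} {Q B δ : ℝ} (hB : 0 < B) (hBQ : B ≤ Q)
    (hd : ∀ w, ‖w - z₀‖ < 3 / 2 → DifferentiableAt ℂ G w)
    (hne : ∀ w, ‖w - z₀‖ < 3 / 2 → G w ≠ 0)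
    (hG : ∀ w, ‖w - z₀‖ < 3 / 2 → ‖G w‖ ≤ ‖G z₀‖ * Real.exp Q)
    (hnb : ∀ w, ‖w - z₀‖ ≤ 9 / 10 → ‖deriv G w / G w‖ ≤ B)
    (hδ : 0 < δ) (hδ' : δ ≤ 3 / 5) (hz : ‖z - z₀‖ ≤ 3 / 2 - δ)
    (hη : (B / Q) ^ (δ / 2) ≤ 1 / 2) :
    ‖G z‖ ≤ ‖G z₀‖ * Real.exp (4 * Q * (B / Q) ^ (δ / 2)) ∧
    ‖G z₀‖ ≤ ‖G z‖ * Real.exp (4 * Q * (B / Q) ^ (δ / 2)) := by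
  obtain ⟨f, hf0, hf, hexp⟩ := exists_log_on_ball (by norm_num) hd hne
  have hz0 : 0 < ‖G z₀‖ := norm_pos_iff.2 (hne z₀ (by simp))
  have hex : ∀ w, ‖w - z₀‖ < 3 / 2 → Real.exp (f w).re = ‖G w‖ / ‖G z₀‖ := fun w hw => by
    rw [← Complex.norm_exp, hexp w hw, norm_div]
  have hfz : ‖f z‖ ≤ 4 * Q * (B / Q) ^ (δ / 2) := by
    refine norm_le_of_re_le_of_norm_le hB hBQ (fun w hw => (hf w hw).differentiableAt) ?_ ?_ hδ hδ'
      hz hη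
    · intro w hw
      rw [← Real.exp_le_exp, hex w hw, div_le_iff₀ hz0, mul_comm]
      exact hG w hw
    · intro w hw
      have hcb : ∀ u, u ∈ Metric.closedBall z₀ (9 / 10) ↔ ‖u - z₀‖ ≤ 9 / 10 := fun u => by
        rw [Metric.mem_closedBall, dist_eq_norm]
      have := (convex_closedBall z₀ (9 / 10)).norm_image_sub_le_of_norm_hasDerivWithin_le
        (f := f) (f' := fun w => deriv G w / G w) (C := B) (x := z₀) (y := w)
        (fun u hu => (hf u (by linarith [(hcb u).1 hu])).hasDerivWithinAt)
        (fun u hu => hnb u ((hcb u).1 hu)) (Metric.mem_closedBall_self (by norm_num))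
        ((hcb w).2 hw)
      rw [hf0, sub_zero] at this
      nlinarith
  have hz' : ‖z - z₀‖ < 3 / 2 := by linarith
  have habs := abs_le.1 ((Complex.abs_re_le_norm (f z)).trans hfz)
  have e := hex z hz'
  rw [eq_div_iff hz0.ne'] at e
  constructor
  · rw [← e, mul_comm]
    gcongr
    exact habs.2
  · rw [← e]
    calc ‖G z₀‖ = ‖G z₀‖ * 1 := (mul_one _).symm
      _ ≤ ‖G z₀‖ * Real.exp ((f z).re + 4 * Q * (B / Q) ^ (δ / 2)) := by
        gcongr
        exact Real.one_le_exp (by linarith)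
      _ = _ := by rw [Real.exp_add]; ring

/-- A bound for the continuation of a Dirichlet series whose coefficients have partial sums close
to a linear function. -/
lemma norm_le_of_partial_sums_near_linear {f : ℕ → ℂ} {κ : ℂ} {C : ℝ} {H : ℂ → ℂ}
    (hA : ∀ t : ℝ, 1 ≤ t → ‖∑ k ∈ Finset.Icc 1 ⌊t⌋₊, f k - κ * t‖ ≤ C)
    (hH : Differentiable ℂ H) (hHs : ∀ s : ℂ, 1 < s.re → H s = (s - 1) * LSeries f s)
    (hsum : ∀ s : ℂ, 1 < s.re → LSeriesSummable f s) {s : ℂ} (hs : 0 < s.re) :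
    ‖H s‖ ≤ ‖s - 1‖ * ‖s‖ * (C / s.re) + ‖κ‖ * ‖s‖ := by
  have hC : 0 ≤ C := (norm_nonneg _).trans (hA 1 le_rfl)
  set R : ℝ → ℂ := fun t => ∑ k ∈ Finset.Icc 1 ⌊t⌋₊, f k - κ * t with hR
  set R' : ℝ → ℂ := (Set.Ioi 1).indicator R with hR'
  have hRm : Measurable R := by
    have h1 : Measurable (fun t : ℝ => ∑ k ∈ Finset.Icc 1 ⌊t⌋₊, f k) :=
      (measurable_from_nat (f := fun n => ∑ k ∈ Finset.Icc 1 n, f k)).comp Nat.measurable_floor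
    exact h1.sub (by fun_prop)
  have hR'm : Measurable R' := hRm.indicator measurableSet_Ioi
  have hR'b : ∀ t, ‖R' t‖ ≤ C := fun t => by
    by_cases ht : t ∈ Set.Ioi (1 : ℝ)
    · rw [hR', Set.indicator_of_mem ht]; exact hA t (le_of_lt ht)
    · rw [hR', Set.indicator_of_notMem ht]; simpa
  have hmel : ∀ s : ℂ, 0 < s.re → DifferentiableAt ℂ (mellin R') (-s) := by
    intro s hs
    refine mellin_differentiableAt_of_isBigO_rpow (a := 0) (b := -s.re - 1) ?_ ?_ (by simpa) ?_
      (by simp)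
    · refine (MeasureTheory.LocallyIntegrable.mono
        (MeasureTheory.locallyIntegrable_const (C : ℝ)) hR'm.aestronglyMeasurable
        (Eventually.of_forall fun t => ?_)).locallyIntegrableOn _
      rw [Real.norm_of_nonneg hC]; exact hR'b t
    · refine Asymptotics.IsBigO.of_bound C (Eventually.of_forall fun t => ?_)
      simpa using hR'b t
    · refine Asymptotics.IsBigO.of_bound 1 ?_
      have : Set.Iio (1 : ℝ) ∈ nhdsWithin 0 (Set.Ioi (0:ℝ)) :=
        mem_nhdsWithin_of_mem_nhds (Iio_mem_nhds one_pos)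
      filter_upwards [this] with t ht
      rw [hR', Set.indicator_of_notMem (by simpa using (le_of_lt ht))]
      simp
  have hmeleq : ∀ s : ℂ, mellin R' (-s) = ∫ t in Set.Ioi (1 : ℝ), R t * (t : ℂ) ^ (-(s + 1)) := by
    intro s
    have h2 : ∀ t : ℝ, (t : ℂ) ^ (-s - 1) • R' t =
        (Set.Ioi 1).indicator (fun t : ℝ => R t * (t : ℂ) ^ (-(s + 1))) t := by
      intro t
      by_cases ht : t ∈ Set.Ioi (1 : ℝ)
      · rw [hR', Set.indicator_of_mem ht, Set.indicator_of_mem ht, smul_eq_mul, mul_comm,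
          neg_add']
      · rw [hR', Set.indicator_of_notMem ht, Set.indicator_of_notMem ht, smul_zero]
    rw [mellin]
    simp_rw [h2]
    rw [MeasureTheory.setIntegral_indicator measurableSet_Ioi]
    congr 2
    rw [Set.inter_eq_right]
    exact Set.Ioi_subset_Ioi zero_le_one
  have hnint : ∀ s : ℂ, 0 < s.re → MeasureTheory.IntegrableOn
      (fun t : ℝ => C * t ^ (-s.re - 1)) (Set.Ioi 1) := fun s hs =>
    (integrableOn_Ioi_rpow_of_lt (by linarith) zero_lt_one).const_mul C
  have hbd : ∀ s : ℂ, ∀ t ∈ Set.Ioi (1 : ℝ), ‖R t * (t : ℂ) ^ (-(s + 1))‖ ≤ C * t ^ (-s.re - 1) := by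
    intro s t ht
    have ht0 : (0 : ℝ) < t := zero_lt_one.trans ht
    rw [norm_mul, Complex.norm_cpow_eq_rpow_re_of_pos ht0]
    have : (-(s + 1)).re = -s.re - 1 := by simp; ring
    rw [this]
    gcongr
    exact hA t (le_of_lt ht)
  have hint : ∀ s : ℂ, 0 < s.re → MeasureTheory.IntegrableOn
      (fun t : ℝ => R t * (t : ℂ) ^ (-(s + 1))) (Set.Ioi 1) := fun s hs => by
    refine (hnint s hs).mono' ?_ ?_
    · refine (hRm.mul ?_).aestronglyMeasurable
      fun_prop
    · exact (MeasureTheory.ae_restrict_iff' measurableSet_Ioi).2 (Eventually.of_forall (hbd s))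
  have hrep : ∀ s : ℂ, 1 < s.re → H s = (s - 1) * s * mellin R' (-s) + κ * s := by
    intro s hs
    have hs0 : s ≠ 0 := fun h => by rw [h] at hs; norm_num at hs
    have hs1 : s - 1 ≠ 0 := fun h => by rw [sub_eq_zero.1 h] at hs; norm_num at hs
    rw [hHs s hs, LSeries_eq_mul_integral f zero_le_one hs (hsum s hs), hmeleq]
    · have h3 : ∀ t ∈ Set.Ioi (1 : ℝ), (∑ k ∈ Finset.Icc 1 ⌊t⌋₊, f k) * (t : ℂ) ^ (-(s + 1)) =
          R t * (t : ℂ) ^ (-(s + 1)) + κ * (t : ℂ) ^ (-s) := by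
        intro t ht
        have ht0 : (t : ℂ) ≠ 0 := by
          exact_mod_cast (zero_lt_one.trans ht).ne'
        have : (t : ℂ) ^ (-s) = t * (t : ℂ) ^ (-(s + 1)) := by
          rw [neg_add', Complex.cpow_sub _ _ ht0, Complex.cpow_one]
          field_simp
        rw [this, hR]
        ring
      rw [MeasureTheory.setIntegral_congr_fun measurableSet_Ioi h3,
        MeasureTheory.integral_add (hint s (by linarith))
          ((integrableOn_Ioi_cpow_of_lt (by simpa using hs) zero_lt_one).const_mul κ),
        MeasureTheory.integral_const_mul, integral_Ioi_cpow_of_lt (by simpa using hs) zero_lt_one]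
      have : -s + 1 ≠ 0 := fun h => hs1 (by linear_combination -h)
      simp only [ofReal_one, one_cpow]
      field_simp
      ring
    · refine Asymptotics.IsBigO.of_bound (C + ‖κ‖) ?_
      filter_upwards [eventually_ge_atTop 1] with n hn
      have hn' : (1 : ℝ) ≤ n := by exact_mod_cast hn
      have := hA n hn'
      rw [Nat.floor_natCast] at this
      have h4 := norm_add_le (∑ k ∈ Finset.Icc 1 n, f k - κ * (n : ℝ)) (κ * (n : ℝ))
      rw [sub_add_cancel, norm_mul, Complex.norm_real, Real.norm_natCast] at h4
      rw [Real.rpow_one, Real.norm_natCast]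
      nlinarith
  have hext : H s = (s - 1) * s * mellin R' (-s) + κ * s := by
    have hopen : IsOpen {z : ℂ | 0 < z.re} := isOpen_lt continuous_const continuous_re
    have e1 : AnalyticOnNhd ℂ H {z : ℂ | 0 < z.re} :=
      hH.differentiableOn.analyticOnNhd hopen
    have e2 : AnalyticOnNhd ℂ (fun s => (s - 1) * s * mellin R' (-s) + κ * s) {z : ℂ | 0 < z.re} := by
      refine DifferentiableOn.analyticOnNhd (fun z hz => ?_) hopen
      have h5 : DifferentiableAt ℂ (fun z => mellin R' (-z)) z :=
        DifferentiableAt.fun_comp' z (hmel z hz) (by fun_prop)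
      exact (((by fun_prop : DifferentiableAt ℂ (fun s : ℂ => (s - 1) * s) z).mul h5).add
        (by fun_prop)).differentiableWithinAt
    refine e1.eqOn_of_preconnected_of_eventuallyEq e2
      (convex_halfSpace_re_gt 0).isPreconnected (z₀ := 2) (by simp) ?_ hs
    have : {z : ℂ | 1 < z.re} ∈ nhds (2 : ℂ) :=
      (isOpen_lt continuous_const continuous_re).mem_nhds (by simp)
    filter_upwards [this] with z hz using hrep z hz
  have hM : ‖mellin R' (-s)‖ ≤ C / s.re := by
    rw [hmeleq]
    refine (MeasureTheory.norm_integral_le_of_norm_le (hnint s hs)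
      ((MeasureTheory.ae_restrict_iff' measurableSet_Ioi).2 (Eventually.of_forall (hbd s)))).trans ?_
    rw [MeasureTheory.integral_const_mul, integral_Ioi_rpow_of_lt (by linarith) zero_lt_one]
    simp only [Real.one_rpow, sub_add_cancel, neg_div_neg_eq]
    rw [mul_one_div]
  rw [hext]
  refine (norm_add_le _ _).trans ?_
  rw [norm_mul, norm_mul, norm_mul]
  gcongr

/-- The sums of a non-principal character over initial intervals are bounded. -/
lemma exists_bound_character_sums {N : ℕ} [NeZero N] {χ : DirichletCharacter ℂ N} (hχ : χ ≠ 1) :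
    ∃ C : ℝ, 0 ≤ C ∧ ∀ n : ℕ, ‖∑ k ∈ Finset.Icc 1 n, χ (k : ZMod N)‖ ≤ C := by
  have hper : ∀ m : ℕ, ∑ k ∈ Finset.range N, χ ((m + k : ℕ) : ZMod N) = 0 := by
    intro m
    have h0 := χ.sum_eq_zero_of_ne_one hχ
    rw [← Equiv.sum_comp (Equiv.addLeft (m : ZMod N))] at h0
    rw [← h0]
    refine Finset.sum_bij (fun k _ => (k : ZMod N)) (fun _ _ => Finset.mem_univ _) ?_ ?_ ?_
    · intro a ha b hb hab
      have := (ZMod.natCast_eq_natCast_iff' a b N).1 hab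
      rwa [Nat.mod_eq_of_lt (Finset.mem_range.1 ha), Nat.mod_eq_of_lt (Finset.mem_range.1 hb)] at this
    · intro b _
      exact ⟨b.val, Finset.mem_range.2 (ZMod.val_lt b), by simp⟩
    · intro k _
      simp
  have hrange : ∀ n : ℕ, ‖∑ k ∈ Finset.range n, χ (k : ZMod N)‖ ≤ N := by
    intro n
    induction n using Nat.strong_induction_on with
    | _ n ih =>
      rcases lt_or_ge n N with h | h
      · calc _ ≤ ∑ k ∈ Finset.range n, ‖χ (k : ZMod N)‖ := norm_sum_le _ _
          _ ≤ ∑ k ∈ Finset.range n, (1 : ℝ) := Finset.sum_le_sum fun k _ => χ.norm_le_one _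
          _ ≤ N := by simp; exact_mod_cast h.le
      · obtain ⟨m, rfl⟩ := Nat.exists_eq_add_of_le' h
        rw [Finset.sum_range_add, hper, add_zero]
        exact ih m (by have := NeZero.pos N; omega)
  refine ⟨N + 1, by positivity, fun n => ?_⟩
  have h1 : ∑ k ∈ Finset.Icc 1 n, χ (k : ZMod N) =
      ∑ k ∈ Finset.range (n + 1), χ (k : ZMod N) - χ ((0 : ℕ) : ZMod N) := by
    rw [Finset.range_eq_Ico, Finset.sum_eq_sum_Ico_succ_bot (Nat.succ_pos n), add_sub_cancel_left]
    rfl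
  rw [h1]
  exact (norm_sub_le _ _).trans (add_le_add (hrange _) (χ.norm_le_one _))

/-- Trivial bound for the `L`-function of a non-principal character in the right half plane. -/
lemma exists_norm_LFunction_le {N : ℕ} [NeZero N] {χ : DirichletCharacter ℂ N} (hχ : χ ≠ 1) :
    ∃ C : ℝ, 0 ≤ C ∧ ∀ s : ℂ, 0 < s.re → ‖χ.LFunction s‖ ≤ C * ‖s‖ / s.re := by
  obtain ⟨C, hC, hCb⟩ := exists_bound_character_sums hχ
  refine ⟨C, hC, ?_⟩
  have key : ∀ s : ℂ, 0 < s.re → s ≠ 1 → ‖χ.LFunction s‖ ≤ C * ‖s‖ / s.re := by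
    intro s hs hs1
    have := norm_le_of_partial_sums_near_linear (f := fun n => χ (n : ZMod N)) (κ := 0) (C := C)
      (H := fun s => (s - 1) * χ.LFunction s) (fun t _ => by simpa using hCb _)
      (((by fun_prop : Differentiable ℂ fun s : ℂ => s - 1)).mul
        (DirichletCharacter.differentiable_LFunction hχ))
      (fun s hs => by rw [DirichletCharacter.LFunction_eq_LSeries χ hs])
      (fun s hs => DirichletCharacter.LSeriesSummable_of_one_lt_re χ hs) hs
    have h1 : 0 < ‖s - 1‖ := norm_pos_iff.2 (sub_ne_zero.2 hs1)
    simp only [norm_mul, norm_zero, zero_mul, add_zero] at this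
    rw [mul_assoc] at this
    have := le_of_mul_le_mul_left this h1
    rwa [mul_div_assoc', mul_comm ‖s‖] at this
  intro s hs
  rcases eq_or_ne s 1 with rfl | h
  · have hmem : {z : ℂ | 0 < z.re} ∈ nhdsWithin (1 : ℂ) {1}ᶜ :=
      mem_nhdsWithin_of_mem_nhds ((isOpen_lt continuous_const continuous_re).mem_nhds (by simp))
    refine le_of_tendsto_of_tendsto (b := nhdsWithin (1 : ℂ) {1}ᶜ)
      (f := fun z => ‖χ.LFunction z‖) (g := fun z => C * ‖z‖ / z.re) ?_ ?_ ?_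
    · exact ((DirichletCharacter.differentiable_LFunction hχ).continuous.norm.tendsto 1).mono_left
        nhdsWithin_le_nhds
    · refine Tendsto.mono_left ?_ nhdsWithin_le_nhds
      refine ((continuous_const.mul continuous_norm).tendsto (1 : ℂ)).div
        (continuous_re.tendsto (1 : ℂ)) (by simp)
    · filter_upwards [hmem, self_mem_nhdsWithin] with z hz hz1 using key z hz hz1
  · exact key s hs h

/-- Trivial bound for `(s - 1) ζ(s)` in the right half plane. -/
lemma norm_sub_one_mul_riemannZeta_le {s : ℂ} (hs : 0 < s.re) (hs1 : s ≠ 1) :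
    ‖(s - 1) * riemannZeta s‖ ≤ ‖s - 1‖ * ‖s‖ * (1 / s.re) + ‖s‖ := by
  have hd := DirichletCharacter.differentiable_LFunctionTrivChar₁ 1
  have hval : ∀ s : ℂ, s ≠ 1 → DirichletCharacter.LFunctionTrivChar₁ 1 s =
      (s - 1) * riemannZeta s := by
    intro s hs
    rw [DirichletCharacter.LFunctionTrivChar₁, Function.update_of_ne hs,
      DirichletCharacter.LFunctionTrivChar, DirichletCharacter.LFunction_modOne_eq]
  have := norm_le_of_partial_sums_near_linear (f := 1) (κ := 1) (C := 1)
    (H := DirichletCharacter.LFunctionTrivChar₁ 1) (fun t ht => by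
      have h1 := Nat.floor_le (show 0 ≤ t by linarith)
      have h2 := Nat.lt_floor_add_one t
      simp only [Pi.one_apply, Finset.sum_const, Nat.card_Icc, add_tsub_cancel_right, nsmul_eq_mul,
        mul_one, one_mul]
      rw [← Complex.ofReal_natCast, ← Complex.ofReal_sub, Complex.norm_real, Real.norm_eq_abs,
        abs_le]
      constructor <;> linarith) hd (fun s hs => by
      rw [hval s (fun h => by rw [h] at hs; norm_num at hs), LSeries_one_eq_riemannZeta hs])
    (fun s hs => LSeriesSummable_one_iff.2 hs) hs
  rw [hval s hs1] at this
  simpa using this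

lemma exists_norm_LSeries_le {f : ℕ → ℂ} {s₀ : ℂ} (hf : LSeriesSummable f s₀) :
    ∃ K : ℝ, 0 ≤ K ∧ ∀ s : ℂ, s₀.re ≤ s.re → ‖LSeries f s‖ ≤ K := by
  refine ⟨∑' n, ‖LSeries.term f s₀ n‖, tsum_nonneg fun _ => norm_nonneg _, fun s hs => ?_⟩
  have h1 : Summable fun n => ‖LSeries.term f s n‖ :=
    hf.norm.of_nonneg_of_le (fun _ => norm_nonneg _) (fun n => LSeries.norm_term_le_of_re_le_re f hs n)
  exact (norm_tsum_le_tsum_norm h1).trans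
    (h1.tsum_le_tsum (fun n => LSeries.norm_term_le_of_re_le_re f hs n) hf.norm)

/-- Uniform bounds for a Dirichlet L-function, its inverse, and its logarithmic derivative in a
half-plane of absolute convergence. -/
lemma exists_bounds_LFunction_of_le_re {N : ℕ} [NeZero N] (χ : DirichletCharacter ℂ N) :
    ∃ K : ℝ, 1 ≤ K ∧ ∀ s : ℂ, 11 / 10 ≤ s.re → ‖DirichletCharacter.LFunction χ s‖ ≤ K ∧
      1 ≤ K * ‖DirichletCharacter.LFunction χ s‖ ∧
      ‖deriv (DirichletCharacter.LFunction χ) s / DirichletCharacter.LFunction χ s‖ ≤ K := by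
  have h1 : (1 : ℝ) < ((11 / 10 : ℝ) : ℂ).re := by rw [ofReal_re]; norm_num
  obtain ⟨K1, hK1, h1'⟩ := exists_norm_LSeries_le
    (DirichletCharacter.LSeriesSummable_of_one_lt_re χ h1)
  obtain ⟨K2, hK2, h2'⟩ := exists_norm_LSeries_le (DirichletCharacter.LSeriesSummable_mul χ
    (ArithmeticFunction.LSeriesSummable_moebius_iff.mpr h1))
  obtain ⟨K3, hK3, h3'⟩ := exists_norm_LSeries_le
    (DirichletCharacter.LSeriesSummable_twist_vonMangoldt χ h1)
  simp only [ofReal_re] at h1' h2' h3'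
  refine ⟨1 + K1 + K2 + K3, by linarith, fun s hs => ?_⟩
  have hs1 : 1 < s.re := by linarith
  rw [DirichletCharacter.deriv_LFunction_eq_deriv_LSeries χ hs1,
    DirichletCharacter.LFunction_eq_LSeries χ hs1]
  refine ⟨by linarith [h1' s hs], ?_, ?_⟩
  · have := congrArg norm (DirichletCharacter.LSeries.mul_mu_eq_one χ hs1)
    rw [norm_mul, norm_one, mul_comm] at this
    nlinarith [h2' s hs, norm_nonneg (LSeries (fun n : ℕ => χ n) s)]
  · have := h3' s hs
    rw [DirichletCharacter.LSeries_twist_vonMangoldt_eq χ hs1, neg_div, norm_neg] at this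
    linarith

lemma LSeries_conj (f : ℕ → ℂ) (s : ℂ) :
    LSeries (fun n => (starRingEnd ℂ) (f n)) ((starRingEnd ℂ) s) =
      (starRingEnd ℂ) (LSeries f s) := by
  rw [LSeries, LSeries, Complex.conj_tsum]
  congr 1
  ext n
  rcases eq_or_ne n 0 with rfl | hn
  · simp
  · rw [LSeries.term_of_ne_zero hn, LSeries.term_of_ne_zero hn, map_div₀]
    congr 1
    rw [Complex.cpow_conj _ _ (by rw [Complex.natCast_arg]; exact Real.pi_ne_zero.symm), conj_natCast]

lemma LFunction_inv_conj {N : ℕ} [NeZero N] {χ : DirichletCharacter ℂ N} (hχ : χ ≠ 1) (s : ℂ) :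
    DirichletCharacter.LFunction χ⁻¹ ((starRingEnd ℂ) s) =
      (starRingEnd ℂ) (DirichletCharacter.LFunction χ s) := by
  have hχ' : χ⁻¹ ≠ 1 := inv_ne_one.mpr hχ
  have d1 : Differentiable ℂ (DirichletCharacter.LFunction χ) :=
    DirichletCharacter.differentiable_LFunction hχ
  have d2 : Differentiable ℂ (fun z => (starRingEnd ℂ)
      (DirichletCharacter.LFunction χ⁻¹ ((starRingEnd ℂ) z))) := fun z => by
    simpa only [conj_conj, Function.comp_def] using
      (DirichletCharacter.differentiable_LFunction hχ' ((starRingEnd ℂ) z)).conj_conj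
  have key : (fun z => (starRingEnd ℂ)
      (DirichletCharacter.LFunction χ⁻¹ ((starRingEnd ℂ) z))) = DirichletCharacter.LFunction χ := by
    refine AnalyticOnNhd.eq_of_eventuallyEq (z₀ := 2) (fun z _ => d2.analyticAt z)
      (fun z _ => d1.analyticAt z) ?_
    have : {z : ℂ | 1 < z.re} ∈ nhds (2 : ℂ) :=
      (isOpen_lt continuous_const continuous_re).mem_nhds (by simp)
    filter_upwards [this] with z hz
    rw [DirichletCharacter.LFunction_eq_LSeries χ hz,
      DirichletCharacter.LFunction_eq_LSeries χ⁻¹ (by simpa using hz), ← LSeries_conj]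
    simp only [conj_conj]
    congr 1
    ext n
    have := MulChar.star_apply' χ (n : ZMod N)
    rw [← this]
    simp
  rw [← key]
  simp

/-- Interpolation in the strip `1/2 ≤ Re s ≤ 5/2` between a bounded edge and an edge with quadratic
growth. -/
lemma norm_le_of_strip_growth {f : ℂ → ℂ} {K : ℝ}
    (hd : ∀ s : ℂ, 1 / 2 ≤ s.re → s.re ≤ 5 / 2 → DifferentiableAt ℂ f s)
    (h0 : ∀ t : ℝ, ‖f (1 / 2 + t * I)‖ ≤ 1) (h1 : ∀ t : ℝ, ‖f (5 / 2 + t * I)‖ ≤ (4 + |t|) ^ 2)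
    (hg : ∀ s : ℂ, 1 / 2 ≤ s.re → s.re ≤ 5 / 2 → ‖f s‖ ≤ K * Real.exp (2 * |s.im|))
    {a t : ℝ} (ha : 0 ≤ a) (ha2 : a ≤ 2) :
    ‖f (1 / 2 + a + t * I)‖ ≤ 2 * Real.exp 4 * (4 + |t|) ^ a := by
  have hK : 0 ≤ K := by
    have := (norm_nonneg _).trans (hg (1 / 2) (by norm_num) (by norm_num))
    have h2 : (1 / 2 : ℂ).im = 0 := by norm_num
    rw [h2] at this
    simpa using this
  set h : ℂ → ℂ := fun z => f (1 / 2 + 2 * z + t * I) * Complex.exp ((2 * z) ^ 2) with hh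
  have hre : ∀ z : ℂ, (1 / 2 + 2 * z + t * I).re = 1 / 2 + 2 * z.re := by intro z; norm_num
  have him : ∀ z : ℂ, (1 / 2 + 2 * z + t * I).im = 2 * z.im + t := by intro z; norm_num
  have hexp : ∀ z : ℂ, ‖Complex.exp ((2 * z) ^ 2)‖ = Real.exp (4 * z.re ^ 2 - 4 * z.im ^ 2) := by
    intro z
    rw [Complex.norm_exp]
    congr 1
    rw [sq, mul_re]
    simp
    ring
  have hdiff : DiffContOnCl ℂ h (Complex.HadamardThreeLines.verticalStrip 0 1) := by
    refine DifferentiableOn.diffContOnCl ?_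
    intro z hz
    have hz' : 0 ≤ z.re ∧ z.re ≤ 1 := by
      have hcl : closure (Complex.HadamardThreeLines.verticalStrip 0 1) ⊆ re ⁻¹' Set.Icc 0 1 :=
        closure_minimal (Set.preimage_mono Set.Ioo_subset_Icc_self) (isClosed_Icc.preimage continuous_re)
      exact hcl hz
    refine DifferentiableAt.differentiableWithinAt ?_
    refine DifferentiableAt.mul ?_ (by fun_prop)
    exact DifferentiableAt.fun_comp' z (hd _ (by rw [hre]; linarith) (by rw [hre]; linarith))
      (by fun_prop)
  have hbdd : BddAbove ((norm ∘ h) '' Complex.HadamardThreeLines.verticalClosedStrip 0 1) := by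
    refine ⟨K * Real.exp (2 * |t| + 5), ?_⟩
    rintro _ ⟨z, hz, rfl⟩
    have hz' : 0 ≤ z.re ∧ z.re ≤ 1 := hz
    simp only [Function.comp, hh, norm_mul, hexp]
    have := hg (1 / 2 + 2 * z + t * I) (by rw [hre]; linarith) (by rw [hre]; linarith)
    rw [him] at this
    calc _ ≤ K * Real.exp (2 * |2 * z.im + t|) * Real.exp (4 * z.re ^ 2 - 4 * z.im ^ 2) := by gcongr
      _ = K * Real.exp (2 * |2 * z.im + t| + (4 * z.re ^ 2 - 4 * z.im ^ 2)) := by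
        rw [mul_assoc, ← Real.exp_add]
      _ ≤ _ := by
        refine mul_le_mul_of_nonneg_left (Real.exp_le_exp.mpr ?_) hK
        have e1 : |2 * z.im + t| ≤ 2 * |z.im| + |t| := by
          refine (abs_add_le _ _).trans ?_
          rw [abs_mul]; simp
        have e2 : z.re ^ 2 ≤ 1 := by nlinarith
        nlinarith [sq_abs z.im, sq_nonneg (2 * |z.im| - 1)]
  have hA : ∀ z ∈ re ⁻¹' {0}, ‖h z‖ ≤ 1 := by
    intro z hz
    have hz' : z.re = 0 := hz
    have e : (1 / 2 + 2 * z + t * I : ℂ) = 1 / 2 + ((2 * z.im + t : ℝ) : ℂ) * I := by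
      apply Complex.ext <;> simp [hz']
    simp only [hh, norm_mul, hexp]
    rw [e, hz']
    have h2 := h0 (2 * z.im + t)
    have h3 : Real.exp (4 * (0 : ℝ) ^ 2 - 4 * z.im ^ 2) ≤ 1 := by
      rw [Real.exp_le_one_iff]; nlinarith [sq_nonneg z.im]
    calc _ ≤ (1 : ℝ) * 1 := by gcongr
      _ = 1 := one_mul 1
  have hB : ∀ z ∈ re ⁻¹' {1}, ‖h z‖ ≤ 2 * Real.exp 4 * (4 + |t|) ^ 2 := by
    intro z hz
    have hz' : z.re = 1 := hz
    have e : (1 / 2 + 2 * z + t * I : ℂ) = 5 / 2 + ((2 * z.im + t : ℝ) : ℂ) * I := by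
      apply Complex.ext <;> simp [hz'] ; norm_num
    simp only [hh, norm_mul, hexp]
    rw [e, hz']
    have h2 := h1 (2 * z.im + t)
    have e1 : |2 * z.im + t| ≤ 2 * |z.im| + |t| := by
      refine (abs_add_le _ _).trans ?_
      rw [abs_mul]; simp
    have e3 : 4 + |2 * z.im + t| ≤ (4 + |t|) * (1 + 2 * |z.im|) := by
      nlinarith [abs_nonneg z.im, abs_nonneg t]
    have e4 : (1 + 2 * |z.im|) ^ 2 ≤ 2 * Real.exp (4 * z.im ^ 2) := by
      have := Real.add_one_le_exp (4 * z.im ^ 2)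
      nlinarith [sq_abs z.im, sq_nonneg (2 * |z.im| - 1)]
    calc _ ≤ ((4 + |t|) * (1 + 2 * |z.im|)) ^ 2 * Real.exp (4 * 1 ^ 2 - 4 * z.im ^ 2) := by
          refine mul_le_mul_of_nonneg_right ?_ (Real.exp_pos _).le
          exact h2.trans (pow_le_pow_left₀ (by positivity) e3 2)
      _ = (4 + |t|) ^ 2 * (1 + 2 * |z.im|) ^ 2 * Real.exp (4 * 1 ^ 2 - 4 * z.im ^ 2) := by ring
      _ ≤ (4 + |t|) ^ 2 * (2 * Real.exp (4 * z.im ^ 2)) * Real.exp (4 * 1 ^ 2 - 4 * z.im ^ 2) := by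
          gcongr
      _ = 2 * (4 + |t|) ^ 2 * (Real.exp (4 * z.im ^ 2) * Real.exp (4 * 1 ^ 2 - 4 * z.im ^ 2)) := by
          ring
      _ = _ := by
          rw [← Real.exp_add]
          ring_nf
  have key := Complex.HadamardThreeLines.norm_le_interp_of_mem_verticalClosedStrip₀₁' h
    (z := ((a / 2 : ℝ) : ℂ)) (show ((a / 2 : ℝ) : ℂ).re ∈ Set.Icc 0 1 from by
      rw [ofReal_re]; constructor <;> linarith) hdiff hbdd hA hB
  simp only [hh, norm_mul, hexp, ofReal_re, ofReal_im, Real.one_rpow, one_mul] at key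
  have e : (1 / 2 + 2 * ((a / 2 : ℝ) : ℂ) + t * I : ℂ) = 1 / 2 + a + t * I := by
    push_cast; ring
  rw [e] at key
  have h4 : 1 ≤ Real.exp (4 * (a / 2) ^ 2 - 4 * 0 ^ 2) := Real.one_le_exp (by
    nlinarith [sq_nonneg a])
  have ht : 0 ≤ |t| := abs_nonneg t
  calc _ ≤ ‖f (1 / 2 + a + t * I)‖ * Real.exp (4 * (a / 2) ^ 2 - 4 * 0 ^ 2) :=
        le_mul_of_one_le_right (norm_nonneg _) h4
    _ ≤ _ := key
    _ = (2 * Real.exp 4) ^ (a / 2) * (4 + |t|) ^ a := by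
        rw [Real.mul_rpow (by positivity) (by positivity), ← Real.rpow_natCast (4 + |t|) 2,
          ← Real.rpow_mul (by positivity)]
        congr 2
        push_cast; ring
    _ ≤ _ := by
        gcongr
        have : (1 : ℝ) ≤ 2 * Real.exp 4 := by
          nlinarith [Real.add_one_le_exp (4 : ℝ)]
        exact (Real.rpow_le_rpow_of_exponent_le this (by linarith : a / 2 ≤ 1)).trans
          (by rw [Real.rpow_one])

lemma norm_Gamma_le {s : ℂ} (hs : 0 < s.re) : ‖Complex.Gamma s‖ ≤ Real.Gamma s.re := by
  rw [Complex.Gamma_eq_integral hs, Real.Gamma_eq_integral hs, Complex.GammaIntegral]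
  refine (MeasureTheory.norm_integral_le_integral_norm _).trans (le_of_eq ?_)
  refine MeasureTheory.setIntegral_congr_fun measurableSet_Ioi fun x hx => ?_
  have hx0 : (0 : ℝ) < x := hx
  rw [norm_mul, Complex.norm_cpow_eq_rpow_re_of_pos hx0, Complex.norm_real,
    Real.norm_of_nonneg (Real.exp_pos _).le]
  simp

lemma exists_norm_Gammaℂ_le : ∃ K : ℝ, 0 ≤ K ∧ ∀ s : ℂ, 1 / 2 ≤ s.re → s.re ≤ 5 / 2 →
    ‖Complex.Gammaℂ s‖ ≤ K := by
  have hc : ContinuousOn Real.Gamma (Set.Icc (1 / 2) (5 / 2)) := fun x hx =>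
    (Real.differentiableAt_Gamma fun m => by
      have := hx.1; have : (0 : ℝ) ≤ m := Nat.cast_nonneg m; linarith).continuousAt.continuousWithinAt
  obtain ⟨K, hK⟩ := isCompact_Icc.exists_bound_of_continuousOn hc
  have hK0 : 0 ≤ K := (norm_nonneg _).trans (hK 1 (by norm_num))
  refine ⟨2 * K, by linarith, fun s h1 h2 => ?_⟩
  have hs : 0 < s.re := by linarith
  rw [Complex.Gammaℂ_def, norm_mul, norm_mul]
  have e1 : ‖(2 * (Real.pi : ℂ)) ^ (-s)‖ ≤ 1 := by
    have : (2 * (Real.pi : ℂ)) = ((2 * Real.pi : ℝ) : ℂ) := by push_cast; rfl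
    rw [this, Complex.norm_cpow_eq_rpow_re_of_pos (by positivity)]
    exact Real.rpow_le_one_of_one_le_of_nonpos (by linarith [Real.pi_gt_three])
      (by simp; linarith)
  have e2 := (norm_Gamma_le hs).trans ((le_abs_self _).trans (hK s.re ⟨h1, h2⟩))
  rw [show ‖(2 : ℂ)‖ = 2 by norm_num]
  nlinarith [norm_nonneg ((2 * (Real.pi : ℂ)) ^ (-s)), norm_nonneg (Complex.Gamma s)]

lemma norm_cos_le_exp (z : ℂ) : ‖Complex.cos z‖ ≤ Real.exp |z.im| := by
  rw [Complex.cos, norm_div]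
  have h1 : ‖Complex.exp (z * I)‖ ≤ Real.exp |z.im| := by
    rw [Complex.norm_exp]; gcongr; simp; exact neg_le_abs _
  have h2 : ‖Complex.exp (-z * I)‖ ≤ Real.exp |z.im| := by
    rw [Complex.norm_exp]; gcongr; simp; exact le_abs_self _
  have h3 := norm_add_le (Complex.exp (z * I)) (Complex.exp (-z * I))
  rw [show ‖(2 : ℂ)‖ = 2 by norm_num]
  linarith

lemma norm_sin_le_exp (z : ℂ) : ‖Complex.sin z‖ ≤ Real.exp |z.im| := by
  have := norm_cos_le_exp (z - Real.pi / 2)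
  rw [Complex.cos_sub_pi_div_two] at this
  simpa using this

lemma norm_Gammaℝ_conj (s : ℂ) : ‖Complex.Gammaℝ ((starRingEnd ℂ) s)‖ = ‖Complex.Gammaℝ s‖ := by
  rw [Complex.Gammaℝ_def, Complex.Gammaℝ_def, norm_mul, norm_mul,
    Complex.norm_cpow_eq_rpow_re_of_pos Real.pi_pos, Complex.norm_cpow_eq_rpow_re_of_pos Real.pi_pos]
  have : (starRingEnd ℂ) s / 2 = (starRingEnd ℂ) (s / 2) := by
    rw [map_div₀, Complex.conj_ofNat]
  rw [this, Complex.Gamma_conj, RCLike.norm_conj]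
  simp

lemma norm_Gammaℝ_le_of_even {a t : ℝ} (ha : 0 ≤ a) (ha' : a ≤ 1 / 8) :
    ‖Complex.Gammaℝ (1 / 2 + a + t * I)‖ ≤
      2 * Real.exp 4 * (4 + |t|) ^ a * ‖Complex.Gammaℝ (1 - (1 / 2 + a + t * I))‖ := by
  obtain ⟨K, hK, hKb⟩ := exists_norm_Gammaℂ_le
  have hne : ∀ s : ℂ, 1 / 2 ≤ s.re → ∀ n : ℕ, s ≠ -(2 * n + 1) := by
    rintro s hs n rfl
    have h0 : (0 : ℝ) ≤ n := Nat.cast_nonneg n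
    simp at hs
    linarith
  have hpi : (3 : ℝ) < Real.pi := Real.pi_gt_three
  have hhalf : ∀ t : ℝ, ‖Complex.Gammaℝ (1 / 2 + t * I)‖ = ‖Complex.Gammaℝ (1 - (1 / 2 + t * I))‖ := by
    intro t
    rw [← norm_Gammaℝ_conj]
    congr 2
    apply Complex.ext <;> simp <;> norm_num
  have hpos : ∀ t : ℝ, 0 < ‖Complex.Gammaℝ (1 / 2 + t * I)‖ := fun t =>
    norm_pos_iff.mpr (Complex.Gammaℝ_ne_zero_of_re_pos (by norm_num))
  have key := norm_le_of_strip_growth (f := fun s => Complex.Gammaℂ s * Complex.cos (Real.pi * s / 2))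
    (K := K) ?_ ?_ ?_ ?_ (t := t) ha (by linarith)
  · rw [← Complex.Gammaℝ_div_Gammaℝ_one_sub (hne _ (by simp; exact ha)), norm_div] at key
    rwa [div_le_iff₀] at key
    exact norm_pos_iff.mpr (Complex.Gammaℝ_ne_zero_of_re_pos (by norm_num; linarith))
  · intro s h1 h2
    refine DifferentiableAt.mul ?_ (by fun_prop)
    have hG : DifferentiableAt ℂ Complex.Gamma s := Complex.differentiableAt_Gamma s fun m h => by
      have : (0 : ℝ) ≤ m := Nat.cast_nonneg m
      rw [h] at h1; simp at h1; linarith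
    have : DifferentiableAt ℂ (fun s => 2 * (2 * (Real.pi : ℂ)) ^ (-s) * Complex.Gamma s) s := by
      refine DifferentiableAt.mul (DifferentiableAt.const_mul ?_ _) hG
      exact (by fun_prop : DifferentiableAt ℂ (fun s : ℂ => -s) s).const_cpow (Or.inl (by
        simp [Real.pi_ne_zero]))
    exact this
  · intro t
    rw [← Complex.Gammaℝ_div_Gammaℝ_one_sub (hne _ (by simp)), norm_div, hhalf, div_self]
    rw [← hhalf]; exact (hpos t).ne'
  · intro t
    rw [← Complex.Gammaℝ_div_Gammaℝ_one_sub (hne _ (by norm_num)), norm_div]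
    have e1 : (5 / 2 + t * I : ℂ) = (1 / 2 + t * I) + 2 := by ring
    have e2 : Complex.Gammaℝ (1 - (1 / 2 + t * I)) = Complex.Gammaℝ (1 - (5 / 2 + t * I)) *
        (1 - (5 / 2 + t * I)) / 2 / Real.pi := by
      rw [← Complex.Gammaℝ_add_two]
      · congr 1; ring
      · intro h
        have := congrArg re h
        norm_num at this
    have e3 : ‖Complex.Gammaℝ (5 / 2 + t * I)‖ = ‖Complex.Gammaℝ (1 / 2 + t * I)‖ *
        ‖(1 / 2 + t * I : ℂ)‖ / 2 / Real.pi := by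
      rw [e1, Complex.Gammaℝ_add_two]
      · simp [abs_of_pos Real.pi_pos]
      · intro h
        have := congrArg re h
        norm_num at this
    have e4 : ‖Complex.Gammaℝ (1 / 2 + t * I)‖ = ‖Complex.Gammaℝ (1 - (5 / 2 + t * I))‖ *
        ‖(1 - (5 / 2 + t * I) : ℂ)‖ / 2 / Real.pi := by
      rw [hhalf, e2]
      simp [abs_of_pos Real.pi_pos]
    have n1 : ‖(1 / 2 + t * I : ℂ)‖ ≤ 4 + |t| := by
      refine (norm_add_le _ _).trans ?_
      simp; norm_num
    have n2 : ‖(1 - (5 / 2 + t * I) : ℂ)‖ ≤ 4 + |t| := by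
      rw [show (1 - (5 / 2 + t * I) : ℂ) = ((-3 / 2 : ℝ) : ℂ) + ((-t : ℝ) : ℂ) * I by
        push_cast; ring]
      refine (norm_add_le _ _).trans ?_
      rw [norm_mul, norm_real, norm_real, norm_I, mul_one, norm_neg, Real.norm_eq_abs,
        Real.norm_eq_abs]
      gcongr
      norm_num [abs_div]
    have hp : 0 < ‖Complex.Gammaℝ (1 - (5 / 2 + t * I))‖ := by
      rcases (norm_nonneg (Complex.Gammaℝ (1 - (5 / 2 + t * I)))).eq_or_lt with h | h
      · rw [← h] at e4
        have := hpos t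
        rw [e4] at this
        simp at this
      · exact h
    rw [e3, e4, div_le_iff₀ hp]
    have : ‖Complex.Gammaℝ (1 - (5 / 2 + t * I))‖ * ‖(1 - (5 / 2 + t * I) : ℂ)‖ / 2 / Real.pi *
        ‖(1 / 2 + t * I : ℂ)‖ / 2 / Real.pi = ‖(1 / 2 + t * I : ℂ)‖ * ‖(1 - (5 / 2 + t * I) : ℂ)‖ *
          ‖Complex.Gammaℝ (1 - (5 / 2 + t * I))‖ * (1 / (4 * Real.pi ^ 2)) := by
      field_simp
      ring
    rw [this]
    have h5 : 1 / (4 * Real.pi ^ 2) ≤ 1 := by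
      rw [div_le_one (by positivity)]; nlinarith
    calc _ ≤ (4 + |t|) * (4 + |t|) * ‖Complex.Gammaℝ (1 - (5 / 2 + t * I))‖ * 1 := by gcongr
      _ = _ := by ring
  · intro s h1 h2
    rw [norm_mul]
    refine mul_le_mul (hKb s h1 h2) ((norm_cos_le_exp _).trans ?_) (norm_nonneg _) hK
    rw [Real.exp_le_exp]
    have : (Real.pi * s / 2).im = Real.pi / 2 * s.im := by
      simp; ring
    rw [this, abs_mul, abs_of_pos (by positivity)]
    have := Real.pi_lt_four
    gcongr
    linarith

lemma norm_Gammaℝ_le_of_odd {a t : ℝ} (ha : 0 ≤ a) (ha' : a ≤ 1 / 8) :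
    ‖Complex.Gammaℝ (1 / 2 + a + t * I + 1)‖ ≤
      2 * Real.exp 4 * (4 + |t|) ^ a * ‖Complex.Gammaℝ (2 - (1 / 2 + a + t * I))‖ := by
  obtain ⟨K, hK, hKb⟩ := exists_norm_Gammaℂ_le
  have hrefl : ∀ s : ℂ, 1 / 2 ≤ s.re → Complex.Gammaℝ (s + 1) / Complex.Gammaℝ (2 - s) =
      Complex.Gammaℂ s * Complex.sin (Real.pi * s / 2) := by
    intro s hs
    rw [div_eq_mul_inv, Complex.inv_Gammaℝ_two_sub, mul_comm, mul_assoc, inv_mul_cancel₀, mul_one]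
    · exact Complex.Gammaℝ_ne_zero_of_re_pos (by simp; linarith)
    · rintro n rfl
      have h0 : (0 : ℝ) ≤ n := Nat.cast_nonneg n
      simp at hs
      linarith
  have hpi : (3 : ℝ) < Real.pi := Real.pi_gt_three
  have hhalf : ∀ t : ℝ, ‖Complex.Gammaℝ (1 / 2 + t * I + 1)‖ = ‖Complex.Gammaℝ (2 - (1 / 2 + t * I))‖ := by
    intro t
    rw [← norm_Gammaℝ_conj]
    congr 2
    apply Complex.ext <;> simp <;> norm_num
  have hpos : ∀ t : ℝ, 0 < ‖Complex.Gammaℝ (1 / 2 + t * I + 1)‖ := fun t =>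
    norm_pos_iff.mpr (Complex.Gammaℝ_ne_zero_of_re_pos (by norm_num))
  have key := norm_le_of_strip_growth (f := fun s => Complex.Gammaℂ s * Complex.sin (Real.pi * s / 2))
    (K := K) ?_ ?_ ?_ ?_ (t := t) ha (by linarith)
  · rw [← hrefl _ (by simp; exact ha), norm_div] at key
    rwa [div_le_iff₀] at key
    exact norm_pos_iff.mpr (Complex.Gammaℝ_ne_zero_of_re_pos (by norm_num; linarith))
  · intro s h1 h2
    refine DifferentiableAt.mul ?_ (by fun_prop)
    have hG : DifferentiableAt ℂ Complex.Gamma s := Complex.differentiableAt_Gamma s fun m h => by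
      have : (0 : ℝ) ≤ m := Nat.cast_nonneg m
      rw [h] at h1; simp at h1; linarith
    have : DifferentiableAt ℂ (fun s => 2 * (2 * (Real.pi : ℂ)) ^ (-s) * Complex.Gamma s) s := by
      refine DifferentiableAt.mul (DifferentiableAt.const_mul ?_ _) hG
      exact (by fun_prop : DifferentiableAt ℂ (fun s : ℂ => -s) s).const_cpow (Or.inl (by
        simp [Real.pi_ne_zero]))
    exact this
  · intro t
    rw [← hrefl _ (by simp), norm_div, hhalf, div_self]
    rw [← hhalf]; exact (hpos t).ne'
  · intro t
    rw [← hrefl _ (by norm_num), norm_div]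
    have e1 : (5 / 2 + t * I + 1 : ℂ) = (1 / 2 + t * I + 1) + 2 := by ring
    have e2 : Complex.Gammaℝ (2 - (1 / 2 + t * I)) = Complex.Gammaℝ (2 - (5 / 2 + t * I)) *
        (2 - (5 / 2 + t * I)) / 2 / Real.pi := by
      rw [← Complex.Gammaℝ_add_two]
      · congr 1; ring
      · intro h
        have := congrArg re h
        norm_num at this
    have e3 : ‖Complex.Gammaℝ (5 / 2 + t * I + 1)‖ = ‖Complex.Gammaℝ (1 / 2 + t * I + 1)‖ *
        ‖(1 / 2 + t * I + 1 : ℂ)‖ / 2 / Real.pi := by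
      rw [e1, Complex.Gammaℝ_add_two]
      · simp [abs_of_pos Real.pi_pos]
      · intro h
        have := congrArg re h
        norm_num at this
    have e4 : ‖Complex.Gammaℝ (1 / 2 + t * I + 1)‖ = ‖Complex.Gammaℝ (2 - (5 / 2 + t * I))‖ *
        ‖(2 - (5 / 2 + t * I) : ℂ)‖ / 2 / Real.pi := by
      rw [hhalf, e2]
      simp [abs_of_pos Real.pi_pos]
    have n1 : ‖(1 / 2 + t * I + 1 : ℂ)‖ ≤ 4 + |t| := by
      rw [show (1 / 2 + t * I + 1 : ℂ) = ((3 / 2 : ℝ) : ℂ) + (t : ℂ) * I by push_cast; ring]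
      refine (norm_add_le _ _).trans ?_
      rw [norm_mul, norm_real, norm_real, norm_I, mul_one, Real.norm_eq_abs, Real.norm_eq_abs]
      gcongr
      norm_num [abs_div]
    have n2 : ‖(2 - (5 / 2 + t * I) : ℂ)‖ ≤ 4 + |t| := by
      rw [show (2 - (5 / 2 + t * I) : ℂ) = ((-1 / 2 : ℝ) : ℂ) + ((-t : ℝ) : ℂ) * I by
        push_cast; ring]
      refine (norm_add_le _ _).trans ?_
      rw [norm_mul, norm_real, norm_real, norm_I, mul_one, norm_neg, Real.norm_eq_abs,
        Real.norm_eq_abs]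
      gcongr
      norm_num [abs_div]
    have hp : 0 < ‖Complex.Gammaℝ (2 - (5 / 2 + t * I))‖ := by
      rcases (norm_nonneg (Complex.Gammaℝ (2 - (5 / 2 + t * I)))).eq_or_lt with h | h
      · rw [← h] at e4
        have := hpos t
        rw [e4] at this
        simp at this
      · exact h
    rw [e3, e4, div_le_iff₀ hp]
    have : ‖Complex.Gammaℝ (2 - (5 / 2 + t * I))‖ * ‖(2 - (5 / 2 + t * I) : ℂ)‖ / 2 / Real.pi *
        ‖(1 / 2 + t * I + 1 : ℂ)‖ / 2 / Real.pi = ‖(1 / 2 + t * I + 1 : ℂ)‖ * ‖(2 - (5 / 2 + t * I) : ℂ)‖ *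
          ‖Complex.Gammaℝ (2 - (5 / 2 + t * I))‖ * (1 / (4 * Real.pi ^ 2)) := by
      field_simp
      ring
    rw [this]
    have h5 : 1 / (4 * Real.pi ^ 2) ≤ 1 := by
      rw [div_le_one (by positivity)]; nlinarith
    calc _ ≤ (4 + |t|) * (4 + |t|) * ‖Complex.Gammaℝ (2 - (5 / 2 + t * I))‖ * 1 := by gcongr
      _ = _ := by ring
  · intro s h1 h2
    rw [norm_mul]
    refine mul_le_mul (hKb s h1 h2) ((norm_sin_le_exp _).trans ?_) (norm_nonneg _) hK
    rw [Real.exp_le_exp]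
    have : (Real.pi * s / 2).im = Real.pi / 2 * s.im := by
      simp; ring
    rw [this, abs_mul, abs_of_pos (by positivity)]
    have := Real.pi_lt_four
    gcongr
    linarith

lemma gammaFactor_inv {N : ℕ} (χ : DirichletCharacter ℂ N) (s : ℂ) :
    DirichletCharacter.gammaFactor χ⁻¹ s = DirichletCharacter.gammaFactor χ s := by
  have : χ⁻¹.Even ↔ χ.Even := by
    rw [DirichletCharacter.Even, DirichletCharacter.Even, MulChar.inv_apply_eq_inv', inv_eq_one]
  simp only [DirichletCharacter.gammaFactor, this]

lemma norm_gammaFactor_le {N : ℕ} (χ : DirichletCharacter ℂ N) {a t : ℝ} (ha : 0 ≤ a)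
    (ha' : a ≤ 1 / 8) : ‖DirichletCharacter.gammaFactor χ (1 / 2 + a + t * I)‖ ≤
      2 * Real.exp 4 * (4 + |t|) ^ a *
        ‖DirichletCharacter.gammaFactor χ (1 - (1 / 2 + a + t * I))‖ := by
  simp only [DirichletCharacter.gammaFactor]
  split_ifs
  · exact norm_Gammaℝ_le_of_even ha ha'
  · have := norm_Gammaℝ_le_of_odd (t := t) ha ha'
    rwa [show (2 - (1 / 2 + a + t * I) : ℂ) = 1 - (1 / 2 + a + t * I) + 1 by ring] at this

/-- Comparison of a primitive L-function on the two sides of the critical line. -/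
lemma exists_norm_LFunction_half_sub_le {N : ℕ} [NeZero N] {χ : DirichletCharacter ℂ N} (hχ : χ ≠ 1)
    (hp : χ.IsPrimitive) : ∃ C : ℝ, 1 ≤ C ∧ ∀ a t : ℝ, 0 ≤ a → a ≤ 1 / 8 →
      ‖DirichletCharacter.LFunction χ (1 / 2 - a + t * I)‖ ≤
        C * (4 + |t|) ^ a * ‖DirichletCharacter.LFunction χ (1 / 2 + a + t * I)‖ := by
  have hN : N ≠ 1 := by
    rintro rfl
    exact hχ (DirichletCharacter.level_one χ)
  have hN1 : (1 : ℝ) ≤ N := by exact_mod_cast NeZero.one_le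
  refine ⟨1 + N * ‖DirichletCharacter.rootNumber χ‖ * (2 * Real.exp 4), by
    have : 0 ≤ N * ‖DirichletCharacter.rootNumber χ‖ * (2 * Real.exp 4) := by positivity
    linarith, fun a t ha ha' => ?_⟩
  set s : ℂ := 1 / 2 + a + ((-t : ℝ) : ℂ) * I with hs
  have h1s : (1 / 2 - a + t * I : ℂ) = 1 - s := by rw [hs]; push_cast; ring
  have hsc : (1 / 2 + a + t * I : ℂ) = (starRingEnd ℂ) s := by
    apply Complex.ext <;> simp [hs]
  have hγ : ∀ w : ℂ, 0 < w.re → DirichletCharacter.gammaFactor χ w ≠ 0 := by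
    intro w hw
    rw [DirichletCharacter.gammaFactor]
    split_ifs
    · exact Complex.Gammaℝ_ne_zero_of_re_pos hw
    · exact Complex.Gammaℝ_ne_zero_of_re_pos (by simp; linarith)
  have hsre : s.re = 1 / 2 + a := by simp [hs]
  have h1 : DirichletCharacter.completedLFunction χ⁻¹ s =
      DirichletCharacter.LFunction χ⁻¹ s * DirichletCharacter.gammaFactor χ s := by
    rw [DirichletCharacter.LFunction_eq_completed_div_gammaFactor χ⁻¹ s (Or.inr hN), gammaFactor_inv,
      div_mul_cancel₀ _ (hγ s (by rw [hsre]; linarith))]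
  have h2 : ‖DirichletCharacter.LFunction χ⁻¹ s‖ =
      ‖DirichletCharacter.LFunction χ (1 / 2 + a + t * I)‖ := by
    have := LFunction_inv_conj hχ ((starRingEnd ℂ) s)
    rw [conj_conj] at this
    rw [this, RCLike.norm_conj, hsc]
  have h3 := norm_gammaFactor_le χ (t := -t) ha ha'
  rw [← hs, abs_neg] at h3
  have hγ1 : 0 < ‖DirichletCharacter.gammaFactor χ (1 - s)‖ :=
    norm_pos_iff.mpr (hγ _ (by rw [sub_re, hsre, one_re]; linarith))
  have hNp : ‖(N : ℂ) ^ (s - 1 / 2)‖ ≤ N := by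
    rw [Complex.norm_natCast_cpow_of_pos (Nat.pos_of_ne_zero (NeZero.ne N))]
    have : (s - 1 / 2).re ≤ 1 := by
      rw [sub_re, hsre]; norm_num; linarith
    exact (Real.rpow_le_rpow_of_exponent_le hN1 this).trans (by rw [Real.rpow_one])
  rw [h1s, DirichletCharacter.LFunction_eq_completed_div_gammaFactor χ _ (Or.inr hN),
    hp.completedLFunction_one_sub, h1, norm_div, div_le_iff₀ hγ1, norm_mul, norm_mul, norm_mul, h2]
  have ht : 0 ≤ |t| := abs_nonneg t
  set X := ‖DirichletCharacter.LFunction χ (1 / 2 + a + t * I)‖ with hX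
  have hX0 : 0 ≤ X := norm_nonneg _
  calc _ ≤ N * ‖DirichletCharacter.rootNumber χ‖ * (X *
        (2 * Real.exp 4 * (4 + |t|) ^ a * ‖DirichletCharacter.gammaFactor χ (1 - s)‖)) := by
        gcongr
    _ = (N * ‖DirichletCharacter.rootNumber χ‖ * (2 * Real.exp 4)) *
        ((4 + |t|) ^ a * X * ‖DirichletCharacter.gammaFactor χ (1 - s)‖) := by ring
    _ ≤ (1 + N * ‖DirichletCharacter.rootNumber χ‖ * (2 * Real.exp 4)) *
        ((4 + |t|) ^ a * X * ‖DirichletCharacter.gammaFactor χ (1 - s)‖) := by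
        gcongr
        linarith
    _ = _ := by ring

/-- The maximum modulus principle on a closed rectangle. -/
lemma norm_le_of_rectangle_boundary {f : ℂ → ℂ} {a b c d B : ℝ} (hab : a < b) (hcd : c < d)
    (hf : Differentiable ℂ f)
    (hB : ∀ w : ℂ, w.re ∈ Set.Icc a b → w.im ∈ Set.Icc c d →
      (w.re = a ∨ w.re = b ∨ w.im = c ∨ w.im = d) → ‖f w‖ ≤ B) {s : ℂ}
    (hs : s.re ∈ Set.Icc a b) (hs' : s.im ∈ Set.Icc c d) : ‖f s‖ ≤ B := by
  have hcl : closure (Set.Ioo a b ×ℂ Set.Ioo c d) = Set.Icc a b ×ℂ Set.Icc c d := by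
    rw [Complex.closure_reProdIm, closure_Ioo hab.ne, closure_Ioo hcd.ne]
  have hop : IsOpen (Set.Ioo a b ×ℂ Set.Ioo c d) := isOpen_Ioo.reProdIm isOpen_Ioo
  refine Complex.norm_le_of_forall_mem_frontier_norm_le (U := Set.Ioo a b ×ℂ Set.Ioo c d)
    ?_ hf.diffContOnCl ?_ ?_
  · exact (Metric.isBounded_Ioo a b).reProdIm (Metric.isBounded_Ioo c d)
  · intro w hw
    rw [frontier, hcl, hop.interior_eq] at hw
    obtain ⟨⟨h1, h2⟩, h3⟩ := hw
    refine hB w h1 h2 ?_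
    by_contra hcon
    push Not at hcon
    exact h3 ⟨⟨lt_of_le_of_ne h1.1 (Ne.symm hcon.1), lt_of_le_of_ne h1.2 hcon.2.1⟩,
      ⟨lt_of_le_of_ne h2.1 (Ne.symm hcon.2.2.1), lt_of_le_of_ne h2.2 hcon.2.2.2⟩⟩
  · rw [hcl]; exact ⟨hs, hs'⟩

/-- If `L` is bounded by `exp Ψ` to the right of the critical line up to height `H`, then slightly
away from the critical line it is bounded by about `exp (Ψ / 4)`. -/
lemma norm_le_exp_quarter {L : ℂ → ℂ} {K Ψ M H : ℝ} (hL : Differentiable ℂ L)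
    (hne : ∀ s : ℂ, 1 / 2 < s.re → L s ≠ 0) (hK1 : 1 ≤ K)
    (hK : ∀ s : ℂ, 11 / 10 ≤ s.re → ‖L s‖ ≤ K ∧ 1 ≤ K * ‖L s‖ ∧ ‖deriv L s / L s‖ ≤ K)
    (hX : 700 ≤ Real.log M) (hXK : 26 * Real.log K ≤ Real.log M) (hMK : K ^ 2 ≤ M)
    (hΨ : √M ≤ Ψ)
    (hb : ∀ s : ℂ, 1 / 2 ≤ s.re → |s.im| ≤ H → ‖L s‖ ≤ Real.exp Ψ) {s : ℂ}
    (hs : 1 / 2 + 13 / Real.log M ≤ s.re) (hs' : |s.im| ≤ H - 3 / 2) :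
    ‖L s‖ ≤ Real.exp (Ψ / 4 + 2 * Real.log K) := by
  set X := Real.log M with hXdef
  have hK0 : 0 < K := by linarith
  have hlK : 0 ≤ Real.log K := Real.log_nonneg hK1
  have hM0 : 0 < M := by nlinarith
  have hsM : K ≤ √M := Real.le_sqrt_of_sq_le hMK
  have hsM0 : 0 < √M := hK0.trans_le hsM
  have hΨ0 : 0 < Ψ := hsM0.trans_le hΨ
  have hX0 : 0 < X := by linarith
  have hδ : 13 / X ≤ 1 / 8 := by rw [div_le_iff₀ hX0]; linarith
  have hδ0 : 0 < 13 / X := by positivity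
  have hlog : 0 < Ψ / 4 := by linarith
  rcases le_or_gt s.re 2 with h2 | h2
  · set z₀ : ℂ := 2 + s.im * I with hz₀
    have hz₀re : z₀.re = 2 := by simp [hz₀]
    have hz₀im : z₀.im = s.im := by simp [hz₀]
    have hQ : √M ≤ Ψ + Real.log K := by linarith
    have hre : ∀ w : ℂ, ‖w - z₀‖ ≤ 9 / 10 → 11 / 10 ≤ w.re := fun w hw => by
      have := (abs_le.1 ((abs_re_le_norm _).trans hw)).1
      rw [sub_re, hz₀re] at this
      linarith
    have hre' : ∀ w : ℂ, ‖w - z₀‖ < 3 / 2 → 1 / 2 < w.re := fun w hw => by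
      have := (abs_le.1 ((abs_re_le_norm _).trans hw.le)).1
      have h3 := (abs_lt.1 ((abs_re_le_norm _).trans_lt hw)).1
      rw [sub_re, hz₀re] at h3
      linarith
    obtain ⟨k1, k2, -⟩ := hK z₀ (by rw [hz₀re]; norm_num)
    have hη : (K / (Ψ + Real.log K)) ^ (13 / X / 2) ≤ 1 / 16 := by
      calc (K / (Ψ + Real.log K)) ^ (13 / X / 2) ≤ (K / √M) ^ (13 / X / 2) := by gcongr
        _ = Real.exp ((Real.log K - X / 2) * (13 / X / 2)) := by
          rw [Real.rpow_def_of_pos (by positivity), Real.log_div hK0.ne' hsM0.ne',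
            Real.log_sqrt hM0.le]
        _ ≤ Real.exp (-3) := by
          rw [Real.exp_le_exp]
          have : (Real.log K - X / 2) * (13 / X / 2) = (13 * Real.log K / 2 - 13 / 4 * X) / X := by
            field_simp
            ring
          rw [this, div_le_iff₀ hX0]
          linarith
        _ ≤ 1 / 16 := by
          rw [Real.exp_neg, ← one_div]
          refine one_div_le_one_div_of_le (by norm_num) ?_
          have := Real.exp_one_gt_d9
          calc (16 : ℝ) ≤ 2.7 ^ 3 := by norm_num
            _ ≤ Real.exp 1 ^ 3 := by gcongr; linarith
            _ = Real.exp 3 := by rw [← Real.exp_nat_mul]; norm_num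
    have key := (norm_div_bounds_of_nonvanishing (G := L) (z₀ := z₀) (z := s) (Q := Ψ + Real.log K)
      (B := K) (δ := 13 / X) hK0 (hsM.trans hQ) (fun w _ => hL w) (fun w hw => hne w (hre' w hw))
      ?_ (fun w hw => (hK w (hre w hw)).2.2) hδ0 (by linarith) ?_ (by linarith)).1
    · refine key.trans ?_
      calc ‖L z₀‖ * Real.exp (4 * (Ψ + Real.log K) * (K / (Ψ + Real.log K)) ^ (13 / X / 2))
          ≤ K * Real.exp (4 * (Ψ + Real.log K) * (1 / 16)) := by
            gcongr
        _ = Real.exp (Real.log K + 4 * (Ψ + Real.log K) * (1 / 16)) := by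
            rw [Real.exp_add, Real.exp_log hK0]
        _ ≤ _ := by
            rw [Real.exp_le_exp]; linarith
    · intro w hw
      have him : |w.im| ≤ H := by
        have h3 := (abs_im_le_norm _).trans hw.le
        rw [sub_im, hz₀im] at h3
        have := abs_sub_abs_le_abs_sub w.im s.im
        linarith
      rw [Real.exp_add, Real.exp_log hK0]
      calc _ ≤ Real.exp Ψ := hb w (hre' w hw).le him
        _ ≤ Real.exp Ψ * (K * ‖L z₀‖) := le_mul_of_one_le_right (Real.exp_pos _).le k2
        _ = _ := by ring
    · have : s - z₀ = ((s.re - 2 : ℝ) : ℂ) := by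
        apply Complex.ext <;> simp [hz₀]
      rw [this, norm_real, Real.norm_eq_abs, abs_le]
      constructor <;> linarith
  · refine (hK s (by linarith)).1.trans ?_
    rw [← Real.log_le_iff_le_exp hK0]
    linarith

set_option maxHeartbeats 800000 in
/-- One step in the proof of Littlewood's bound. -/
lemma norm_le_exp_step {L : ℂ → ℂ} {K C₁ C₂ Ψ T M H : ℝ} (hL : Differentiable ℂ L)
    (hne : ∀ s : ℂ, 1 / 2 < s.re → L s ≠ 0) (hK1 : 1 ≤ K) (hC₂ : 1 ≤ C₂)
    (hK : ∀ s : ℂ, 11 / 10 ≤ s.re → ‖L s‖ ≤ K ∧ 1 ≤ K * ‖L s‖ ∧ ‖deriv L s / L s‖ ≤ K)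
    (h1 : ∀ s : ℂ, 0 < s.re → ‖L s‖ ≤ C₁ * ‖s‖ / s.re)
    (h2 : ∀ a t : ℝ, 0 ≤ a → a ≤ 1 / 8 → ‖L (1 / 2 - a + t * I)‖ ≤
      C₂ * (4 + |t|) ^ a * ‖L (1 / 2 + a + t * I)‖)
    (hT : 4 ≤ T) (hMT : M = Real.log T) (hC₁ : 0 ≤ C₁) (hTC : C₁ * (1 + 6 * T) ≤ T ^ 2)
    (hX : 700 ≤ Real.log M) (hXK : 26 * Real.log K ≤ Real.log M) (hMK : K ^ 2 ≤ M)
    (hMX : 2 * Real.log K + Real.log C₂ ≤ M / Real.log M)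
    (hΨ : √M ≤ Ψ) (hH : H ≤ 2 * T)
    (hb : ∀ s : ℂ, 1 / 2 ≤ s.re → |s.im| ≤ H → ‖L s‖ ≤ Real.exp Ψ) {s : ℂ}
    (hs : 1 / 2 ≤ s.re) (hs' : |s.im| ≤ H - 3) :
    ‖L s‖ ≤ Real.exp (Ψ / 4 + 28 * (M / Real.log M)) := by
  have hquart := fun s => norm_le_exp_quarter (s := s) hL hne hK1 hK hX hXK hMK hΨ hb
  set X := Real.log M with hXdef
  have hX0 : 0 < X := by linarith
  have hM0 : 0 < M := by nlinarith
  have hMX0 : 0 < M / X := by positivity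
  have hlC₂ : 0 ≤ Real.log C₂ := Real.log_nonneg hC₂
  have hlK : 0 ≤ Real.log K := Real.log_nonneg hK1
  have hΨ0 : 0 ≤ Ψ := (Real.sqrt_nonneg _).trans hΨ
  set δ := 13 / X with hδdef
  have hδ : δ ≤ 1 / 8 := by rw [hδdef, div_le_iff₀ hX0]; linarith
  have hδ0 : 0 < δ := by positivity
  have hT0 : 0 < T := by linarith
  rcases le_or_gt (1 / 2 + δ) s.re with hc | hc
  · refine (hquart s hc (by linarith)).trans ?_
    rw [Real.exp_le_exp]
    linarith
  set t := s.im with ht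
  set f : ℂ → ℂ := fun w => L w * Complex.exp (4 * M * (w - (1 / 2 + t * I)) ^ 2) with hf
  have hexp : ∀ w : ℂ, ‖Complex.exp (4 * M * (w - (1 / 2 + t * I)) ^ 2)‖ =
      Real.exp (4 * M * ((w.re - 1 / 2) ^ 2 - (w.im - t) ^ 2)) := by
    intro w
    rw [Complex.norm_exp]
    congr 1
    rw [sq, mul_assoc, show (4 : ℂ) = ((4 : ℝ) : ℂ) by norm_num, re_ofReal_mul, re_ofReal_mul, mul_re]
    simp
    ring
  have hMδ : 4 * M * δ ^ 2 ≤ M / X := by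
    have : 4 * M * δ ^ 2 = M / X * (676 / X) := by rw [hδdef]; field_simp; ring
    rw [this]
    refine mul_le_of_le_one_right hMX0.le ?_
    rw [div_le_one hX0]; linarith
  have hpow : ∀ y : ℝ, |y| ≤ 2 * T → (4 + |y|) ^ δ ≤ Real.exp (26 * (M / X)) := by
    intro y hy
    have h3 : 4 + |y| ≤ T ^ 2 := by nlinarith
    have h4 : 0 < 4 + |y| := by positivity
    calc (4 + |y|) ^ δ ≤ (T ^ 2) ^ δ := by gcongr
      _ = Real.exp (26 * (M / X)) := by
        rw [Real.rpow_def_of_pos (by positivity), Real.log_pow, ← hMT, hδdef]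
        congr 1
        push_cast
        field_simp
        ring
  have hfs : ‖L s‖ ≤ ‖f s‖ := by
    rw [hf, norm_mul, hexp]
    refine le_mul_of_one_le_right (norm_nonneg _) (Real.one_le_exp ?_)
    have : s.im - t = 0 := sub_self _
    rw [this]
    have := sq_nonneg (s.re - 1 / 2)
    nlinarith
  refine hfs.trans ?_
  refine norm_le_of_rectangle_boundary (a := 1 / 2 - δ) (b := 1 / 2 + δ) (c := t - 1) (d := t + 1)
    (by linarith) (by linarith) ?_ ?_ ⟨by linarith, hc.le⟩ ⟨by linarith, by linarith⟩
  · exact hL.mul (by fun_prop)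
  · intro w hw1 hw2 hw3
    rw [hf, norm_mul, hexp]
    obtain ⟨hw1a, hw1b⟩ := hw1
    obtain ⟨hw2a, hw2b⟩ := hw2
    have hre2 : (w.re - 1 / 2) ^ 2 ≤ δ ^ 2 := by
      exact sq_le_sq' (by linarith) (by linarith)
    have him : |w.im| ≤ H - 2 := by
      rw [abs_le] at hs' ⊢
      constructor <;> linarith
    have hside : (w.re = 1 / 2 - δ ∨ w.re = 1 / 2 + δ) → ‖L w‖ * Real.exp (4 * M * ((w.re - 1 / 2) ^ 2 - (w.im - t) ^ 2)) ≤
        Real.exp (Ψ / 4 + 28 * (M / X)) := by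
      intro hw
      have e1 : Real.exp (4 * M * ((w.re - 1 / 2) ^ 2 - (w.im - t) ^ 2)) ≤ Real.exp (M / X) := by
        rw [Real.exp_le_exp]
        nlinarith [sq_nonneg (w.im - t)]
      have hR := hquart (1 / 2 + δ + w.im * I) (by simp) (by simp; linarith)
      have e2 : ‖L w‖ ≤ C₂ * Real.exp (26 * (M / X)) * Real.exp (Ψ / 4 + 2 * Real.log K) := by
        rcases hw with hw | hw
        · have : w = 1 / 2 - δ + w.im * I := by
            apply Complex.ext <;> simp [hw]
          rw [this]
          refine (h2 δ w.im hδ0.le hδ).trans ?_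
          gcongr
          exact hpow _ (by linarith)
        · have : w = 1 / 2 + δ + w.im * I := by
            apply Complex.ext <;> simp [hw]
          rw [this]
          refine hR.trans (le_mul_of_one_le_left (Real.exp_pos _).le ?_)
          have := Real.one_le_exp (by positivity : 0 ≤ 26 * (M / X))
          nlinarith
      calc _ ≤ C₂ * Real.exp (26 * (M / X)) * Real.exp (Ψ / 4 + 2 * Real.log K) *
            Real.exp (M / X) := by gcongr
        _ = Real.exp (Real.log C₂ + 26 * (M / X) + (Ψ / 4 + 2 * Real.log K) + M / X) := by
            rw [Real.exp_add _ (M / X), Real.exp_add _ (Ψ / 4 + 2 * Real.log K),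
              Real.exp_add (Real.log C₂), Real.exp_log (by linarith)]
        _ ≤ _ := by
            rw [Real.exp_le_exp]; linarith
    have hedge : (w.im - t) ^ 2 = 1 → ‖L w‖ * Real.exp (4 * M * ((w.re - 1 / 2) ^ 2 - (w.im - t) ^ 2)) ≤
        Real.exp (Ψ / 4 + 28 * (M / X)) := by
      intro hw
      rw [hw]
      have hwre : 3 / 8 ≤ w.re := by linarith
      have e1 : ‖L w‖ ≤ Real.exp (2 * M) := by
        refine (h1 w (by linarith)).trans ?_
        have e3 : ‖w‖ ≤ (1 + 6 * T) * w.re := by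
          refine (norm_le_abs_re_add_abs_im w).trans ?_
          rw [abs_of_pos (by linarith)]
          have := mul_le_mul_of_nonneg_left hwre (by linarith : 0 ≤ 6 * T)
          linarith
        calc C₁ * ‖w‖ / w.re ≤ C₁ * ((1 + 6 * T) * w.re) / w.re := by gcongr
          _ = C₁ * (1 + 6 * T) := by field_simp
          _ ≤ T ^ 2 := hTC
          _ = Real.exp (2 * M) := by
            rw [hMT, show 2 * Real.log T = Real.log T + Real.log T by ring, Real.exp_add,
              Real.exp_log hT0, sq]
      calc _ ≤ Real.exp (2 * M) * Real.exp (4 * M * (δ ^ 2 - 1)) := by gcongr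
        _ = Real.exp (2 * M + 4 * M * (δ ^ 2 - 1)) := by rw [Real.exp_add]
        _ ≤ _ := by
          rw [Real.exp_le_exp]
          have : M * δ ^ 2 ≤ M * (1 / 8) ^ 2 := by gcongr
          nlinarith
    rcases hw3 with h | h | h | h
    · exact hside (Or.inl h)
    · exact hside (Or.inr h)
    · exact hedge (by rw [h]; ring)
    · exact hedge (by rw [h]; ring)

lemma log_le_two_mul_sqrt {M : ℝ} (hM : 0 < M) : Real.log M ≤ 2 * √M := by
  have h := Real.log_le_sub_one_of_pos (Real.sqrt_pos.mpr hM)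
  rw [Real.log_sqrt hM.le] at h
  linarith

lemma norm_le_exp_iterate {L : ℂ → ℂ} {K C₁ C₂ T M : ℝ} (hL : Differentiable ℂ L)
    (hne : ∀ s : ℂ, 1 / 2 < s.re → L s ≠ 0) (hK1 : 1 ≤ K) (hC₂ : 1 ≤ C₂)
    (hK : ∀ s : ℂ, 11 / 10 ≤ s.re → ‖L s‖ ≤ K ∧ 1 ≤ K * ‖L s‖ ∧ ‖deriv L s / L s‖ ≤ K)
    (h1 : ∀ s : ℂ, 0 < s.re → ‖L s‖ ≤ C₁ * ‖s‖ / s.re)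
    (h2 : ∀ a t : ℝ, 0 ≤ a → a ≤ 1 / 8 → ‖L (1 / 2 - a + t * I)‖ ≤
      C₂ * (4 + |t|) ^ a * ‖L (1 / 2 + a + t * I)‖)
    (hT : 4 ≤ T) (hMT : M = Real.log T) (hC₁ : 0 ≤ C₁) (hTC : C₁ * (1 + 6 * T) ≤ T ^ 2)
    (hX : 700 ≤ Real.log M) (hXK : 26 * Real.log K ≤ Real.log M) (hMK : K ^ 2 ≤ M)
    (hMX : 2 * Real.log K + Real.log C₂ ≤ M / Real.log M) (k : ℕ) {s : ℂ}
    (hs : 1 / 2 ≤ s.re) (hs' : |s.im| ≤ 2 * T - 3 * k) :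
    ‖L s‖ ≤ Real.exp (2 * M / 4 ^ k + 40 * (M / Real.log M)) := by
  have hX0 : 0 < Real.log M := by linarith
  have hM0 : 0 < M := by nlinarith
  have hMX0 : 0 < M / Real.log M := by positivity
  have hT0 : 0 < T := by linarith
  induction k generalizing s with
  | zero =>
    simp only [Nat.cast_zero, mul_zero, sub_zero] at hs'
    have e3 : ‖s‖ ≤ (1 + 6 * T) * s.re := by
      refine (norm_le_abs_re_add_abs_im s).trans ?_
      rw [abs_of_pos (by linarith)]
      have := mul_le_mul_of_nonneg_left hs (by linarith : 0 ≤ 6 * T)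
      linarith
    have hre : 0 < s.re := by linarith
    calc ‖L s‖ ≤ C₁ * ‖s‖ / s.re := h1 s hre
      _ ≤ C₁ * ((1 + 6 * T) * s.re) / s.re := by gcongr
      _ = C₁ * (1 + 6 * T) := by field_simp
      _ ≤ T ^ 2 := hTC
      _ = Real.exp (2 * M) := by
        rw [hMT, show 2 * Real.log T = Real.log T + Real.log T by ring, Real.exp_add,
          Real.exp_log hT0, sq]
      _ ≤ _ := by
        rw [Real.exp_le_exp, pow_zero, div_one]
        linarith
  | succ k ih =>
    have hΨ : √M ≤ 2 * M / 4 ^ k + 40 * (M / Real.log M) := by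
      have h3 : √M ≤ 40 * (M / Real.log M) := by
        rw [mul_div_assoc', le_div_iff₀ hX0]
        have h4 := log_le_two_mul_sqrt hM0
        have h5 := Real.mul_self_sqrt hM0.le
        nlinarith [Real.sqrt_nonneg M]
      have : 0 ≤ 2 * M / 4 ^ k := by positivity
      linarith
    have := norm_le_exp_step hL hne hK1 hC₂ hK h1 h2 hT hMT hC₁ hTC hX hXK hMK hMX hΨ
      (H := 2 * T - 3 * k) (by have : (0 : ℝ) ≤ k := Nat.cast_nonneg k
                               linarith) (fun s hs hs' => ih hs hs') hs (by push_cast at hs'; linarith)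
    refine this.trans ?_
    rw [Real.exp_le_exp]
    have : 2 * M / 4 ^ (k + 1) = (2 * M / 4 ^ k) / 4 := by
      rw [pow_succ]; field_simp
    rw [this]
    linarith

/-- **Littlewood's bound** in abstract form. -/
lemma exists_littlewood_bound {L : ℂ → ℂ} {K C₁ C₂ : ℝ} (hL : Differentiable ℂ L)
    (hne : ∀ s : ℂ, 1 / 2 < s.re → L s ≠ 0) (hK1 : 1 ≤ K) (hC₂ : 1 ≤ C₂)
    (hK : ∀ s : ℂ, 11 / 10 ≤ s.re → ‖L s‖ ≤ K ∧ 1 ≤ K * ‖L s‖ ∧ ‖deriv L s / L s‖ ≤ K)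
    (h1 : ∀ s : ℂ, 0 < s.re → ‖L s‖ ≤ C₁ * ‖s‖ / s.re) (hC₁ : 0 ≤ C₁)
    (h2 : ∀ a t : ℝ, 0 ≤ a → a ≤ 1 / 8 → ‖L (1 / 2 - a + t * I)‖ ≤
      C₂ * (4 + |t|) ^ a * ‖L (1 / 2 + a + t * I)‖) :
    ∃ T₀ : ℝ, 4 ≤ T₀ ∧ ∀ T : ℝ, T₀ ≤ T → ∀ s : ℂ, 1 / 2 ≤ s.re → |s.im| ≤ T →
      ‖L s‖ ≤ Real.exp (41 * (Real.log T / Real.log (Real.log T))) := by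
  have hlog : Tendsto Real.log atTop atTop := Real.tendsto_log_atTop
  have hll : Tendsto (fun T => Real.log (Real.log T)) atTop atTop := hlog.comp hlog
  set Y := 2 * Real.log K + Real.log C₂ with hY
  have hev := ((eventually_ge_atTop (18 : ℝ)).and (eventually_ge_atTop (7 * C₁))).and
    (((hll.eventually_ge_atTop 700).and (hll.eventually_ge_atTop (26 * Real.log K))).and
    ((hlog.eventually_ge_atTop (K ^ 2)).and (hlog.eventually_ge_atTop (4 * Y ^ 2))))
  obtain ⟨T₁, hT₁⟩ := eventually_atTop.1 hev
  refine ⟨max 4 T₁, le_max_left _ _, fun T hT s hs hs' => ?_⟩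
  obtain ⟨⟨t1, t2⟩, ⟨t3, t4⟩, t5, t6⟩ := hT₁ T ((le_max_right _ _).trans hT)
  set M := Real.log T with hM
  have hX0 : 0 < Real.log M := by linarith
  have hM0 : 0 < M := by nlinarith
  have hY0 : 0 ≤ Y := by
    have := Real.log_nonneg hC₂
    have := Real.log_nonneg hK1
    linarith
  have hYM : Y ≤ M / Real.log M := by
    rw [le_div_iff₀ hX0]
    have h4 := log_le_two_mul_sqrt hM0
    have h5 := Real.mul_self_sqrt hM0.le
    have h6 : 2 * Y ≤ √M := Real.le_sqrt_of_sq_le (by linarith)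
    nlinarith [Real.sqrt_nonneg M]
  have hTC : C₁ * (1 + 6 * T) ≤ T ^ 2 := by nlinarith
  set k := ⌊T / 3⌋₊ with hk
  have hk1 : (k : ℝ) ≤ T / 3 := Nat.floor_le (by linarith)
  have hk2 : T / 3 < k + 1 := Nat.lt_floor_add_one _
  refine (norm_le_exp_iterate hL hne hK1 hC₂ hK h1 h2 (by linarith) hM hC₁ hTC t3 t4 t5 hYM k hs
    (by linarith)).trans ?_
  rw [Real.exp_le_exp]
  have h4k : 2 * Real.log M ≤ 4 ^ k := by
    have e1 : (k : ℝ) + 1 ≤ 2 ^ k := by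
      exact_mod_cast (Nat.lt_two_pow_self : k < 2 ^ k)
    have e2 : (4 : ℝ) ^ k = 2 ^ k * 2 ^ k := by rw [← mul_pow]; norm_num
    have e3 : Real.log M ≤ M := (Real.log_le_sub_one_of_pos hM0).trans (by linarith)
    have e4 : M ≤ T := (Real.log_le_sub_one_of_pos (by linarith)).trans (by linarith)
    rw [e2]
    nlinarith
  have : 2 * M / 4 ^ k ≤ M / Real.log M := by
    rw [div_le_div_iff₀ (by positivity) hX0]
    nlinarith
  linarith

/-- Two-sided comparison of an entire function without zeros in `Re s > 1/2` with its values on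
`Re s = 2`. -/
lemma exists_two_sided_bound {G : ℂ → ℂ} {K C : ℝ} (hG : Differentiable ℂ G)
    (hne : ∀ s : ℂ, 1 / 2 < s.re → G s ≠ 0) (hK1 : 1 ≤ K)
    (hK : ∀ s : ℂ, 11 / 10 ≤ s.re → 1 ≤ K * ‖G s‖ ∧ ‖deriv G s / G s‖ ≤ K)
    (hC : ∀ s : ℂ, 1 / 2 < s.re → ‖G s‖ ≤ C * (1 + ‖s‖) ^ 2) (hC0 : 0 ≤ C) :
    ∃ T₀ : ℝ, 4 ≤ T₀ ∧ ∀ T : ℝ, T₀ ≤ T → ∀ s : ℂ, 3 / 4 ≤ s.re → s.re ≤ 2 → |s.im| ≤ 2 * T →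
      ‖G s‖ ≤ ‖G (2 + s.im * I)‖ * Real.exp (128 * K * (Real.log T / Real.log (Real.log T))) ∧
      ‖G (2 + s.im * I)‖ ≤ ‖G s‖ * Real.exp (128 * K * (Real.log T / Real.log (Real.log T))) := by
  have hlog : Tendsto Real.log atTop atTop := Real.tendsto_log_atTop
  have hll : Tendsto (fun T => Real.log (Real.log T)) atTop atTop := hlog.comp hlog
  have hev := ((eventually_ge_atTop (10 : ℝ)).and (eventually_ge_atTop (9 * C))).and
    ((hll.eventually_ge_atTop 1).and ((hlog.eventually_ge_atTop (64 * K)).and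
      (hlog.eventually_ge_atTop (Real.log K))))
  obtain ⟨T₁, hT₁⟩ := eventually_atTop.1 hev
  refine ⟨max 4 T₁, le_max_left _ _, fun T hT s hs hs2 hs' => ?_⟩
  obtain ⟨⟨t1, t2⟩, t3, t4, t5⟩ := hT₁ T ((le_max_right _ _).trans hT)
  set M := Real.log T with hM
  have hX0 : 0 < Real.log M := by linarith
  have hM0 : 0 < M := by nlinarith
  have hK0 : 0 < K := by linarith
  have hT0 : 0 < T := by linarith
  set z₀ : ℂ := 2 + s.im * I with hz₀
  have hz₀re : z₀.re = 2 := by simp [hz₀]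
  have hz₀im : z₀.im = s.im := by simp [hz₀]
  have hre : ∀ w : ℂ, ‖w - z₀‖ ≤ 9 / 10 → 11 / 10 ≤ w.re := fun w hw => by
    have := (abs_le.1 ((abs_re_le_norm _).trans hw)).1
    rw [sub_re, hz₀re] at this
    linarith
  have hre' : ∀ w : ℂ, ‖w - z₀‖ < 3 / 2 → 1 / 2 < w.re := fun w hw => by
    have h3 := (abs_lt.1 ((abs_re_le_norm _).trans_lt hw)).1
    rw [sub_re, hz₀re] at h3
    linarith
  have hη : (K / (4 * M)) ^ ((1 / 4 : ℝ) / 2) ≤ 1 / 2 := by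
    have h3 : K / (4 * M) ≤ (1 / 2) ^ 8 := by
      rw [div_le_iff₀ (by positivity)]; linarith
    calc (K / (4 * M)) ^ ((1 / 4 : ℝ) / 2) ≤ ((1 / 2 : ℝ) ^ 8) ^ ((1 / 4 : ℝ) / 2) := by gcongr
      _ = 1 / 2 := by
        rw [← Real.rpow_natCast, ← Real.rpow_mul (by norm_num)]
        norm_num
  have hη2 : 4 * (4 * M) * (K / (4 * M)) ^ ((1 / 4 : ℝ) / 2) ≤ 128 * K * (M / Real.log M) := by
    have e1 : (K / (4 * M)) ^ ((1 / 4 : ℝ) / 2) ≤ K * (8 / Real.log M) := by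
      calc (K / (4 * M)) ^ ((1 / 4 : ℝ) / 2) ≤ (K / M) ^ ((1 / 4 : ℝ) / 2) := by
            gcongr; linarith
        _ = K ^ ((1 / 4 : ℝ) / 2) * Real.exp (-(Real.log M / 8)) := by
            rw [Real.div_rpow hK0.le hM0.le, div_eq_mul_inv, ← Real.rpow_neg hM0.le,
              Real.rpow_def_of_pos hM0]
            ring_nf
        _ ≤ K * (8 / Real.log M) := by
            gcongr
            · calc K ^ ((1 / 4 : ℝ) / 2) ≤ K ^ (1 : ℝ) :=
                  Real.rpow_le_rpow_of_exponent_le hK1 (by norm_num)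
                _ = K := Real.rpow_one K
            · rw [Real.exp_neg, ← one_div, div_le_div_iff₀ (Real.exp_pos _) hX0]
              have := Real.add_one_le_exp (Real.log M / 8)
              linarith
    calc _ ≤ 4 * (4 * M) * (K * (8 / Real.log M)) := by gcongr
      _ = _ := by field_simp; ring
  obtain ⟨k1, k2⟩ := norm_div_bounds_of_nonvanishing (G := G) (z₀ := z₀) (z := s) (Q := 4 * M)
    (B := K) (δ := 1 / 4) hK0 (by linarith) (fun w _ => hG w) (fun w hw => hne w (hre' w hw))
    (by
      intro w hw
      have hw1 : ‖w‖ ≤ 4 + 2 * T := by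
        have h3 := norm_le_abs_re_add_abs_im z₀
        rw [hz₀re, hz₀im, abs_of_pos (by norm_num : (0 : ℝ) < 2)] at h3
        have h4 := norm_add_le (w - z₀) z₀
        rw [sub_add_cancel] at h4
        linarith
      have hzK := (hK z₀ (by rw [hz₀re]; norm_num)).1
      calc ‖G w‖ ≤ C * (1 + ‖w‖) ^ 2 := hC w (hre' w hw)
        _ ≤ C * (1 + (4 + 2 * T)) ^ 2 := by gcongr
        _ ≤ C * (3 * T) ^ 2 := by gcongr; linarith
        _ ≤ T ^ 3 := by nlinarith
        _ = Real.exp (3 * M) := by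
          rw [show 3 * M = M + M + M by ring, Real.exp_add, Real.exp_add, hM, Real.exp_log hT0]
          ring
        _ ≤ Real.exp (3 * M) * (K * ‖G z₀‖) := le_mul_of_one_le_right (Real.exp_pos _).le hzK
        _ = ‖G z₀‖ * Real.exp (3 * M + Real.log K) := by
          rw [Real.exp_add, Real.exp_log hK0]; ring
        _ ≤ _ := by gcongr; linarith)
    (fun w hw => (hK w (hre w hw)).2) (by norm_num) (by norm_num)
    (by
      have : s - z₀ = ((s.re - 2 : ℝ) : ℂ) := by
        apply Complex.ext <;> simp [hz₀]
      rw [this, norm_real, Real.norm_eq_abs, abs_le]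
      constructor <;> linarith) hη
  constructor
  · exact k1.trans (by gcongr)
  · exact k2.trans (by gcongr)

lemma LVal_eq_LFunction {N : ℕ} [h : NeZero N] (χ : DirichletCharacter ℂ N) (s : ℂ) :
    LVal χ s = DirichletCharacter.LFunction χ s := by
  simp [LVal, h.out]

lemma LFunction_ne_zero_of_GRH {N : ℕ} [NeZero N] {χ : DirichletCharacter ℂ N} (h : GRH χ)
    {s : ℂ} (hs : 1 / 2 < s.re) (h1 : χ ≠ 1 ∨ s ≠ 1) : DirichletCharacter.LFunction χ s ≠ 0 := by
  rcases le_or_gt 1 s.re with h' | h'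
  · exact DirichletCharacter.LFunction_ne_zero_of_one_le_re χ h1 h'
  · intro h0
    have := h s (by linarith) h' (by rw [LVal_eq_LFunction, h0])
    linarith

lemma norm_prod_one_sub_le {N : ℕ} {u : ℕ → ℂ} (hu : ∀ n, ‖u n‖ ≤ 1) {s : ℂ} (hs : 0 ≤ s.re) :
    ‖∏ p ∈ N.primeFactors, (1 - u p * (p : ℂ) ^ (-s))‖ ≤ 2 ^ N.primeFactors.card := by
  rw [norm_prod]
  refine (Finset.prod_le_prod (fun _ _ => norm_nonneg _) (g := fun _ => (2 : ℝ)) fun p hp => ?_).trans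
    (by simp)
  have hp1 : 1 ≤ p := (Nat.prime_of_mem_primeFactors hp).one_le
  have h2 : ‖(p : ℂ) ^ (-s)‖ ≤ 1 := by
    rw [Complex.norm_natCast_cpow_of_pos (by omega)]
    exact Real.rpow_le_one_of_one_le_of_nonpos (by exact_mod_cast hp1) (by simpa using hs)
  calc ‖1 - u p * (p : ℂ) ^ (-s)‖ ≤ ‖(1 : ℂ)‖ + ‖u p * (p : ℂ) ^ (-s)‖ := norm_sub_le _ _
    _ ≤ 1 + 1 * 1 := by
        rw [norm_mul, norm_one]
        have := mul_le_mul (hu p) h2 (norm_nonneg _) zero_le_one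
        linarith
    _ = 2 := by norm_num

lemma log_div_log_log_nonneg {T : ℝ} (hT : 4 ≤ T) : 0 ≤ Real.log T / Real.log (Real.log T) := by
  have h1 : 1 ≤ Real.log T := by
    rw [Real.le_log_iff_exp_le (by linarith)]
    exact Real.exp_one_lt_d9.le.trans (by linarith)
  exact div_nonneg (by linarith) (Real.log_nonneg h1)

lemma exists_norm_LFunction_le_of_GRH {N : ℕ} [NeZero N] {χ : DirichletCharacter ℂ N} (hχ : χ ≠ 1)
    (h : GRH χ) : ∃ C T₀ : ℝ, 1 ≤ C ∧ 4 ≤ T₀ ∧ ∀ T : ℝ, T₀ ≤ T → ∀ s : ℂ, 3 / 8 ≤ s.re →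
      |s.im| ≤ T → ‖DirichletCharacter.LFunction χ s‖ ≤ C * T ^ (max 0 (1 / 2 - s.re)) *
        Real.exp (41 * (Real.log T / Real.log (Real.log T))) := by
  have hN0 : NeZero χ.conductor := ⟨χ.conductor_ne_zero⟩
  set ψ := χ.primitiveCharacter with hψ
  have hcl : DirichletCharacter.changeLevel χ.conductor_dvd_level ψ = χ :=
    χ.changeLevel_primitiveCharacter
  have hψ1 : ψ ≠ 1 := by
    intro h0
    rw [h0, map_one] at hcl
    exact hχ hcl.symm
  have heq : ∀ s, DirichletCharacter.LFunction χ s = DirichletCharacter.LFunction ψ s *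
      ∏ p ∈ N.primeFactors, (1 - ψ p * (p : ℂ) ^ (-s)) := by
    intro s
    conv_lhs => rw [← hcl]
    exact DirichletCharacter.LFunction_changeLevel _ ψ (.inl hψ1)
  obtain ⟨C₂, hC₂, h2⟩ := exists_norm_LFunction_half_sub_le hψ1 χ.primitiveCharacter_isPrimitive
  obtain ⟨C₁, hC₁, h1⟩ := exists_norm_LFunction_le hψ1
  obtain ⟨K, hK1, hK⟩ := exists_bounds_LFunction_of_le_re ψ
  obtain ⟨T₀, hT₀, hb⟩ := exists_littlewood_bound (DirichletCharacter.differentiable_LFunction hψ1)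
    (fun s hs h0 => LFunction_ne_zero_of_GRH h hs (.inl hχ) (by rw [heq, h0, zero_mul]))
    hK1 hC₂ hK h1 hC₁ h2
  refine ⟨2 ^ N.primeFactors.card * (2 * C₂), T₀, ?_, hT₀, fun T hT s hs ht => ?_⟩
  · have : (1 : ℝ) ≤ 2 ^ N.primeFactors.card := one_le_pow₀ (by norm_num)
    nlinarith
  set E := Real.exp (41 * (Real.log T / Real.log (Real.log T))) with hE
  have hT1 : 1 ≤ T := by linarith
  have hmain : ‖DirichletCharacter.LFunction ψ s‖ ≤ 2 * C₂ * T ^ (max 0 (1 / 2 - s.re)) * E := by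
    rcases le_or_gt (1 / 2) s.re with h' | h'
    · have := hb T hT s h' ht
      rw [max_eq_left (by linarith), Real.rpow_zero]
      have hE0 : 0 ≤ E := (Real.exp_pos _).le
      nlinarith
    · rw [max_eq_right (by linarith)]
      have e1 : (1 / 2 : ℂ) - ((1 / 2 - s.re : ℝ) : ℂ) + s.im * I = s := by
        apply Complex.ext <;> simp
      have e2 := h2 (1 / 2 - s.re) s.im (by linarith) (by linarith)
      rw [e1] at e2
      have e3 := hb T hT ((1 / 2 : ℂ) + ((1 / 2 - s.re : ℝ) : ℂ) + s.im * I)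
        (by simp; linarith) (by simpa using ht)
      have e4 : (4 + |s.im|) ^ (1 / 2 - s.re) ≤ 2 * T ^ (1 / 2 - s.re) := by
        calc (4 + |s.im|) ^ (1 / 2 - s.re) ≤ (2 * T) ^ (1 / 2 - s.re) :=
              Real.rpow_le_rpow (by positivity) (by linarith) (by linarith)
          _ = 2 ^ (1 / 2 - s.re) * T ^ (1 / 2 - s.re) :=
              Real.mul_rpow (by norm_num) (by linarith)
          _ ≤ 2 * T ^ (1 / 2 - s.re) := by
              refine mul_le_mul_of_nonneg_right ?_ (by positivity)
              calc (2 : ℝ) ^ (1 / 2 - s.re) ≤ 2 ^ (1 : ℝ) :=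
                    Real.rpow_le_rpow_of_exponent_le (by norm_num) (by linarith)
                _ = 2 := by norm_num
      calc _ ≤ _ := e2
        _ ≤ C₂ * (2 * T ^ (1 / 2 - s.re)) * E := by
            refine mul_le_mul (mul_le_mul_of_nonneg_left e4 (by linarith)) e3 (norm_nonneg _)
              (by positivity)
        _ = _ := by ring
  rw [heq, norm_mul]
  have hp := norm_prod_one_sub_le (N := N) (u := fun n => ψ n) (fun n => ψ.norm_le_one _)
    (s := s) (by linarith)
  calc _ ≤ (2 * C₂ * T ^ (max 0 (1 / 2 - s.re)) * E) * 2 ^ N.primeFactors.card :=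
        mul_le_mul hmain hp (norm_nonneg _) ((norm_nonneg _).trans hmain)
    _ = _ := by ring

lemma exists_bounds_LFunction_of_GRH {N : ℕ} [NeZero N] {χ : DirichletCharacter ℂ N}
    (h : GRH χ) : ∃ A C T₀ : ℝ, 0 ≤ A ∧ 1 ≤ C ∧ 4 ≤ T₀ ∧ ∀ T : ℝ, T₀ ≤ T → ∀ s : ℂ, 3 / 4 ≤ s.re →
      |s.im| ≤ 2 * T → s ≠ 1 →
      ‖DirichletCharacter.LFunction χ s‖ ≤ C * (1 + 1 / ‖s - 1‖) *
        Real.exp (A * (Real.log T / Real.log (Real.log T))) ∧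
      1 ≤ C * ‖DirichletCharacter.LFunction χ s‖ *
        Real.exp (A * (Real.log T / Real.log (Real.log T))) := by
  obtain ⟨K, hK1, hK⟩ := exists_bounds_LFunction_of_le_re χ
  by_cases hχ : χ = 1
  · set G := DirichletCharacter.LFunctionTrivChar₁ N with hG
    have hGe : ∀ s, s ≠ 1 → G s = (s - 1) * DirichletCharacter.LFunction χ s := by
      intro s hs
      rw [hG, DirichletCharacter.LFunctionTrivChar₁, Function.update_of_ne hs, hχ]
    have hGd : ∀ s, s ≠ 1 → deriv G s = (s - 1) * deriv (DirichletCharacter.LFunction χ) s +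
        DirichletCharacter.LFunction χ s := by
      intro s hs
      rw [hG, DirichletCharacter.deriv_LFunctionTrivChar₁_apply_of_ne_one N hs, hχ]
    obtain ⟨T₀, hT₀, hb⟩ := exists_two_sided_bound (G := G) (K := 10 * K + 10)
      (C := 3 * 2 ^ N.primeFactors.card)
      (DirichletCharacter.differentiable_LFunctionTrivChar₁ N) (by
        intro s hs
        rcases eq_or_ne s 1 with rfl | h1
        · exact DirichletCharacter.LFunctionTrivChar₁_apply_one_ne_zero N
        · rw [hGe s h1]
          exact mul_ne_zero (sub_ne_zero.2 h1) (LFunction_ne_zero_of_GRH h hs (.inr h1)))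
      (by linarith) (by
        intro s hs
        have h1 : s ≠ 1 := by rintro rfl; norm_num at hs
        obtain ⟨k1, k2, k3⟩ := hK s hs
        have hs1 : 1 / 10 ≤ ‖s - 1‖ := by
          have := Complex.re_le_norm (s - 1)
          simp at this
          linarith
        have hne : DirichletCharacter.LFunction χ s ≠ 0 := by
          intro h0
          rw [h0] at k2; simp at k2; linarith
        rw [hGd s h1, hGe s h1]
        constructor
        · rw [norm_mul]
          nlinarith [mul_le_mul_of_nonneg_left k2 (norm_nonneg (s - 1)),
            mul_nonneg (norm_nonneg (s - 1)) (norm_nonneg (DirichletCharacter.LFunction χ s))]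
        · have e : ((s - 1) * deriv (DirichletCharacter.LFunction χ) s +
              DirichletCharacter.LFunction χ s) / ((s - 1) * DirichletCharacter.LFunction χ s) =
              deriv (DirichletCharacter.LFunction χ) s / DirichletCharacter.LFunction χ s +
                1 / (s - 1) := by
            have := sub_ne_zero.2 h1
            field_simp
          rw [e]
          refine (norm_add_le _ _).trans ?_
          have : ‖1 / (s - 1)‖ ≤ 10 := by
            rw [norm_div, norm_one, div_le_iff₀ (by linarith)]
            linarith
          linarith) (by
        intro s hs
        have hpn := norm_nonneg s
        have hprod : 0 < (2 : ℝ) ^ N.primeFactors.card := by positivity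
        have key : ∀ s : ℂ, 1 / 2 < s.re → s ≠ 1 →
            ‖G s‖ ≤ 3 * 2 ^ N.primeFactors.card * (1 + ‖s‖) ^ 2 := by
          intro s hs h1
          have hpn := norm_nonneg s
          have e1 := norm_sub_one_mul_riemannZeta_le (s := s) (by linarith) h1
          have e2 : G s = ((s - 1) * riemannZeta s) *
              ∏ p ∈ N.primeFactors, (1 - (1 : ℂ) * (p : ℂ) ^ (-s)) := by
            rw [hGe s h1, hχ]
            have := DirichletCharacter.LFunctionTrivChar_eq_mul_riemannZeta (N := N) h1
            rw [DirichletCharacter.LFunctionTrivChar] at this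
            rw [this]
            simp only [one_mul]
            ring
          have e3 := norm_prod_one_sub_le (N := N) (u := fun _ => (1 : ℂ)) (by simp) (s := s)
            (by linarith)
          have e4 : ‖(s - 1) * riemannZeta s‖ ≤ 3 * (1 + ‖s‖) ^ 2 := by
            have h5 : 1 / s.re ≤ 2 := by
              rw [div_le_iff₀ (by linarith)]; linarith
            have h6 : ‖s - 1‖ ≤ ‖s‖ + 1 := by simpa using norm_sub_le s 1
            have h7 : ‖s - 1‖ * ‖s‖ ≤ (‖s‖ + 1) * ‖s‖ := mul_le_mul_of_nonneg_right h6 hpn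
            have h8 : ‖s - 1‖ * ‖s‖ * (1 / s.re) ≤ (‖s‖ + 1) * ‖s‖ * 2 :=
              mul_le_mul h7 h5 (by positivity) (by positivity)
            nlinarith
          rw [e2, norm_mul]
          calc _ ≤ (3 * (1 + ‖s‖) ^ 2) * 2 ^ N.primeFactors.card :=
                mul_le_mul e4 e3 (norm_nonneg _) (by positivity)
            _ = _ := by ring
        rcases eq_or_ne s 1 with rfl | h1
        · have hcont := (DirichletCharacter.differentiable_LFunctionTrivChar₁ N).continuous
          have hc1 : ContinuousWithinAt (fun s => ‖G s‖) {1}ᶜ 1 :=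
            (hcont.norm.continuousAt).continuousWithinAt
          have hc2 : ContinuousWithinAt
              (fun s : ℂ => 3 * 2 ^ N.primeFactors.card * (1 + ‖s‖) ^ 2) {1}ᶜ 1 := by
            exact (Continuous.continuousAt (by fun_prop)).continuousWithinAt
          refine le_of_tendsto_of_tendsto hc1 hc2 ?_
          have hopen : {s : ℂ | 1 / 2 < s.re} ∈ nhds (1 : ℂ) :=
            (isOpen_lt continuous_const Complex.continuous_re).mem_nhds (by norm_num)
          filter_upwards [self_mem_nhdsWithin, mem_nhdsWithin_of_mem_nhds hopen] with w hw1 hw2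
          exact key w hw2 hw1
        · exact key s hs h1) (by positivity)
    refine ⟨128 * (10 * K + 10), 3 * K, T₀, by linarith, by linarith, hT₀, fun T hT s hs ht h1 => ?_⟩
    set M := Real.log T / Real.log (Real.log T) with hM
    have hM0 : 0 ≤ M := log_div_log_log_nonneg (hT₀.trans hT)
    set E := Real.exp (128 * (10 * K + 10) * M) with hE
    have hE1 : 1 ≤ E := Real.one_le_exp (by positivity)
    have hs1 : 0 < ‖s - 1‖ := norm_pos_iff.2 (sub_ne_zero.2 h1)
    have hinv : 0 ≤ 1 / ‖s - 1‖ := by positivity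
    rcases le_or_gt s.re 2 with h2 | h2
    · obtain ⟨b1, b2⟩ := hb T hT s hs h2 ht
      have hz1 : (2 + s.im * I : ℂ) ≠ 1 := by
        intro h0
        have := congrArg Complex.re h0
        simp at this
      rw [hGe s h1, hGe _ hz1, norm_mul, norm_mul] at b1 b2
      obtain ⟨k1, k2, -⟩ := hK (2 + s.im * I) (by simp; norm_num)
      set z := (2 + s.im * I : ℂ) with hz
      have hzs : ‖z - s‖ ≤ 5 / 4 := by
        have e : z - s = ((2 - s.re : ℝ) : ℂ) := by apply Complex.ext <;> simp [hz]
        rw [e, Complex.norm_real, Real.norm_eq_abs, abs_le]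
        constructor <;> linarith
      have hz2 : ‖z - 1‖ ≤ ‖s - 1‖ + 5 / 4 := by
        have := norm_add_le (z - s) (s - 1)
        rw [sub_add_sub_cancel] at this
        linarith
      have hz3 : ‖s - 1‖ ≤ ‖z - 1‖ := by
        rw [Complex.norm_def, Complex.norm_def]
        refine Real.sqrt_le_sqrt ?_
        simp [Complex.normSq_apply, hz]
        nlinarith
      set l := ‖DirichletCharacter.LFunction χ s‖ with hl
      set lz := ‖DirichletCharacter.LFunction χ z‖ with hlz
      have hl0 : 0 ≤ l := norm_nonneg _
      have hlz0 : 0 ≤ lz := norm_nonneg _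
      constructor
      · have e1 : ‖s - 1‖ * l ≤ (‖s - 1‖ + 5 / 4) * K * E :=
          b1.trans (mul_le_mul_of_nonneg_right (mul_le_mul hz2 k1 hlz0 (by positivity))
            (by positivity))
        have e2 : l ≤ (‖s - 1‖ + 5 / 4) * K * E / ‖s - 1‖ := by
          rw [le_div_iff₀ hs1]; linarith
        refine e2.trans ?_
        have e3 : (‖s - 1‖ + 5 / 4) * K * E / ‖s - 1‖ = (1 + 5 / 4 * (1 / ‖s - 1‖)) * K * E := by
          field_simp
        rw [e3]
        refine mul_le_mul_of_nonneg_right ?_ (by positivity)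
        nlinarith
      · have e1 : ‖s - 1‖ * lz ≤ ‖s - 1‖ * (l * E) := by
          calc _ ≤ ‖z - 1‖ * lz := mul_le_mul_of_nonneg_right hz3 hlz0
            _ ≤ _ := b2
            _ = _ := by ring
        have e2 := le_of_mul_le_mul_left e1 hs1
        have : 0 ≤ K * (l * E) := by positivity
        nlinarith [mul_le_mul_of_nonneg_left e2 (by linarith : 0 ≤ K)]
    · obtain ⟨k1, k2, -⟩ := hK s (by linarith)
      have hl0 := norm_nonneg (DirichletCharacter.LFunction χ s)
      constructor
      · calc _ ≤ K := k1
          _ ≤ 3 * K * 1 * 1 := by linarith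
          _ ≤ _ := by gcongr; linarith
      · calc (1 : ℝ) ≤ _ := k2
          _ ≤ 3 * (K * ‖DirichletCharacter.LFunction χ s‖) * 1 := by nlinarith
          _ ≤ 3 * (K * ‖DirichletCharacter.LFunction χ s‖) * E := by gcongr
          _ = _ := by ring
  · obtain ⟨C₁, hC₁, h1⟩ := exists_norm_LFunction_le hχ
    obtain ⟨T₀, hT₀, hb⟩ := exists_two_sided_bound (C := 2 * C₁)
      (DirichletCharacter.differentiable_LFunction hχ)
      (fun s hs => LFunction_ne_zero_of_GRH h hs (.inl hχ)) hK1 (fun s hs => (hK s hs).2) (by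
        intro s hs
        refine (h1 s (by linarith)).trans ?_
        have hpn := norm_nonneg s
        rw [div_le_iff₀ (by linarith)]
        have e : ‖s‖ ≤ (1 + ‖s‖) ^ 2 := by nlinarith
        have e2 : C₁ * ‖s‖ ≤ C₁ * (1 + ‖s‖) ^ 2 := mul_le_mul_of_nonneg_left e hC₁
        have e3 : 0 ≤ C₁ * (1 + ‖s‖) ^ 2 := by positivity
        nlinarith) (by positivity)
    refine ⟨128 * K, K, T₀, by linarith, hK1, hT₀, fun T hT s hs ht h1 => ?_⟩
    set M := Real.log T / Real.log (Real.log T) with hM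
    have hM0 : 0 ≤ M := log_div_log_log_nonneg (hT₀.trans hT)
    set E := Real.exp (128 * K * M) with hE
    have hE1 : 1 ≤ E := Real.one_le_exp (by positivity)
    have hinv : 0 ≤ 1 / ‖s - 1‖ := by positivity
    have hl0 := norm_nonneg (DirichletCharacter.LFunction χ s)
    rcases le_or_gt s.re 2 with h2 | h2
    · obtain ⟨b1, b2⟩ := hb T hT s hs h2 ht
      obtain ⟨k1, k2, -⟩ := hK (2 + s.im * I) (by simp; norm_num)
      constructor
      · calc _ ≤ _ := b1
          _ ≤ K * E := by gcongr
          _ ≤ K * 1 * E := by linarith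
          _ ≤ _ := by gcongr; linarith
      · nlinarith [mul_le_mul_of_nonneg_left b2 (by linarith : 0 ≤ K)]
    · obtain ⟨k1, k2, -⟩ := hK s (by linarith)
      constructor
      · calc _ ≤ K := k1
          _ ≤ K * 1 * 1 := by linarith
          _ ≤ _ := by gcongr; linarith
      · calc (1 : ℝ) ≤ _ := k2
          _ ≤ (K * ‖DirichletCharacter.LFunction χ s‖) * 1 := by nlinarith
          _ ≤ _ := by gcongr

lemma LSeries_term_prime_pow (f : ℕ → ℂ) (s : ℂ) {p : ℕ} (hp : p.Prime) (e : ℕ) :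
    LSeries.term f s (p ^ e) = f (p ^ e) * ((p : ℂ) ^ (-s)) ^ e := by
  have h0 : p ^ e ≠ 0 := pow_ne_zero _ hp.ne_zero
  rw [LSeries.term_of_ne_zero h0, div_eq_mul_inv, ← Complex.cpow_neg]
  congr 1
  clear h0
  induction e with
  | zero => simp
  | succ e ih => rw [pow_succ, pow_succ, ← ih]; rw [Nat.cast_mul, natCast_mul_natCast_cpow]

lemma LSeries_hasProd_of_multiplicative {f : ℕ → ℂ} (h1 : f 1 = 1)
    (hmul : ∀ m n : ℕ, m ≠ 0 → n ≠ 0 → m.Coprime n → f (m * n) = f m * f n)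
    (hb : ∀ n, ‖f n‖ ≤ 1) {s : ℂ} (hs : 1 < s.re) :
    HasProd (fun p : Nat.Primes => ∑' e : ℕ, f ((p : ℕ) ^ e) * (((p : ℕ) : ℂ) ^ (-s)) ^ e)
      (LSeries f s) := by
  have hsum : LSeriesSummable f s :=
    LSeriesSummable_of_bounded_of_one_lt_re (m := 1) (fun n _ => hb n) hs
  have := EulerProduct.eulerProduct_hasProd (f := LSeries.term f s) (by simp [LSeries.term, h1])
    (by
      intro m n hmn
      rcases eq_or_ne m 0 with rfl | hm
      · simp
      rcases eq_or_ne n 0 with rfl | hn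
      · simp
      rw [LSeries.term_of_ne_zero hm, LSeries.term_of_ne_zero hn,
        LSeries.term_of_ne_zero (mul_ne_zero hm hn), hmul m n hm hn hmn, Nat.cast_mul,
        natCast_mul_natCast_cpow]
      ring) hsum.norm (LSeries.term_zero _ _)
  refine this.congr_fun fun p => ?_
  exact tsum_congr fun e => (LSeries_term_prime_pow f s p.2 e).symm

lemma isSum2Sq_iff (n : ℕ) :
    IsSum2Sq n ↔ ∀ p ∈ n.primeFactors, p % 4 = 3 → Even (padicValNat p n) :=
  Nat.eq_sq_add_sq_iff

lemma isSum2Sq_prime_pow {p : ℕ} (hp : p.Prime) (e : ℕ) :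
    IsSum2Sq (p ^ e) ↔ (p % 4 = 3 → Even e) := by
  rw [isSum2Sq_iff]
  rcases eq_or_ne e 0 with rfl | he
  · simp
  · have := Fact.mk hp
    rw [Nat.primeFactors_prime_pow he hp]
    simp

lemma isSum2Sq_mul_iff {m n : ℕ} (hm : m ≠ 0) (hn : n ≠ 0) (h : m.Coprime n) :
    IsSum2Sq (m * n) ↔ IsSum2Sq m ∧ IsSum2Sq n := by
  rw [isSum2Sq_iff, isSum2Sq_iff, isSum2Sq_iff, Nat.primeFactors_mul hm hn]
  have e1 : ∀ p ∈ m.primeFactors, padicValNat p (m * n) = padicValNat p m := by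
    intro p hp
    have := Fact.mk (Nat.prime_of_mem_primeFactors hp)
    rw [padicValNat.mul hm hn, padicValNat.eq_zero_of_not_dvd (n := n), add_zero]
    intro hd
    exact h.disjoint_primeFactors.notMem_of_mem_left_finset hp
      (Nat.mem_primeFactors.2 ⟨this.out, hd, hn⟩)
  have e2 : ∀ p ∈ n.primeFactors, padicValNat p (m * n) = padicValNat p n := by
    intro p hp
    have := Fact.mk (Nat.prime_of_mem_primeFactors hp)
    rw [padicValNat.mul hm hn, padicValNat.eq_zero_of_not_dvd (n := m), zero_add]
    intro hd
    exact h.disjoint_primeFactors.notMem_of_mem_left_finset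
      (Nat.mem_primeFactors.2 ⟨this.out, hd, hm⟩) hp
  constructor
  · intro H
    exact ⟨fun p hp h3 => e1 p hp ▸ H p (Finset.mem_union_left _ hp) h3,
      fun p hp h3 => e2 p hp ▸ H p (Finset.mem_union_right _ hp) h3⟩
  · rintro ⟨H1, H2⟩ p hp h3
    rcases Finset.mem_union.1 hp with hp | hp
    · rw [e1 p hp]; exact H1 p hp h3
    · rw [e2 p hp]; exact H2 p hp h3

lemma norm_STwist_le {q : ℕ} (χ : DirichletCharacter ℂ q) (n : ℕ) : ‖STwist χ n‖ ≤ 1 := by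
  unfold STwist
  split_ifs
  · exact χ.norm_le_one _
  · simp

lemma norm_mul_cpow_neg_lt_one {p : ℕ} (hp : p.Prime) {u : ℂ} (hu : ‖u‖ ≤ 1) {s : ℂ}
    (hs : 0 < s.re) : ‖u * (p : ℂ) ^ (-s)‖ < 1 := by
  rw [norm_mul, Complex.norm_natCast_cpow_of_pos hp.pos]
  have : (p : ℝ) ^ (-s).re < 1 :=
    Real.rpow_lt_one_of_one_lt_of_neg (by exact_mod_cast hp.one_lt) (by simpa using hs)
  have h0 : 0 ≤ (p : ℝ) ^ (-s).re := by positivity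
  nlinarith [norm_nonneg u]

lemma STwist_hasProd {q : ℕ} (χ : DirichletCharacter ℂ q) {s : ℂ} (hs : 1 < s.re) :
    HasProd (fun p : Nat.Primes => if (p : ℕ) % 4 = 3 then
      (1 - (χ (p : ℕ) * ((p : ℕ) : ℂ) ^ (-s)) ^ 2)⁻¹ else
      (1 - χ (p : ℕ) * ((p : ℕ) : ℂ) ^ (-s))⁻¹) (LSeries (STwist χ) s) := by
  have := LSeries_hasProd_of_multiplicative (f := STwist χ)
    (by simp [STwist, isSum2Sq_iff])
    (by
      intro m n hm hn hmn
      unfold STwist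
      rw [isSum2Sq_mul_iff hm hn hmn]
      by_cases h1 : IsSum2Sq m <;> by_cases h2 : IsSum2Sq n <;> simp [h1, h2])
    (norm_STwist_le χ) hs
  convert this using 2 with p
  have hp := p.2
  set z := χ (p : ℕ) * ((p : ℕ) : ℂ) ^ (-s) with hz
  have hz1 : ‖z‖ < 1 := norm_mul_cpow_neg_lt_one hp (χ.norm_le_one _) (by linarith)
  split_ifs with h
  · have hz2 : ‖z ^ 2‖ < 1 := by
      rw [norm_pow]; exact pow_lt_one₀ (norm_nonneg _) hz1 two_ne_zero
    have hev : Function.support (fun e : ℕ => STwist χ ((p : ℕ) ^ e) *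
        (((p : ℕ) : ℂ) ^ (-s)) ^ e) ⊆ Set.range (fun k : ℕ => 2 * k) := by
      intro e he
      by_contra h'
      apply he
      have : ¬ IsSum2Sq ((p : ℕ) ^ e) := by
        rw [isSum2Sq_prime_pow hp]
        intro H
        obtain ⟨k, hk⟩ := H h
        exact h' ⟨k, by simp; omega⟩
      simp [STwist, this]
    rw [← tsum_geometric_of_norm_lt_one hz2,
      ← (mul_right_injective₀ (two_ne_zero' ℕ)).tsum_eq hev]
    refine tsum_congr fun k => ?_
    have : IsSum2Sq ((p : ℕ) ^ (2 * k)) := (isSum2Sq_prime_pow hp _).2 fun _ => even_two_mul k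
    simp only [STwist, this, if_true, Nat.cast_pow, map_pow]
    rw [hz]
    ring
  · rw [← tsum_geometric_of_norm_lt_one hz1]
    refine tsum_congr fun k => ?_
    have : IsSum2Sq ((p : ℕ) ^ k) := (isSum2Sq_prime_pow hp _).2 fun h' => absurd h' h
    simp only [STwist, this, if_true, Nat.cast_pow, map_pow]
    rw [hz]
    ring

/-- The fourth power of `χ` restricted to integers all of whose prime factors are `3 mod 4`. -/
def quarticTwist {q : ℕ} (χ : DirichletCharacter ℂ q) (n : ℕ) : ℂ :=
  if ∀ p ∈ n.primeFactors, p % 4 = 3 then χ (n : ZMod q) ^ 4 else 0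

lemma norm_quarticTwist_le {q : ℕ} (χ : DirichletCharacter ℂ q) (n : ℕ) :
    ‖quarticTwist χ n‖ ≤ 1 := by
  unfold quarticTwist
  split_ifs
  · rw [norm_pow]; exact pow_le_one₀ (norm_nonneg _) (χ.norm_le_one _)
  · simp

lemma quarticTwist_hasProd {q : ℕ} (χ : DirichletCharacter ℂ q) {s : ℂ} (hs : 1 < s.re) :
    HasProd (fun p : Nat.Primes => if (p : ℕ) % 4 = 3 then
      (1 - χ (p : ℕ) ^ 4 * ((p : ℕ) : ℂ) ^ (-s))⁻¹ else 1) (LSeries (quarticTwist χ) s) := by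
  have := LSeries_hasProd_of_multiplicative (f := quarticTwist χ)
    (by simp [quarticTwist])
    (by
      intro m n hm hn hmn
      unfold quarticTwist
      rw [Nat.primeFactors_mul hm hn]
      simp only [Finset.mem_union, or_imp, forall_and]
      by_cases h1 : ∀ p ∈ m.primeFactors, p % 4 = 3
      · by_cases h2 : ∀ p ∈ n.primeFactors, p % 4 = 3
        · rw [if_pos ⟨h1, h2⟩, if_pos h1, if_pos h2, Nat.cast_mul, map_mul, mul_pow]
        · rw [if_neg fun h => h2 h.2, if_neg h2, mul_zero]
      · rw [if_neg fun h => h1 h.1, if_neg h1, zero_mul])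
    (norm_quarticTwist_le χ) hs
  convert this using 2 with p
  have hp := p.2
  set z := χ (p : ℕ) ^ 4 * ((p : ℕ) : ℂ) ^ (-s) with hz
  have hz1 : ‖z‖ < 1 := by
    refine norm_mul_cpow_neg_lt_one hp ?_ (by linarith)
    rw [norm_pow]; exact pow_le_one₀ (norm_nonneg _) (χ.norm_le_one _)
  split_ifs with h
  · rw [← tsum_geometric_of_norm_lt_one hz1]
    refine tsum_congr fun k => ?_
    have : ∀ r ∈ ((p : ℕ) ^ k).primeFactors, r % 4 = 3 := by
      intro r hr
      have h5 := (Nat.prime_of_mem_primeFactors hr).dvd_of_dvd_pow (Nat.dvd_of_mem_primeFactors hr)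
      rw [(Nat.prime_dvd_prime_iff_eq (Nat.prime_of_mem_primeFactors hr) hp).1 h5, h]
    simp only [quarticTwist]
    rw [if_pos this, hz]
    push_cast
    rw [map_pow]
    ring
  · rw [tsum_eq_single 0]
    · simp [quarticTwist]
    · intro k hk
      have : ¬ ∀ r ∈ ((p : ℕ) ^ k).primeFactors, r % 4 = 3 := by
        intro H
        refine h (H p ?_)
        rw [Nat.primeFactors_prime_pow hk hp]
        simp
      simp only [quarticTwist]
      rw [if_neg this, zero_mul]

lemma mulChiNeg4_apply {q : ℕ} (χ : DirichletCharacter ℂ q) (n : ℕ) :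
    mulChiNeg4 χ (n : ZMod (4 * q)) = χ (n : ZMod q) * (ZMod.χ₄ (n : ZMod 4) : ℂ) := by
  by_cases hn : IsUnit (n : ZMod (4 * q))
  · obtain ⟨u, hu⟩ := hn
    rw [mulChiNeg4, MulChar.mul_apply, ← hu, DirichletCharacter.changeLevel_eq_cast_of_dvd,
      DirichletCharacter.changeLevel_eq_cast_of_dvd, hu]
    rw [ZMod.cast_natCast (dvd_mul_left q 4), ZMod.cast_natCast (dvd_mul_right 4 q)]
    rfl
  · rw [MulChar.map_nonunit _ hn]
    rw [ZMod.isUnit_iff_coprime, Nat.coprime_mul_iff_right] at hn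
    symm
    by_cases h4 : n.Coprime 4
    · have : ¬ IsUnit (n : ZMod q) := by
        rw [ZMod.isUnit_iff_coprime]; exact fun h => hn ⟨h4, h⟩
      rw [MulChar.map_nonunit _ this, zero_mul]
    · have : ¬ IsUnit (n : ZMod 4) := by
        rw [ZMod.isUnit_iff_coprime]; exact h4
      rw [MulChar.map_nonunit _ this]; simp

lemma cpow_neg_mul_nat (p : ℕ) (s : ℂ) (k : ℕ) : (p : ℂ) ^ (-(k * s)) = ((p : ℂ) ^ (-s)) ^ k := by
  rw [← Complex.cpow_nat_mul]; ring_nf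

lemma LSeries_STwist_identity {q : ℕ} (χ : DirichletCharacter ℂ q) {s : ℂ} (hs : 1 < s.re) :
    LSeries (STwist χ) s ^ 4 * LSeries (fun n => mulChiNeg4 (χ ^ 2) n) (2 * s) *
      (1 - χ 2 * 2 ^ (-s)) =
    LSeries (fun n => χ n) s ^ 2 * LSeries (fun n => mulChiNeg4 χ n) s ^ 2 *
      LSeries (fun n => (χ ^ 2) n) (2 * s) * (1 + χ 2 * 2 ^ (-s)) *
      LSeries (quarticTwist χ) (4 * s) := by
  have h2s : 1 < (2 * s).re := by simp; linarith
  have h4s : 1 < (4 * s).re := by simp; linarith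
  let two : Nat.Primes := ⟨2, Nat.prime_two⟩
  have hs2 : ∀ w : ℂ, HasProd (fun p : Nat.Primes => if p = two then w else 1) w :=
    fun w => hasProd_ite_eq two w
  have hL := (((STwist_hasProd χ hs).pow 4).mul
    ((mulChiNeg4 (χ ^ 2)).LSeries_eulerProduct_hasProd h2s)).mul (hs2 (1 - χ 2 * 2 ^ (-s)))
  have hR := (((((χ.LSeries_eulerProduct_hasProd hs).pow 2).mul
    (((mulChiNeg4 χ).LSeries_eulerProduct_hasProd hs).pow 2)).mul
    ((χ ^ 2).LSeries_eulerProduct_hasProd h2s)).mul (hs2 (1 + χ 2 * 2 ^ (-s)))).mul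
    (quarticTwist_hasProd χ h4s)
  refine hL.unique ?_
  convert hR using 2 with p
  have hp := p.2
  have e2 : ((p : ℕ) : ℂ) ^ (-(2 * s)) = (((p : ℕ) : ℂ) ^ (-s)) ^ 2 := by
    exact_mod_cast cpow_neg_mul_nat p s 2
  have e4 : ((p : ℕ) : ℂ) ^ (-(4 * s)) = (((p : ℕ) : ℂ) ^ (-s)) ^ 4 := by
    exact_mod_cast cpow_neg_mul_nat p s 4
  rw [mulChiNeg4_apply, mulChiNeg4_apply, e2, e4, MulChar.pow_apply' _ two_ne_zero]
  have hz1 : ‖χ (p : ℕ) * ((p : ℕ) : ℂ) ^ (-s)‖ < 1 :=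
    norm_mul_cpow_neg_lt_one hp (χ.norm_le_one _) (by linarith)
  have hpe : p = two ↔ (p : ℕ) = 2 := Subtype.ext_iff
  set z := χ (p : ℕ) * ((p : ℕ) : ℂ) ^ (-s) with hz
  have g2 : χ (p : ℕ) ^ 2 * (((p : ℕ) : ℂ) ^ (-s)) ^ 2 = z ^ 2 := by rw [hz]; ring
  have g4 : χ (p : ℕ) ^ 4 * (((p : ℕ) : ℂ) ^ (-s)) ^ 4 = z ^ 4 := by rw [hz]; ring
  have hn1 : 1 - z ≠ 0 := by
    intro h; rw [← sub_eq_zero.1 h] at hz1; simp at hz1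
  have hn2 : 1 + z ≠ 0 := by
    intro h; rw [← neg_eq_of_add_eq_zero_right h] at hz1; simp at hz1
  have hn3 : 1 + z ^ 2 ≠ 0 := by
    intro h
    have : ‖z ^ 2‖ < 1 := by rw [norm_pow]; exact pow_lt_one₀ (norm_nonneg _) hz1 two_ne_zero
    rw [← neg_eq_of_add_eq_zero_right h] at this; simp at this
  have hn4 : 1 - z ^ 2 ≠ 0 := by
    have : 1 - z ^ 2 = (1 - z) * (1 + z) := by ring
    rw [this]; exact mul_ne_zero hn1 hn2
  have hn5 : 1 - z ^ 4 ≠ 0 := by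
    have : 1 - z ^ 4 = (1 - z ^ 2) * (1 + z ^ 2) := by ring
    rw [this]; exact mul_ne_zero hn4 hn3
  set k : ℂ := ((ZMod.χ₄ ((p : ℕ) : ZMod 4) : ℤ) : ℂ) with hk
  have g5 : χ (p : ℕ) ^ 2 * k * (((p : ℕ) : ℂ) ^ (-s)) ^ 2 = k * z ^ 2 := by rw [hz]; ring
  have g6 : χ (p : ℕ) * k * ((p : ℕ) : ℂ) ^ (-s) = k * z := by rw [hz]; ring
  rw [g2, g4, g5, g6]
  rw [ZMod.χ₄_nat_eq_if_mod_four] at hk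
  have a1 : 1 - z ^ 2 = (1 - z) * (1 + z) := by ring
  have a2 : 1 - z ^ 4 = (1 - z) * (1 + z) * (1 + z ^ 2) := by ring
  have a3 : 1 - -1 * z = 1 + z := by ring
  have a4 : 1 - -1 * z ^ 2 = 1 + z ^ 2 := by ring
  rcases hp.eq_two_or_odd with h | h
  · have h3 : ¬ (p : ℕ) % 4 = 3 := by omega
    have hz2 : χ 2 * 2 ^ (-s) = z := by rw [hz, h]; simp
    have hk0 : k = 0 := by rw [hk, h]; simp
    rw [if_neg h3, if_neg h3, if_pos (hpe.2 h), if_pos (hpe.2 h), hz2, hk0, a1]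
    field_simp
    ring
  · have hne : ¬ p = two := by rw [hpe]; omega
    rw [if_neg hne, if_neg hne]
    rw [if_neg (by omega : ¬ (p : ℕ) % 2 = 0)] at hk
    rcases (by omega : (p : ℕ) % 4 = 1 ∨ (p : ℕ) % 4 = 3) with h1 | h1
    · have h3 : ¬ (p : ℕ) % 4 = 3 := by omega
      have hk1 : k = 1 := by rw [hk, if_pos h1]; simp
      rw [if_neg h3, if_neg h3, hk1, one_mul, one_mul, a1]
      field_simp
    · have h3 : ¬ (p : ℕ) % 4 = 1 := by omega
      have hk1 : k = -1 := by rw [hk, if_neg h3]; simp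
      rw [if_pos h1, if_pos h1, hk1, a3, a4, a2, a1]
      field_simp

/-- The height `t` carries a singularity of the generating series of `χ` on `Re s = 1/2`. -/
def IsSingularHeight {q : ℕ} (χ : DirichletCharacter ℂ q) (t : ℝ) : Prop :=
  LVal χ (1 / 2 + t * I) * LVal (mulChiNeg4 χ) (1 / 2 + t * I) = 0 ∨
    (t = 0 ∧ (χ ^ 2 = 1 ∨ mulChiNeg4 (χ ^ 2) = 1))

/-- The half-plane `Re s > 1/4` cut along the horizontal rays to the left of singularities. -/
def cutHalfPlane {q : ℕ} (χ : DirichletCharacter ℂ q) : Set ℂ :=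
  {s : ℂ | 1 / 4 < s.re ∧ (s.re ≤ 1 / 2 → ¬ IsSingularHeight χ s.im)}

lemma LSeries_quarticTwist_four_ne_zero {q : ℕ} (χ : DirichletCharacter ℂ q) :
    LSeries (quarticTwist χ) 4 ≠ 0 := by
  have hsum : LSeriesSummable (quarticTwist χ) 4 :=
    LSeriesSummable_of_bounded_of_one_lt_re (m := 1) (fun n _ => norm_quarticTwist_le χ n)
      (by norm_num)
  have h1 : LSeries.term (quarticTwist χ) 4 1 = 1 := by simp [LSeries.term, quarticTwist]
  have e := hsum.tsum_eq_add_tsum_ite 1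
  have e2 := (hasSum_zeta_four.summable).tsum_eq_add_tsum_ite 1
  rw [hasSum_zeta_four.tsum_eq] at e2
  have hpi : Real.pi ^ 4 / 90 < 2 := by
    have := Real.pi_lt_d2
    have h3 := Real.pi_pos
    have : Real.pi ^ 4 < 3.15 ^ 4 := pow_lt_pow_left₀ this h3.le (by norm_num)
    norm_num at this
    linarith
  have hle : ‖∑' n, (if n = 1 then 0 else LSeries.term (quarticTwist χ) 4 n)‖ ≤
      ∑' n : ℕ, (if n = 1 then 0 else (1 : ℝ) / (n : ℝ) ^ 4) := by
    refine tsum_of_norm_bounded (g := fun n : ℕ => if n = 1 then 0 else (1 : ℝ) / (n : ℝ) ^ 4) ?_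
      fun n => ?_
    · refine Summable.hasSum ?_
      refine Summable.of_nonneg_of_le (fun n => ?_) (fun n => ?_) hasSum_zeta_four.summable
      · split_ifs <;> positivity
      · split_ifs
        · positivity
        · exact le_rfl
    · split_ifs with h
      · simp
      · rcases eq_or_ne n 0 with rfl | hn
        · simp
        · rw [LSeries.term_of_ne_zero hn, norm_div]
          have : ‖(n : ℂ) ^ (4 : ℂ)‖ = (n : ℝ) ^ 4 := by
            rw [Complex.norm_natCast_cpow_of_pos (Nat.pos_of_ne_zero hn)]
            norm_num
          rw [this]
          exact div_le_div_of_nonneg_right (norm_quarticTwist_le χ n) (by positivity)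
  intro h0
  rw [LSeries] at h0
  rw [h0, h1] at e
  have e3 : ‖∑' n, (if n = 1 then 0 else LSeries.term (quarticTwist χ) 4 n)‖ = 1 := by
    rw [← neg_eq_of_add_eq_zero_right e.symm]; simp
  rw [e3] at hle
  norm_num at e2 hle
  linarith

lemma differentiableAt_LSeries_quarticTwist {q : ℕ} (χ : DirichletCharacter ℂ q) {s : ℂ}
    (hs : 1 < s.re) : DifferentiableAt ℂ (LSeries (quarticTwist χ)) s := by
  refine ((LSeries_analyticOnNhd (quarticTwist χ)) s ?_).differentiableAt
  have : LSeries.abscissaOfAbsConv (quarticTwist χ) ≤ 1 :=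
    LSeries.abscissaOfAbsConv_le_of_le_const ⟨1, fun n _ => norm_quarticTwist_le χ n⟩
  exact lt_of_le_of_lt this (by exact_mod_cast hs)

lemma norm_two_cpow_neg_le {s : ℂ} (hs : 3 / 8 ≤ s.re) : ‖(2 : ℂ) ^ (-s)‖ ≤ 4 / 5 := by
  have e : ‖(2 : ℂ) ^ (-s)‖ = (2 : ℝ) ^ (-s.re) := by
    have := Complex.norm_natCast_cpow_of_pos (n := 2) two_pos (-s)
    simpa using this
  rw [e]
  calc (2 : ℝ) ^ (-s.re) ≤ 2 ^ (-(3 / 8 : ℝ)) :=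
        Real.rpow_le_rpow_of_exponent_le (by norm_num) (by linarith)
    _ ≤ 4 / 5 := by
        rw [Real.rpow_neg (by norm_num), inv_le_comm₀ (by positivity) (by norm_num)]
        have h : ((4 / 5 : ℝ)⁻¹) ^ 8 ≤ ((2 : ℝ) ^ (3 / 8 : ℝ)) ^ 8 := by
          rw [← Real.rpow_natCast (2 ^ (3 / 8 : ℝ)), ← Real.rpow_mul (by norm_num)]
          norm_num
        exact le_of_pow_le_pow_left₀ (by norm_num) (by positivity) h

lemma LFunction_STwist_identity {q : ℕ} [NeZero q] (χ : DirichletCharacter ℂ q) {s : ℂ}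
    (hs : 1 < s.re) :
    LSeries (STwist χ) s ^ 4 * DirichletCharacter.LFunction (mulChiNeg4 (χ ^ 2)) (2 * s) *
      (1 - χ 2 * 2 ^ (-s)) =
    DirichletCharacter.LFunction χ s ^ 2 * DirichletCharacter.LFunction (mulChiNeg4 χ) s ^ 2 *
      DirichletCharacter.LFunction (χ ^ 2) (2 * s) * (1 + χ 2 * 2 ^ (-s)) *
      LSeries (quarticTwist χ) (4 * s) := by
  have h2s : 1 < (2 * s).re := by simp; linarith
  rw [DirichletCharacter.LFunction_eq_LSeries _ hs, DirichletCharacter.LFunction_eq_LSeries _ hs,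
    DirichletCharacter.LFunction_eq_LSeries _ h2s, DirichletCharacter.LFunction_eq_LSeries _ h2s]
  exact LSeries_STwist_identity χ hs

lemma mulChiNeg4_ne_one {q : ℕ} [NeZero q] {χ : DirichletCharacter ℂ q} (hχ : χ ≠ 1)
    {F : ℂ → ℂ} (hFser : ∀ s : ℂ, 1 < s.re → F s = LSeries (STwist χ) s)
    (hF : ContinuousAt F 1) : mulChiNeg4 χ ≠ 1 := by
  intro h0
  have hnb : (nhdsWithin (1 : ℂ) {s : ℂ | 1 < s.re}).NeBot := by
    rw [← mem_closure_iff_nhdsWithin_neBot, Complex.closure_setOfPred_lt_re]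
    simp
  set l := nhdsWithin (1 : ℂ) {s : ℂ | 1 < s.re} with hl
  have hl1 : l ≤ nhds 1 := nhdsWithin_le_nhds
  have hl2 : l ≤ nhdsWithin 1 {1}ᶜ := nhdsWithin_mono _ (by
    rintro s hs rfl
    simp at hs)
  have hc2 : Tendsto (fun s : ℂ => 2 * s) (nhds 1) (nhds (2 : ℂ)) := by
    have : Continuous fun s : ℂ => 2 * s := by fun_prop
    simpa using this.tendsto 1
  have hc4 : Tendsto (fun s : ℂ => 4 * s) (nhds 1) (nhds (4 : ℂ)) := by
    have : Continuous fun s : ℂ => 4 * s := by fun_prop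
    simpa using this.tendsto 1
  have hL2 : Tendsto (fun s : ℂ => DirichletCharacter.LFunction (mulChiNeg4 (χ ^ 2)) (2 * s)) l
      (nhds (DirichletCharacter.LFunction (mulChiNeg4 (χ ^ 2)) 2)) :=
    ((DirichletCharacter.differentiableAt_LFunction _ 2 (.inl (by norm_num))).continuousAt.tendsto.comp
      hc2).mono_left hl1
  have hL2' : Tendsto (fun s : ℂ => DirichletCharacter.LFunction (χ ^ 2) (2 * s)) l
      (nhds (DirichletCharacter.LFunction (χ ^ 2) 2)) :=
    ((DirichletCharacter.differentiableAt_LFunction _ 2 (.inl (by norm_num))).continuousAt.tendsto.comp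
      hc2).mono_left hl1
  have hL1 : Tendsto (DirichletCharacter.LFunction χ) l
      (nhds (DirichletCharacter.LFunction χ 1)) :=
    ((DirichletCharacter.differentiable_LFunction hχ).continuous.tendsto 1).mono_left hl1
  have hE : Tendsto (fun s => LSeries (quarticTwist χ) (4 * s)) l
      (nhds (LSeries (quarticTwist χ) 4)) :=
    ((differentiableAt_LSeries_quarticTwist χ (s := 4) (by norm_num)).continuousAt.tendsto.comp
      hc4).mono_left hl1
  have hres : Tendsto (fun s => (s - 1) * DirichletCharacter.LFunction (mulChiNeg4 χ) s) l
      (nhds (∏ p ∈ (4 * q).primeFactors, (1 - (p : ℂ)⁻¹))) := by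
    rw [h0]
    exact (DirichletCharacter.LFunctionTrivChar_residue_one (N := 4 * q)).mono_left hl2
  have hcont : Continuous fun s : ℂ => (2 : ℂ) ^ (-s) :=
    (continuous_neg).const_cpow (.inl two_ne_zero)
  have hz : Tendsto (fun s : ℂ => χ 2 * (2 : ℂ) ^ (-s)) l (nhds (χ 2 * 2 ^ (-1 : ℂ))) :=
    ((continuous_const.mul hcont).tendsto 1).mono_left hl1
  have hF' : Tendsto F l (nhds (F 1)) := hF.tendsto.mono_left hl1
  have hs1 : Tendsto (fun s : ℂ => s - 1) l (nhds 0) := by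
    have : Continuous fun s : ℂ => s - 1 := by fun_prop
    simpa using (this.tendsto 1).mono_left hl1
  have t1 := (hs1.pow 2).mul (((hF'.pow 4).mul hL2).mul (tendsto_const_nhds.sub hz : Tendsto
    (fun s : ℂ => (1 : ℂ) - χ 2 * (2 : ℂ) ^ (-s)) l (nhds (1 - χ 2 * 2 ^ (-1 : ℂ)))))
  have t2 := ((((hL1.pow 2).mul (hres.pow 2)).mul hL2').mul (tendsto_const_nhds.add hz : Tendsto
    (fun s : ℂ => (1 : ℂ) + χ 2 * (2 : ℂ) ^ (-s)) l (nhds (1 + χ 2 * 2 ^ (-1 : ℂ))))).mul hE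
  have heq := tendsto_nhds_unique_of_eventuallyEq t1 t2 (by
    filter_upwards [self_mem_nhdsWithin] with s hs
    rw [hFser s hs, LFunction_STwist_identity χ hs]
    ring)
  rw [zero_pow two_ne_zero, zero_mul] at heq
  have n1 : DirichletCharacter.LFunction χ 1 ≠ 0 :=
    DirichletCharacter.LFunction_ne_zero_of_one_le_re χ (.inl hχ) (by simp)
  have n2 : DirichletCharacter.LFunction (χ ^ 2) 2 ≠ 0 :=
    DirichletCharacter.LFunction_ne_zero_of_one_le_re _ (.inr (by norm_num)) (by norm_num)
  have n3 : ∏ p ∈ (4 * q).primeFactors, (1 - (p : ℂ)⁻¹) ≠ 0 := by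
    refine Finset.prod_ne_zero_iff.mpr fun p hp ↦ ?_
    simpa [sub_ne_zero] using (Nat.prime_of_mem_primeFactors hp).ne_one
  have n4 : 1 + χ 2 * (2 : ℂ) ^ (-1 : ℂ) ≠ 0 := by
    intro h
    have h5 : ‖χ 2 * (2 : ℂ) ^ (-1 : ℂ)‖ = 1 := by
      rw [← neg_eq_of_add_eq_zero_right h]; simp
    have h6 := norm_two_cpow_neg_le (s := 1) (by norm_num)
    rw [norm_mul] at h5
    have h7 := χ.norm_le_one 2
    have := mul_le_mul h7 h6 (norm_nonneg _) zero_le_one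
    linarith
  exact (mul_ne_zero (mul_ne_zero (mul_ne_zero (mul_ne_zero (pow_ne_zero 2 n1)
    (pow_ne_zero 2 n3)) n2) n4) (LSeries_quarticTwist_four_ne_zero χ)) heq.symm

lemma isOpen_not_isSingularHeight {q : ℕ} [NeZero q] {χ : DirichletCharacter ℂ q} (hχ : χ ≠ 1)
    (hχ4 : mulChiNeg4 χ ≠ 1) : IsOpen {t : ℝ | ¬ IsSingularHeight χ t} := by
  have e : {t : ℝ | ¬ IsSingularHeight χ t} = {t : ℝ | DirichletCharacter.LFunction χ (1 / 2 + t * I) *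
      DirichletCharacter.LFunction (mulChiNeg4 χ) (1 / 2 + t * I) ≠ 0} ∩
      {t : ℝ | t ≠ 0 ∨ ¬ (χ ^ 2 = 1 ∨ mulChiNeg4 (χ ^ 2) = 1)} := by
    ext t
    simp only [IsSingularHeight, LVal_eq_LFunction, Set.mem_ofPred_eq, Set.mem_inter_iff, not_or]
    tauto
  rw [e]
  have c1 := (DirichletCharacter.differentiable_LFunction hχ).continuous
  have c2 := (DirichletCharacter.differentiable_LFunction hχ4).continuous
  refine IsOpen.inter (isOpen_ne_fun (by fun_prop) continuous_const) ?_
  by_cases h : χ ^ 2 = 1 ∨ mulChiNeg4 (χ ^ 2) = 1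
  · simpa [h] using isOpen_ne
  · simp [h]

lemma isOpen_cutHalfPlane {q : ℕ} [NeZero q] {χ : DirichletCharacter ℂ q} (hχ : χ ≠ 1)
    (hχ4 : mulChiNeg4 χ ≠ 1) : IsOpen (cutHalfPlane χ) := by
  have e : cutHalfPlane χ = {s : ℂ | 1 / 4 < s.re} ∩ ({s : ℂ | 1 / 2 < s.re} ∪
      Complex.im ⁻¹' {t : ℝ | ¬ IsSingularHeight χ t}) := by
    ext s
    simp only [cutHalfPlane, Set.mem_ofPred_eq, Set.mem_inter_iff, Set.mem_union, Set.mem_preimage,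
      ← not_le]
    tauto
  rw [e]
  exact (isOpen_lt continuous_const Complex.continuous_re).inter
    ((isOpen_lt continuous_const Complex.continuous_re).union
      ((isOpen_not_isSingularHeight hχ hχ4).preimage Complex.continuous_im))

lemma isPreconnected_cutHalfPlane {q : ℕ} (χ : DirichletCharacter ℂ q) :
    IsPreconnected (cutHalfPlane χ) := by
  refine isPreconnected_of_forall (2 : ℂ) fun y hy => ?_
  have hconv : IsPreconnected {s : ℂ | 1 / 2 < s.re} :=
    (convex_halfSpace_re_gt (1 / 2)).isPreconnected
  have hray : Convex ℝ ({s : ℂ | y.re ≤ s.re} ∩ {s : ℂ | s.im = y.im}) :=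
    (convex_halfSpace_re_ge _).inter
      (convex_hyperplane Complex.imLm.isLinear y.im)
  refine ⟨{s : ℂ | 1 / 2 < s.re} ∪ ({s : ℂ | y.re ≤ s.re} ∩ {s : ℂ | s.im = y.im}), ?_, ?_, ?_, ?_⟩
  · rintro s (hs | ⟨hs1, hs2⟩)
    · simp only [Set.mem_ofPred_eq] at hs
      exact ⟨by linarith, fun h => by linarith⟩
    · simp only [Set.mem_ofPred_eq] at hs1 hs2
      exact ⟨hy.1.trans_le hs1, fun h => hs2 ▸ hy.2 (hs1.trans h)⟩
  · left; norm_num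
  · right; simp
  · refine IsPreconnected.union (max 1 y.re + y.im * I) ?_ ?_ hconv hray.isPreconnected
    · simp only [Set.mem_ofPred_eq, add_re, ofReal_re, mul_re, I_re, mul_zero, ofReal_im, I_im,
        mul_one, sub_self, add_zero]
      have := le_max_left 1 y.re
      linarith
    · simp

lemma continuation_STwist_identity {q : ℕ} [NeZero q] {χ : DirichletCharacter ℂ q} (hχ : χ ≠ 1)
    (hχ4 : mulChiNeg4 χ ≠ 1) {F : ℂ → ℂ}
    (hFser : ∀ s : ℂ, 1 < s.re → F s = LSeries (STwist χ) s)
    (hFan : DifferentiableOn ℂ F (cutHalfPlane χ)) {s : ℂ} (hs : s ∈ cutHalfPlane χ) :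
    F s ^ 4 * DirichletCharacter.LFunction (mulChiNeg4 (χ ^ 2)) (2 * s) *
      (1 - χ 2 * 2 ^ (-s)) =
    DirichletCharacter.LFunction χ s ^ 2 * DirichletCharacter.LFunction (mulChiNeg4 χ) s ^ 2 *
      DirichletCharacter.LFunction (χ ^ 2) (2 * s) * (1 + χ 2 * 2 ^ (-s)) *
      LSeries (quarticTwist χ) (4 * s) := by
  have hU := isOpen_cutHalfPlane hχ hχ4
  have d2 : ∀ {M : ℕ} [NeZero M] (ψ : DirichletCharacter ℂ M),
      (ψ = 1 → χ ^ 2 = 1 ∨ mulChiNeg4 (χ ^ 2) = 1) →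
      DifferentiableOn ℂ (fun s => DirichletCharacter.LFunction ψ (2 * s)) (cutHalfPlane χ) := by
    intro M _ ψ hψ w hw
    have : DifferentiableAt ℂ (DirichletCharacter.LFunction ψ) (2 * w) := by
      refine DirichletCharacter.differentiableAt_LFunction ψ _ ?_
      by_contra! hcon
      have hw2 : w = 1 / 2 := by linear_combination hcon.1 / 2
      rw [hw2] at hw
      exact hw.2 (by norm_num) (.inr ⟨by norm_num, hψ hcon.2⟩)
    exact (this.comp w (by fun_prop : DifferentiableAt ℂ (fun s : ℂ => 2 * s) w)).differentiableWithinAt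
  have dz : Differentiable ℂ fun s : ℂ => χ 2 * (2 : ℂ) ^ (-s) :=
    (differentiable_neg.const_cpow (.inl two_ne_zero)).const_mul _
  have dE : DifferentiableOn ℂ (fun s => LSeries (quarticTwist χ) (4 * s)) (cutHalfPlane χ) := by
    intro w hw
    have : DifferentiableAt ℂ (LSeries (quarticTwist χ)) (4 * w) :=
      differentiableAt_LSeries_quarticTwist χ (by have := hw.1; simp; linarith)
    exact (this.comp w (by fun_prop : DifferentiableAt ℂ (fun s : ℂ => 4 * s) w)).differentiableWithinAt
  have dL := (DirichletCharacter.differentiable_LFunction hχ).differentiableOn (s := cutHalfPlane χ)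
  have dL4 := (DirichletCharacter.differentiable_LFunction hχ4).differentiableOn
    (s := cutHalfPlane χ)
  have h2 : (2 : ℂ) ∈ cutHalfPlane χ := by
    refine ⟨by norm_num, fun h => ?_⟩
    norm_num at h
  have A1 := (((hFan.pow 4).mul (d2 (mulChiNeg4 (χ ^ 2)) .inr)).mul
    (dz.const_sub 1).differentiableOn).analyticOnNhd hU
  have A2 := (((((dL.pow 2).mul (dL4.pow 2)).mul (d2 (χ ^ 2) .inl)).mul
    (dz.const_add 1).differentiableOn).mul dE).analyticOnNhd hU
  refine A1.eqOn_of_preconnected_of_eventuallyEq A2 (isPreconnected_cutHalfPlane χ) h2 ?_ hs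
  have hopen : {s : ℂ | 1 < s.re} ∈ nhds (2 : ℂ) :=
    (isOpen_lt continuous_const Complex.continuous_re).mem_nhds (by norm_num)
  filter_upwards [hopen] with w hw
  have := LFunction_STwist_identity χ hw
  rw [← hFser w hw] at this
  exact this

lemma exists_norm_pow_four_le {q : ℕ} [NeZero q] {χ : DirichletCharacter ℂ q} (hχ : χ ≠ 1)
    (hχ4 : mulChiNeg4 χ ≠ 1) (h1 : GRH χ) (h2 : GRH (mulChiNeg4 χ)) (h3 : GRH (χ ^ 2))
    (h4 : GRH (mulChiNeg4 (χ ^ 2))) {F : ℂ → ℂ}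
    (hFser : ∀ s : ℂ, 1 < s.re → F s = LSeries (STwist χ) s)
    (hFan : DifferentiableOn ℂ F (cutHalfPlane χ)) :
    ∃ A C T₀ : ℝ, 0 ≤ A ∧ 1 ≤ C ∧ 4 ≤ T₀ ∧ ∀ T : ℝ, T₀ ≤ T → ∀ s ∈ cutHalfPlane χ, s ≠ 1 / 2 →
      3 / 8 ≤ s.re → |s.im| ≤ T →
      ‖F s‖ ^ 4 ≤ C * (T ^ (max 0 (1 / 2 - s.re))) ^ 4 * (1 + 1 / ‖2 * s - 1‖) *
        Real.exp (A * (Real.log T / Real.log (Real.log T))) := by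
  obtain ⟨C₁, T₁, hC₁, hT₁, b₁⟩ := exists_norm_LFunction_le_of_GRH hχ h1
  obtain ⟨C₂, T₂, hC₂, hT₂, b₂⟩ := exists_norm_LFunction_le_of_GRH hχ4 h2
  obtain ⟨A₃, C₃, T₃, hA₃, hC₃, hT₃, b₃⟩ := exists_bounds_LFunction_of_GRH h3
  obtain ⟨A₄, C₄, T₄, hA₄, hC₄, hT₄, b₄⟩ := exists_bounds_LFunction_of_GRH h4
  obtain ⟨K, hK0, hK⟩ := exists_norm_LSeries_le (f := quarticTwist χ) (s₀ := 3 / 2)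
    (LSeriesSummable_of_bounded_of_one_lt_re (m := 1) (fun n _ => norm_quarticTwist_le χ n)
      (by norm_num))
  refine ⟨A₄ + 164 + A₃, 1 + 10 * (C₄ * C₁ ^ 2 * C₂ ^ 2 * C₃ * K), max (max T₁ T₂) (max T₃ T₄),
    by linarith, ?_, hT₁.trans ((le_max_left _ _).trans (le_max_left _ _)),
    fun T hT s hs hs1 hre him => ?_⟩
  · have : 0 ≤ 10 * (C₄ * C₁ ^ 2 * C₂ ^ 2 * C₃ * K) := by positivity
    linarith
  have t1 := (max_le_iff.1 (max_le_iff.1 hT).1).1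
  have t2 := (max_le_iff.1 (max_le_iff.1 hT).1).2
  have t3 := (max_le_iff.1 (max_le_iff.1 hT).2).1
  have t4 := (max_le_iff.1 (max_le_iff.1 hT).2).2
  set M := Real.log T / Real.log (Real.log T) with hM
  set P := T ^ (max 0 (1 / 2 - s.re)) with hP
  have hP0 : 0 ≤ P := Real.rpow_nonneg (by linarith) _
  have hid := continuation_STwist_identity hχ hχ4 hFser hFan hs
  have hs2 : 2 * s ≠ 1 := fun h => hs1 (by linear_combination h / 2)
  have hre2 : 3 / 4 ≤ (2 * s).re := by simp; linarith
  have him2 : |(2 * s).im| ≤ 2 * T := by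
    simp [abs_mul]; exact him
  have e1 := b₁ T t1 s hre him
  have e2 := b₂ T t2 s hre him
  have e3 := (b₃ T t3 (2 * s) hre2 him2 hs2).1
  have e4 := (b₄ T t4 (2 * s) hre2 him2 hs2).2
  have e5 : ‖LSeries (quarticTwist χ) (4 * s)‖ ≤ K := hK _ (by
    have : (3 / 2 : ℂ).re = 3 / 2 := by norm_num
    rw [this]; simp; linarith)
  have hz : ‖χ 2 * (2 : ℂ) ^ (-s)‖ ≤ 4 / 5 := by
    rw [norm_mul]
    have := mul_le_mul (χ.norm_le_one 2) (norm_two_cpow_neg_le hre) (norm_nonneg _) zero_le_one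
    linarith
  have hz1 : 1 / 5 ≤ ‖1 - χ 2 * (2 : ℂ) ^ (-s)‖ := by
    have := norm_sub_norm_le (1 : ℂ) (χ 2 * (2 : ℂ) ^ (-s))
    rw [norm_one] at this
    linarith
  have hz2 : ‖1 + χ 2 * (2 : ℂ) ^ (-s)‖ ≤ 2 := by
    have := norm_add_le (1 : ℂ) (χ 2 * (2 : ℂ) ^ (-s))
    rw [norm_one] at this
    linarith
  have hidn := congrArg norm hid
  simp only [norm_mul, norm_pow] at hidn
  set L₁ := ‖DirichletCharacter.LFunction χ s‖
  set L₂ := ‖DirichletCharacter.LFunction (mulChiNeg4 χ) s‖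
  set L₃ := ‖DirichletCharacter.LFunction (χ ^ 2) (2 * s)‖
  set L₄ := ‖DirichletCharacter.LFunction (mulChiNeg4 (χ ^ 2)) (2 * s)‖
  set E := Real.exp (41 * M) with hE
  set E₃ := Real.exp (A₃ * M) with hE₃
  set E₄ := Real.exp (A₄ * M) with hE₄
  have l1 : 0 ≤ L₁ := norm_nonneg _
  have l2 : 0 ≤ L₂ := norm_nonneg _
  have l3 : 0 ≤ L₃ := norm_nonneg _
  have l4 : 0 ≤ L₄ := norm_nonneg _
  set R := 1 + 1 / ‖2 * s - 1‖ with hR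
  have hR0 : 0 ≤ R := by positivity
  have hexp : Real.exp ((A₄ + 164 + A₃) * M) = E₄ * E ^ 4 * E₃ := by
    rw [hE, hE₃, hE₄, ← Real.exp_nat_mul, ← Real.exp_add, ← Real.exp_add]
    congr 1; push_cast; ring
  set f := ‖F s‖ ^ 4 with hf
  have hf0 : 0 ≤ f := by positivity
  have s1 : f ≤ C₄ * E₄ * (f * L₄) := by nlinarith [mul_le_mul_of_nonneg_left e4 hf0]
  have s2 : f * L₄ ≤ 5 * (f * L₄ * ‖1 - χ 2 * (2 : ℂ) ^ (-s)‖) := by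
    nlinarith [mul_le_mul_of_nonneg_left hz1 (mul_nonneg hf0 l4)]
  have s3 : f * L₄ * ‖1 - χ 2 * (2 : ℂ) ^ (-s)‖ ≤
      (C₁ * P * E) ^ 2 * (C₂ * P * E) ^ 2 * (C₃ * R * E₃) * 2 * K := by
    rw [hidn]
    gcongr
  calc f ≤ C₄ * E₄ * (5 * ((C₁ * P * E) ^ 2 * (C₂ * P * E) ^ 2 * (C₃ * R * E₃) * 2 * K)) :=
        s1.trans (mul_le_mul_of_nonneg_left (s2.trans (by linarith)) (by positivity))
    _ = 10 * (C₄ * C₁ ^ 2 * C₂ ^ 2 * C₃ * K) * P ^ 4 * R * (E₄ * E ^ 4 * E₃) := by ring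
    _ ≤ (1 + 10 * (C₄ * C₁ ^ 2 * C₂ ^ 2 * C₃ * K)) * P ^ 4 * R * (E₄ * E ^ 4 * E₃) := by
        gcongr; linarith
    _ = _ := by rw [hexp]

lemma exists_norm_le_of_dist_half {q : ℕ} [NeZero q] {χ : DirichletCharacter ℂ q} (hχ : χ ≠ 1)
    (hχ4 : mulChiNeg4 χ ≠ 1) (h1 : GRH χ) (h2 : GRH (mulChiNeg4 χ)) (h3 : GRH (χ ^ 2))
    (h4 : GRH (mulChiNeg4 (χ ^ 2))) {F : ℂ → ℂ}
    (hFser : ∀ s : ℂ, 1 < s.re → F s = LSeries (STwist χ) s)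
    (hFan : DifferentiableOn ℂ F (cutHalfPlane χ)) {c : ℝ} (hc : 0 < c) :
    ∃ A C T₀ : ℝ, 0 ≤ A ∧ 1 ≤ C ∧ 4 ≤ T₀ ∧ ∀ T : ℝ, T₀ ≤ T → ∀ s ∈ cutHalfPlane χ,
      c ≤ ‖s - 1 / 2‖ → 3 / 8 ≤ s.re → |s.im| ≤ T →
      ‖F s‖ ≤ C * T ^ (max 0 (1 / 2 - s.re)) *
        Real.exp (A * (Real.log T / Real.log (Real.log T))) := by
  obtain ⟨A, C, T₀, hA, hC, hT₀, hb⟩ := exists_norm_pow_four_le hχ hχ4 h1 h2 h3 h4 hFser hFan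
  have hc' : 0 ≤ 1 / (2 * c) := by positivity
  refine ⟨A, C * (1 + 1 / (2 * c)), T₀, hA, by nlinarith, hT₀, fun T hT s hs hsc hre him => ?_⟩
  have hs1 : s ≠ 1 / 2 := by
    rintro rfl
    simp at hsc
    linarith
  have := hb T hT s hs hs1 hre him
  set M := Real.log T / Real.log (Real.log T) with hM
  have hM0 : 0 ≤ M := log_div_log_log_nonneg (hT₀.trans hT)
  set P := T ^ (max 0 (1 / 2 - s.re)) with hP
  have hP0 : 0 ≤ P := Real.rpow_nonneg (by linarith) _
  have hR : 1 + 1 / ‖2 * s - 1‖ ≤ 1 + 1 / (2 * c) := by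
    have e : ‖2 * s - 1‖ = 2 * ‖s - 1 / 2‖ := by
      rw [show 2 * s - 1 = 2 * (s - 1 / 2) by ring, norm_mul]; simp
    rw [e]
    gcongr
  set E := Real.exp (A * M) with hE
  have hE1 : 1 ≤ E := Real.one_le_exp (by positivity)
  set D := C * (1 + 1 / (2 * c)) with hD
  have hD1 : 1 ≤ D := by rw [hD]; nlinarith
  refine le_of_pow_le_pow_left₀ (n := 4) (by norm_num) (by positivity) ?_
  calc ‖F s‖ ^ 4 ≤ _ := this
    _ ≤ C * P ^ 4 * (1 + 1 / (2 * c)) * E := by gcongr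
    _ = D * P ^ 4 * E := by rw [hD]; ring
    _ ≤ D ^ 4 * P ^ 4 * E ^ 4 := by
        gcongr
        · exact le_self_pow₀ hD1 (by norm_num)
        · exact le_self_pow₀ hE1 (by norm_num)
    _ = _ := by ring

lemma exists_norm_le_near_half {q : ℕ} [NeZero q] {χ : DirichletCharacter ℂ q} (hχ : χ ≠ 1)
    (hχ4 : mulChiNeg4 χ ≠ 1) (h1 : GRH χ) (h2 : GRH (mulChiNeg4 χ)) (h3 : GRH (χ ^ 2))
    (h4 : GRH (mulChiNeg4 (χ ^ 2))) {F : ℂ → ℂ}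
    (hFser : ∀ s : ℂ, 1 < s.re → F s = LSeries (STwist χ) s)
    (hFan : DifferentiableOn ℂ F (cutHalfPlane χ)) (γ : ℝ) :
    ∃ K δ : ℝ, 0 ≤ K ∧ 0 < δ ∧ ∀ s ∈ cutHalfPlane χ, s ≠ 1 / 2 + γ * I →
      ‖s - (1 / 2 + γ * I)‖ < δ → ‖F s‖ ≤ K * ‖s - (1 / 2 + γ * I)‖ ^ (-(1 / 4) : ℝ) := by
  obtain ⟨A, C, T₀, hA, hC, hT₀, hb⟩ := exists_norm_pow_four_le hχ hχ4 h1 h2 h3 h4 hFser hFan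
  set T := max T₀ (|γ| + 1) with hT
  set B := C * 2 ^ 4 * T ^ 4 * Real.exp (A * (Real.log T / Real.log (Real.log T))) with hB
  have hT1 : 1 ≤ T := by have := le_max_left T₀ (|γ| + 1); linarith
  have hB0 : 0 ≤ B := by positivity
  obtain ⟨K, hK1, hK⟩ : ∃ K : ℝ, 1 ≤ K ∧ B * (1 + 1 / |γ|) ≤ K := ⟨max 1 _, le_max_left _ _, le_max_right _ _⟩
  have hK2 : B ≤ K := by
    refine le_trans ?_ hK
    have : 0 ≤ 1 / |γ| := by positivity
    nlinarith
  obtain ⟨δ, hδ0, hδ1, hδ2⟩ : ∃ δ : ℝ, 0 < δ ∧ δ ≤ 1 / 8 ∧ (γ ≠ 0 → δ ≤ |γ| / 2) := by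
    rcases eq_or_ne γ 0 with h | h
    · exact ⟨1 / 8, by norm_num, le_rfl, fun h' => absurd h h'⟩
    · exact ⟨min (1 / 8) (|γ| / 2), lt_min (by norm_num) (by have := abs_pos.2 h; linarith),
        min_le_left _ _, fun _ => min_le_right _ _⟩
  refine ⟨K, δ, by linarith, hδ0, fun s hs hsne hsd => ?_⟩
  set d := ‖s - (1 / 2 + γ * I)‖ with hd
  have hd0 : 0 < d := norm_pos_iff.2 (sub_ne_zero.2 hsne)
  have hre : |s.re - 1 / 2| ≤ d := by
    have := Complex.abs_re_le_norm (s - (1 / 2 + γ * I))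
    rw [hd]
    simpa using this
  have him : |s.im - γ| ≤ d := by
    have := Complex.abs_im_le_norm (s - (1 / 2 + γ * I))
    rw [hd]
    simpa using this
  have hre' := abs_le.1 hre
  have himT : |s.im| ≤ T := by
    have : |s.im| ≤ |s.im - γ| + |γ| := by
      have := abs_add_le (s.im - γ) γ
      rwa [sub_add_cancel] at this
    have := le_max_right T₀ (|γ| + 1)
    linarith
  have key : s ≠ 1 / 2 ∧ d * (B * (1 + 1 / ‖2 * s - 1‖)) ≤ 2 ^ 4 * K := by
    rcases eq_or_ne γ 0 with h | h
    · have e0 : (1 / 2 + γ * I : ℂ) = 1 / 2 := by rw [h]; simp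
      rw [e0] at hsne
      refine ⟨hsne, ?_⟩
      have e : ‖2 * s - 1‖ = 2 * d := by
        rw [hd, e0, show 2 * s - 1 = 2 * (s - 1 / 2) by ring, norm_mul]; simp
      rw [e]
      have : d * (B * (1 + 1 / (2 * d))) = B * (d + 1 / 2) := by field_simp
      rw [this]
      nlinarith
    · have hg := abs_pos.2 h
      have hγim : |γ| / 2 ≤ |s.im| := by
        have : |γ| ≤ |s.im - γ| + |s.im| := by
          have := abs_sub (s.im) (s.im - γ)
          rw [sub_sub_cancel] at this
          linarith
        have := hδ2 h
        linarith
      refine ⟨?_, ?_⟩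
      · rintro rfl
        norm_num at hγim
        linarith
      · have e : |γ| ≤ ‖2 * s - 1‖ := by
          have := Complex.abs_im_le_norm (2 * s - 1)
          simp [abs_mul] at this
          linarith
        have e2 : B * (1 + 1 / ‖2 * s - 1‖) ≤ K := by
          refine le_trans ?_ hK
          gcongr
        have e3 : 0 ≤ B * (1 + 1 / ‖2 * s - 1‖) := by positivity
        nlinarith
  have hmain := hb T (le_max_left _ _) s hs key.1 (by linarith) himT
  have hP : T ^ (max 0 (1 / 2 - s.re)) ≤ T := by
    calc T ^ (max 0 (1 / 2 - s.re)) ≤ T ^ (1 : ℝ) :=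
          Real.rpow_le_rpow_of_exponent_le hT1 (max_le (by norm_num) (by linarith))
      _ = T := Real.rpow_one T
  have hP0 : 0 ≤ T ^ (max 0 (1 / 2 - s.re)) := Real.rpow_nonneg (by linarith) _
  have h5 : ‖F s‖ ^ 4 ≤ K * d⁻¹ := by
    have : 2 ^ 4 * ‖F s‖ ^ 4 ≤ B * (1 + 1 / ‖2 * s - 1‖) := by
      calc 2 ^ 4 * ‖F s‖ ^ 4 ≤ 2 ^ 4 * (C * T ^ 4 * (1 + 1 / ‖2 * s - 1‖) *
            Real.exp (A * (Real.log T / Real.log (Real.log T)))) := by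
            refine mul_le_mul_of_nonneg_left (hmain.trans ?_) (by norm_num)
            gcongr
        _ = _ := by rw [hB]; ring
    rw [← div_eq_mul_inv, le_div_iff₀ hd0]
    nlinarith [mul_le_mul_of_nonneg_left this hd0.le, key.2]
  refine le_of_pow_le_pow_left₀ (n := 4) (by norm_num) (by positivity) ?_
  calc ‖F s‖ ^ 4 ≤ K * d⁻¹ := h5
    _ ≤ K ^ 4 * d⁻¹ := by gcongr; exact le_self_pow₀ hK1 (by norm_num)
    _ = _ := by
        rw [mul_pow, ← Real.rpow_natCast (d ^ _), ← Real.rpow_mul hd0.le]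
        rw [show (-(1 / 4) : ℝ) * (4 : ℕ) = -1 by norm_num, Real.rpow_neg_one]

lemma finite_singularHeights {q : ℕ} [NeZero q] {χ : DirichletCharacter ℂ q} (hχ : χ ≠ 1)
    (hχ4 : mulChiNeg4 χ ≠ 1) (T : ℝ) :
    {t : ℝ | IsSingularHeight χ t ∧ |t| ≤ T}.Finite := by
  set f : ℂ → ℂ := fun t => DirichletCharacter.LFunction χ (1 / 2 + t * I) *
      DirichletCharacter.LFunction (mulChiNeg4 χ) (1 / 2 + t * I) with hf
  have hd : Differentiable ℂ f := by
    have := DirichletCharacter.differentiable_LFunction hχ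
    have := DirichletCharacter.differentiable_LFunction hχ4
    fun_prop
  have han : AnalyticOnNhd ℂ f Set.univ := hd.differentiableOn.analyticOnNhd isOpen_univ
  have hne : ∃ z, f z ≠ 0 := by
    refine ⟨-(3 / 2) * I, ?_⟩
    have e : (1 / 2 + -(3 / 2) * I * I : ℂ) = 2 := by
      linear_combination (-3 / 2 : ℂ) * Complex.I_mul_I
    rw [hf]
    simp only [e]
    exact mul_ne_zero
      (DirichletCharacter.LFunction_ne_zero_of_one_le_re _ (.inl hχ) (by norm_num))
      (DirichletCharacter.LFunction_ne_zero_of_one_le_re _ (.inl hχ4) (by norm_num))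
  have hfin : {z : ℂ | f z = 0 ∧ ‖z‖ ≤ T}.Finite := by
    have hK : IsCompact (Metric.closedBall (0 : ℂ) T) := isCompact_closedBall _ _
    have hcod : f ⁻¹' {0}ᶜ ∈ Filter.codiscrete ℂ := by
      obtain ⟨z, hz⟩ := hne
      exact han.preimage_zero_mem_codiscrete hz
    by_contra hinf
    have hsub : {z : ℂ | f z = 0 ∧ ‖z‖ ≤ T} ⊆ Metric.closedBall (0 : ℂ) T := by
      rintro z ⟨-, hz⟩
      simpa using hz
    obtain ⟨x, -, hx⟩ := Set.Infinite.exists_accPt_of_subset_isCompact hinf hK hsub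
    have hx2 := mem_codiscrete'.1 hcod
    have := (mem_codiscrete.1 hcod) x
    rw [accPt_iff_frequently_nhdsNE] at hx
    refine hx ?_
    have h6 : f ⁻¹' {0}ᶜ ∈ nhdsWithin x {x}ᶜ := by
      rw [Filter.disjoint_principal_right, compl_compl] at this
      exact this
    filter_upwards [h6] with z hz hz2
    exact hz hz2.1
  have hfin2 : ({t : ℝ | f (t : ℂ) = 0 ∧ |t| ≤ T} ∪ {0}).Finite := by
    refine Set.Finite.union ?_ (Set.finite_singleton _)
    refine (hfin.preimage (Complex.ofReal_injective.injOn)).subset ?_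
    rintro t ⟨h1, h2⟩
    exact ⟨h1, by simpa using h2⟩
  refine hfin2.subset ?_
  rintro t ⟨h1 | h1, h2⟩
  · left
    rw [LVal_eq_LFunction, LVal_eq_LFunction] at h1
    exact ⟨h1, h2⟩
  · right; exact h1.1

/-- The truncated Perron kernel `(1/2π) ∫ exp((b+it)L)/(b+it) dt` over `|t| ≤ T`. -/
def perronKernel (b T L : ℝ) : ℂ :=
  1 / (2 * Real.pi) * ∫ t in (-T)..T, Complex.exp ((b + t * I) * L) / (b + t * I)

lemma add_mul_I_ne_zero_of_re {b : ℝ} (hb : b ≠ 0) (t : ℝ) : (b + t * I : ℂ) ≠ 0 := by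
  intro h
  have := congrArg Complex.re h
  simp at this
  exact hb this

lemma add_mul_I_ne_zero_of_im {t : ℝ} (ht : t ≠ 0) (b : ℝ) : (b + t * I : ℂ) ≠ 0 := by
  intro h
  have := congrArg Complex.im h
  simp at this
  exact ht this

lemma norm_exp_div_le (L σ t τ : ℝ) (hτ : 0 < τ) (ht : τ ≤ |t|) :
    ‖Complex.exp ((σ + t * I) * L) / (σ + t * I)‖ ≤ Real.exp (σ * L) / τ := by
  rw [norm_div, Complex.norm_exp]
  have h1 : ((σ + t * I : ℂ) * L).re = σ * L := by simp
  rw [h1]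
  have h2 : |t| ≤ ‖(σ + t * I : ℂ)‖ := by
    have := Complex.abs_im_le_norm (σ + t * I : ℂ)
    simpa using this
  gcongr
  exact ht.trans h2

lemma integral_exp_mul_right {L : ℝ} (hL : L ≠ 0) (a b : ℝ) :
    ∫ σ in a..b, Real.exp (σ * L) = (Real.exp (b * L) - Real.exp (a * L)) / L := by
  rw [intervalIntegral.integral_comp_mul_right (fun u => Real.exp u) hL, integral_exp, smul_eq_mul]
  field_simp

lemma norm_integral_horizontal_le {L : ℝ} (hL : L ≠ 0) {a b τ t : ℝ} (hab : a ≤ b) (hτ : 0 < τ)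
    (ht : τ ≤ |t|) :
    ‖∫ σ in a..b, Complex.exp ((σ + t * I) * L) / (σ + t * I)‖ ≤
      (Real.exp (b * L) - Real.exp (a * L)) / L / τ := by
  calc _ ≤ ∫ σ in a..b, Real.exp (σ * L) / τ := by
        refine intervalIntegral.norm_integral_le_of_norm_le hab ?_ ?_
        · exact Filter.Eventually.of_forall fun σ _ => norm_exp_div_le L σ t τ hτ ht
        · exact Continuous.intervalIntegrable (by fun_prop) _ _
    _ = _ := by rw [intervalIntegral.integral_div, integral_exp_mul_right hL]

lemma norm_one_div_two_pi_mul_le (z : ℂ) : ‖1 / (2 * Real.pi) * z‖ ≤ ‖z‖ / 2 := by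
  rw [norm_mul]
  have h : ‖(1 / (2 * Real.pi) : ℂ)‖ = 1 / (2 * Real.pi) := by
    simp [Real.pi_pos.le]
  rw [h, one_div_mul_eq_div]
  have := Real.pi_gt_three
  gcongr
  linarith

lemma integral_comp_neg_symm (f : ℝ → ℂ) (T : ℝ) :
    ∫ t in (-T)..T, f (-t) = ∫ t in (-T)..T, f t := by
  rw [intervalIntegral.integral_comp_neg, neg_neg]

lemma integral_inv_add_mul_I {b : ℝ} (hb : 0 < b) (T : ℝ) :
    ∫ t in (-T)..T, 1 / (b + t * I : ℂ) = 2 * Real.arctan (T / b) := by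
  have hi : ∀ β : ℝ, β ≠ 0 → IntervalIntegrable (fun t : ℝ => 1 / (b + β * t * I : ℂ)) MeasureTheory.volume (-T) T := by
    intro β _
    refine Continuous.intervalIntegrable ?_ _ _
    have : ∀ t : ℝ, (b + β * t * I : ℂ) ≠ 0 := fun t => by
      have := add_mul_I_ne_zero_of_re hb.ne' (β * t)
      push_cast at this
      exact this
    fun_prop (disch := first | assumption | exact this _)
  have h1 := hi 1 one_ne_zero
  have h2 := hi (-1) (by norm_num)
  push_cast at h1 h2
  simp only [one_mul, neg_mul] at h1 h2
  have hn : ∫ t in (-T)..T, 1 / (b + -(t : ℂ) * I : ℂ) = ∫ t in (-T)..T, 1 / (b + t * I : ℂ) := by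
    have := intervalIntegral.integral_comp_neg (a := -T) (b := T) (fun t : ℝ => 1 / (b + t * I : ℂ))
    push_cast at this
    rw [neg_neg] at this
    exact this
  have hs : (∫ t in (-T)..T, 1 / (b + t * I : ℂ)) + ∫ t in (-T)..T, 1 / (b + -(t : ℂ) * I : ℂ) =
      2 * (2 * Real.arctan (T / b) : ℝ) := by
    have hat : ∫ t in (-T)..T, b / (b ^ 2 + t ^ 2) = 2 * Real.arctan (T / b) := by
      rw [integral_div_sq_add_sq, neg_div, Real.arctan_neg]; ring
    rw [← intervalIntegral.integral_add h1 (by simpa using h2), ← hat,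
      ← intervalIntegral.integral_ofReal, ← intervalIntegral.integral_const_mul]
    refine intervalIntegral.integral_congr fun t _ => ?_
    have h1 := add_mul_I_ne_zero_of_re hb.ne' t
    have h2 := add_mul_I_ne_zero_of_re hb.ne' (-t)
    have h3 : (b ^ 2 + t ^ 2 : ℂ) ≠ 0 := by
      have : (b ^ 2 + t ^ 2 : ℝ) ≠ 0 := by positivity
      exact_mod_cast this
    push_cast at h2 ⊢
    rw [div_add_div _ _ h1 h2, mul_div_assoc', div_eq_div_iff (mul_ne_zero h1 h2) h3]
    linear_combination (2 * b * t ^ 2 : ℂ) * Complex.I_sq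
  rw [hn] at hs
  simp only [ofReal_mul, ofReal_ofNat] at hs
  linear_combination hs / 2

lemma integral_boundary_rect_inv {b T : ℝ} (hb : 0 < b) (hT : 0 < T) :
    ((∫ σ in (-b)..b, 1 / (σ + (-T : ℝ) * I : ℂ)) - ∫ σ in (-b)..b, 1 / (σ + T * I : ℂ))
      + I * (∫ t in (-T)..T, 1 / (b + t * I : ℂ)) - I * ∫ t in (-T)..T, 1 / ((-b : ℝ) + t * I : ℂ) =
      2 * Real.pi * I := by
  have r1 := integral_inv_add_mul_I hb T
  have r2 : ∫ t in (-T)..T, 1 / ((-b : ℝ) + t * I : ℂ) = - (2 * Real.arctan (T / b)) := by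
    rw [← r1, ← intervalIntegral.integral_neg, ← integral_comp_neg_symm]
    refine intervalIntegral.integral_congr fun t _ => ?_
    rw [← div_neg]
    push_cast
    congr 1; ring
  have t1 := integral_inv_add_mul_I hT b
  have r3 : ∫ σ in (-b)..b, 1 / (σ + (-T : ℝ) * I : ℂ) = I * (2 * Real.arctan (b / T)) := by
    rw [← t1, ← intervalIntegral.integral_const_mul]
    refine intervalIntegral.integral_congr fun t _ => ?_
    have h1 := add_mul_I_ne_zero_of_re hT.ne' t
    have h2 := add_mul_I_ne_zero_of_im (neg_ne_zero.2 hT.ne') t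
    rw [mul_one_div, div_eq_div_iff h2 h1]
    push_cast
    linear_combination (T : ℂ) * Complex.I_sq
  have r4 : ∫ σ in (-b)..b, 1 / (σ + T * I : ℂ) = - (I * (2 * Real.arctan (b / T))) := by
    rw [← t1, ← intervalIntegral.integral_const_mul, ← intervalIntegral.integral_neg,
      ← integral_comp_neg_symm]
    refine intervalIntegral.integral_congr fun t _ => ?_
    have h1 := add_mul_I_ne_zero_of_re hT.ne' t
    have h2 := add_mul_I_ne_zero_of_im hT.ne' (-t)
    rw [mul_one_div, ← neg_div, div_eq_div_iff h2 h1]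
    push_cast
    linear_combination (T : ℂ) * Complex.I_sq
  have hpi : Real.arctan (T / b) + Real.arctan (b / T) = Real.pi / 2 := by
    have := Real.arctan_inv_of_pos (x := b / T) (by positivity)
    rw [inv_div] at this
    linarith
  have hpi' : (Real.arctan (T / b) + Real.arctan (b / T) : ℂ) = Real.pi / 2 := by
    rw [← ofReal_add, hpi]
    simp
  rw [r1, r2, r3, r4]
  linear_combination (4 * I) * hpi'

lemma norm_perronKernel_le_of_neg {b T L : ℝ} (hb : 0 < b) (hT : 0 < T) (hL : L < 0) :
    ‖perronKernel b T L‖ ≤ Real.exp (b * L) / (T * |L|) := by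
  set f : ℂ → ℂ := fun s => Complex.exp (s * L) / s with hf
  have key : ∀ X : ℝ, b ≤ X → ‖∫ t in (-T)..T, f (b + t * I)‖ ≤
      2 * (Real.exp (b * L) / (T * |L|)) + 2 * T * (Real.exp (X * L) / X) := by
    intro X hX
    have hd : DifferentiableOn ℂ f (Set.uIcc b X ×ℂ Set.uIcc (-T) T) := by
      intro s hs
      refine DifferentiableAt.differentiableWithinAt ?_
      have hs0 : s ≠ 0 := by
        rintro rfl
        have := hs.1
        simp [Set.uIcc_of_le hX] at this
        linarith
      rw [hf]
      fun_prop (disch := assumption)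
    have hrect := Complex.integral_boundary_rect_eq_zero_of_differentiableOn f
      (b + (-T : ℝ) * I) (X + T * I) (by simpa using hd)
    simp only [add_re, ofReal_re, mul_re, I_re, mul_zero, ofReal_im, I_im, mul_one, sub_self,
      add_zero, add_im, mul_im, zero_add, smul_eq_mul] at hrect
    have e : I * ∫ t in (-T)..T, f (b + t * I) = (∫ σ in b..X, f (σ + (-T : ℝ) * I)) -
        (∫ σ in b..X, f (σ + T * I)) + I * ∫ t in (-T)..T, f (X + t * I) := by
      linear_combination -hrect
    have n1 := norm_integral_horizontal_le hL.ne hX hT (t := -T) (by rw [abs_neg]; exact le_abs_self _)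
    have n2 := norm_integral_horizontal_le hL.ne hX hT (t := T) (le_abs_self _)
    have n3 : ‖∫ t in (-T)..T, f (X + t * I)‖ ≤ Real.exp (X * L) / X * |T - -T| := by
      refine intervalIntegral.norm_integral_le_of_norm_le_const fun t _ => ?_
      rw [hf]
      simp only
      rw [norm_div, Complex.norm_exp]
      have h1 : ((X + t * I : ℂ) * L).re = X * L := by simp
      rw [h1]
      have hX0 : 0 < X := by linarith
      have h2 : X ≤ ‖(X + t * I : ℂ)‖ := by
        have := (le_abs_self _).trans (Complex.abs_re_le_norm (X + t * I : ℂ))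
        simpa using this
      gcongr
    rw [show T - -T = 2 * T by ring, abs_of_pos (by linarith : 0 < 2 * T)] at n3
    have n4 : (Real.exp (X * L) - Real.exp (b * L)) / L / T ≤ Real.exp (b * L) / (T * |L|) := by
      have : (Real.exp (X * L) - Real.exp (b * L)) / L / T =
          (Real.exp (b * L) - Real.exp (X * L)) / (T * |L|) := by
        rw [abs_of_neg hL]
        have := hL.ne
        field_simp
        ring
      rw [this]
      have := abs_pos.2 hL.ne
      have := Real.exp_pos (X * L)
      gcongr
      linarith
    have n0 : ‖∫ t in (-T)..T, f (b + t * I)‖ = ‖I * ∫ t in (-T)..T, f (b + t * I)‖ := by simp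
    rw [n0, e]
    refine (norm_add_le _ _).trans ?_
    rw [norm_mul, Complex.norm_I, one_mul]
    have := norm_sub_le (∫ σ in b..X, f (σ + (-T : ℝ) * I)) (∫ σ in b..X, f (σ + T * I))
    linarith
  have hlim : Tendsto (fun X : ℝ => 2 * (Real.exp (b * L) / (T * |L|)) +
      2 * T * (Real.exp (X * L) / X)) atTop
      (nhds (2 * (Real.exp (b * L) / (T * |L|)) + 2 * T * 0)) := by
    refine Tendsto.const_add _ (Tendsto.const_mul _ ?_)
    refine Tendsto.div_atTop (a := 0) ?_ tendsto_id
    refine Real.tendsto_exp_atBot.comp ?_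
    exact tendsto_id.atTop_mul_const_of_neg hL
  have hle := ge_of_tendsto hlim (eventually_atTop.2 ⟨b, key⟩)
  rw [mul_zero, add_zero] at hle
  exact (norm_one_div_two_pi_mul_le _).trans (by linarith)

/-- Difference of the kernels on the lines `re = b` and `re = -b`, crossing the pole at `0`. -/
lemma norm_perronKernel_sub_one_le_of_pos {b T L : ℝ} (hb : 0 < b) (hT : 0 < T) (hL : 0 < L) :
    ‖perronKernel b T L - 1‖ ≤ 2 * (Real.exp (b * L) / (T * L)) := by
  have hb0 := hb.ne'
  have hb0' : -b ≠ 0 := neg_ne_zero.2 hb0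
  have hT0 := hT.ne'
  have hT0' : -T ≠ 0 := neg_ne_zero.2 hT0
  set f : ℂ → ℂ := fun s => Complex.exp (s * L) / s with hf
  set h : ℂ → ℂ := dslope (fun s => Complex.exp (s * L)) 0 with hh
  have hhd : Differentiable ℂ h := by
    intro s
    have : DifferentiableOn ℂ h Set.univ :=
      (Complex.differentiableOn_dslope Filter.univ_mem).2 (by fun_prop)
    exact (this s (Set.mem_univ s)).differentiableAt Filter.univ_mem
  have hhe : ∀ s : ℂ, s ≠ 0 → h s = f s - 1 / s := by
    intro s hs
    rw [hh, dslope_of_ne _ hs, slope_def_field]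
    simp [hf, sub_div]
  have hrect := Complex.integral_boundary_rect_eq_zero_of_differentiableOn h
      (((-b : ℝ) : ℂ) + (-T : ℝ) * I) (b + T * I) hhd.differentiableOn
  simp only [add_re, ofReal_re, mul_re, I_re, mul_zero, ofReal_im, I_im, mul_one, sub_self,
      add_zero, add_im, mul_im, zero_add, smul_eq_mul] at hrect
  have hcv : ∀ β : ℝ, β ≠ 0 → IntervalIntegrable (fun t : ℝ => f (β + t * I)) MeasureTheory.volume (-T) T := by
    intro β hβ
    refine Continuous.intervalIntegrable ?_ _ _
    have := add_mul_I_ne_zero_of_re hβ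
    rw [hf]
    fun_prop (disch := assumption)
  have hcv1 : ∀ β : ℝ, β ≠ 0 → IntervalIntegrable (fun t : ℝ => 1 / (β + t * I : ℂ)) MeasureTheory.volume (-T) T := by
    intro β hβ
    refine Continuous.intervalIntegrable ?_ _ _
    have := add_mul_I_ne_zero_of_re hβ
    fun_prop (disch := assumption)
  have hch : ∀ τ : ℝ, τ ≠ 0 → IntervalIntegrable (fun σ : ℝ => f (σ + τ * I)) MeasureTheory.volume (-b) b := by
    intro β hβ
    refine Continuous.intervalIntegrable ?_ _ _
    have := add_mul_I_ne_zero_of_im hβ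
    rw [hf]
    fun_prop (disch := assumption)
  have hch1 : ∀ τ : ℝ, τ ≠ 0 → IntervalIntegrable (fun σ : ℝ => 1 / (σ + τ * I : ℂ)) MeasureTheory.volume (-b) b := by
    intro β hβ
    refine Continuous.intervalIntegrable ?_ _ _
    have := add_mul_I_ne_zero_of_im hβ
    fun_prop (disch := assumption)
  have sv : ∀ β : ℝ, β ≠ 0 → ∫ t in (-T)..T, h (β + t * I) =
      (∫ t in (-T)..T, f (β + t * I)) - ∫ t in (-T)..T, 1 / (β + t * I : ℂ) := by
    intro β hβ
    rw [← intervalIntegral.integral_sub (hcv β hβ) (hcv1 β hβ)]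
    exact intervalIntegral.integral_congr fun t _ => hhe _ (add_mul_I_ne_zero_of_re hβ t)
  have sh : ∀ τ : ℝ, τ ≠ 0 → ∫ σ in (-b)..b, h (σ + τ * I) =
      (∫ σ in (-b)..b, f (σ + τ * I)) - ∫ σ in (-b)..b, 1 / (σ + τ * I : ℂ) := by
    intro β hβ
    rw [← intervalIntegral.integral_sub (hch β hβ) (hch1 β hβ)]
    exact intervalIntegral.integral_congr fun t _ => hhe _ (add_mul_I_ne_zero_of_im hβ t)
  rw [sv b hb0, sv (-b) hb0', sh T hT0, sh (-T) hT0'] at hrect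
  have hwind : ((∫ σ in (-b)..b, 1 / (σ + (-T : ℝ) * I : ℂ)) - ∫ σ in (-b)..b, 1 / (σ + T * I : ℂ))
      + I * (∫ t in (-T)..T, 1 / (b + t * I : ℂ)) - I * ∫ t in (-T)..T, 1 / ((-b : ℝ) + t * I : ℂ) =
      2 * Real.pi * I := integral_boundary_rect_inv hb hT
  have hneg : ∫ t in (-T)..T, f ((-b : ℝ) + t * I) = - (2 * Real.pi * perronKernel b T (-L)) := by
    rw [perronKernel, ← mul_assoc, mul_one_div_cancel (by simp [Real.pi_ne_zero]), one_mul,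
      ← intervalIntegral.integral_neg, ← integral_comp_neg_symm]
    refine intervalIntegral.integral_congr fun t _ => ?_
    simp only [hf]
    rw [← div_neg]
    push_cast
    congr 1
    · congr 1; ring
    · ring
  have hpos : ∫ t in (-T)..T, f (b + t * I) = 2 * Real.pi * perronKernel b T L := by
    rw [perronKernel, ← mul_assoc, mul_one_div_cancel (by simp [Real.pi_ne_zero]), one_mul]
  rw [hneg, hpos] at hrect
  have e : 2 * Real.pi * I * (perronKernel b T L - 1) =
      (∫ σ in (-b)..b, f (σ + T * I)) - (∫ σ in (-b)..b, f (σ + (-T : ℝ) * I)) -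
        2 * Real.pi * I * perronKernel b T (-L) := by
    linear_combination hrect + hwind
  have n1 := norm_integral_horizontal_le hL.ne' (neg_le_self hb.le) hT (t := -T)
    (by rw [abs_neg]; exact le_abs_self _)
  have n2 := norm_integral_horizontal_le hL.ne' (neg_le_self hb.le) hT (t := T) (le_abs_self _)
  have n3 := norm_perronKernel_le_of_neg hb hT (neg_lt_zero.2 hL)
  rw [abs_neg, abs_of_pos hL] at n3
  have n4 : (Real.exp (b * L) - Real.exp (-b * L)) / L / T ≤ Real.exp (b * L) / (T * L) := by
    rw [div_div, mul_comm L T]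
    gcongr
    linarith [Real.exp_pos (-b * L)]
  have n5 : Real.exp (b * -L) / (T * L) ≤ Real.exp (b * L) / (T * L) := by
    gcongr
    linarith
  have n6 : 2 * Real.pi * ‖perronKernel b T L - 1‖ ≤
      2 * (Real.exp (b * L) / (T * L)) + 2 * Real.pi * (Real.exp (b * L) / (T * L)) := by
    have e1 := congrArg norm e
    have npi : ‖(2 * Real.pi * I : ℂ)‖ = 2 * Real.pi := by
      simp [Real.pi_pos.le]
    rw [norm_mul, npi] at e1
    rw [e1]
    refine (norm_sub_le _ _).trans ?_
    rw [norm_mul, npi]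
    have := norm_sub_le (∫ σ in (-b)..b, f (σ + T * I)) (∫ σ in (-b)..b, f (σ + (-T : ℝ) * I))
    have := mul_le_mul_of_nonneg_left (n3.trans n5) Real.two_pi_pos.le
    linarith
  have hQ : 0 ≤ Real.exp (b * L) / (T * L) := by positivity
  have := Real.pi_gt_three
  nlinarith

lemma tsum_nat_rpow_neg_le {b : ℝ} (hb : 1 < b) :
    ∑' n : ℕ, (n : ℝ) ^ (-b) ≤ 1 + 1 / (b - 1) := by
  refine Real.tsum_le_of_sum_range_le (fun n => by positivity) fun n => ?_
  have h1 : ∑ i ∈ Finset.range n, (1 + ((i + 1 : ℕ) : ℝ)) ^ (-b) ≤ 1 / (b - 1) := by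
    have hanti : AntitoneOn (fun t : ℝ => t ^ (-b)) (Set.Icc 1 (1 + (n : ℝ))) := by
      intro u hu v hv huv
      exact Real.rpow_le_rpow_of_nonpos (by linarith [hu.1]) huv (by linarith)
    refine hanti.sum_le_integral.trans ?_
    rw [integral_rpow (Or.inr ⟨by linarith, by
      rw [Set.uIcc_of_le (by have : (0 : ℝ) ≤ n := n.cast_nonneg
                             linarith)]
      intro h; linarith [h.1]⟩)]
    rw [Real.one_rpow, show -b + 1 = -(b - 1) by ring, div_neg, ← neg_div]
    have : 0 ≤ (1 + (n : ℝ)) ^ (-(b - 1)) := by positivity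
    have h2 : 0 < b - 1 := by linarith
    gcongr
    linarith
  calc ∑ i ∈ Finset.range n, (i : ℝ) ^ (-b) ≤ ∑ i ∈ Finset.range (n + 2), (i : ℝ) ^ (-b) := by
        refine Finset.sum_le_sum_of_subset_of_nonneg (by simp) fun i _ _ => by positivity
    _ = (∑ i ∈ Finset.range n, (1 + ((i + 1 : ℕ) : ℝ)) ^ (-b)) + 1 := by
        rw [Finset.sum_range_succ', Finset.sum_range_succ']
        simp only [Nat.cast_zero, zero_add, Nat.cast_one, Real.one_rpow]
        rw [Real.zero_rpow (by linarith), add_zero]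
        congr 1
        refine Finset.sum_congr rfl fun i _ => ?_
        push_cast; ring_nf
    _ ≤ _ := by linarith

lemma norm_perronKernel_le_of_small {b T L : ℝ} (hb : 0 < b) (hT : 0 < T) (hL : T * |L| ≤ 1) :
    ‖perronKernel b T L‖ ≤ 3 * Real.exp (b * L) := by
  have hne := add_mul_I_ne_zero_of_re hb.ne'
  have hi1 : IntervalIntegrable (fun t : ℝ => 1 / (b + t * I : ℂ)) MeasureTheory.volume (-T) T := by
    refine Continuous.intervalIntegrable ?_ _ _
    fun_prop (disch := assumption)
  have hi2 : IntervalIntegrable (fun t : ℝ => (Complex.exp (I * (t * L : ℝ)) - 1) / (b + t * I : ℂ))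
      MeasureTheory.volume (-T) T := by
    refine Continuous.intervalIntegrable ?_ _ _
    fun_prop (disch := assumption)
  have e : ∫ t in (-T)..T, Complex.exp ((b + t * I) * L) / (b + t * I) =
      Complex.exp (b * L) * ((∫ t in (-T)..T, (Complex.exp (I * (t * L : ℝ)) - 1) / (b + t * I : ℂ)) +
        2 * Real.arctan (T / b)) := by
    rw [← integral_inv_add_mul_I hb, ← intervalIntegral.integral_add hi2 hi1,
      ← intervalIntegral.integral_const_mul]
    refine intervalIntegral.integral_congr fun t _ => ?_
    rw [← add_div, sub_add_cancel, mul_div_assoc', ← Complex.exp_add]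
    push_cast
    congr 2; ring
  have h1 : ‖∫ t in (-T)..T, (Complex.exp (I * (t * L : ℝ)) - 1) / (b + t * I : ℂ)‖ ≤
      |L| * |T - -T| := by
    refine intervalIntegral.norm_integral_le_of_norm_le_const fun t _ => ?_
    rw [norm_div, div_le_iff₀ (norm_pos_iff.2 (hne t))]
    refine (Real.norm_exp_I_mul_ofReal_sub_one_le).trans ?_
    rw [Real.norm_eq_abs, abs_mul, mul_comm]
    have := Complex.abs_im_le_norm (b + t * I : ℂ)
    simp at this
    gcongr
  rw [show T - -T = 2 * T by ring, abs_of_pos (by linarith : 0 < 2 * T)] at h1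
  have h2 : ‖(2 * Real.arctan (T / b) : ℂ)‖ ≤ 4 := by
    rw [norm_mul, Complex.norm_real, Real.norm_eq_abs, Complex.norm_ofNat]
    have h3 : |Real.arctan (T / b)| ≤ 2 := by
      have := Real.arctan_lt_pi_div_two (T / b)
      have := Real.neg_pi_div_two_lt_arctan (T / b)
      have := Real.pi_lt_four
      exact abs_le.2 ⟨by linarith, by linarith⟩
    linarith
  refine (norm_one_div_two_pi_mul_le _).trans ?_
  rw [e, norm_mul, Complex.norm_exp]
  have : (b * L : ℂ).re = b * L := by simp
  rw [this]
  have := norm_add_le (∫ t in (-T)..T, (Complex.exp (I * (t * L : ℝ)) - 1) / (b + t * I : ℂ))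
    (2 * Real.arctan (T / b) : ℂ)
  have hE := Real.exp_pos (b * L)
  nlinarith

/-- The deviation of the Perron kernel from the step function. -/
lemma norm_perronKernel_sub_step_le {b T L : ℝ} (hb : 0 < b) (hT : 0 < T) (hL : L ≠ 0) :
    ‖(if 0 ≤ L then (1 : ℂ) else 0) - perronKernel b T L‖ ≤ 2 * (Real.exp (b * L) / (T * |L|)) := by
  rcases lt_or_gt_of_ne hL with h | h
  · rw [if_neg (not_le.2 h), zero_sub, norm_neg]
    have := norm_perronKernel_le_of_neg hb hT h
    have : 0 ≤ Real.exp (b * L) / (T * |L|) := by positivity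
    linarith
  · rw [if_pos h.le, norm_sub_rev, abs_of_pos h]
    exact norm_perronKernel_sub_one_le_of_pos hb hT h

lemma norm_perronKernel_sub_step_le_const {b T L : ℝ} (hb : 0 < b) (hT : 0 < T) :
    ‖(if 0 ≤ L then (1 : ℂ) else 0) - perronKernel b T L‖ ≤ 1 + 3 * Real.exp (b * L) := by
  have hE := Real.exp_pos (b * L)
  by_cases h : T * |L| ≤ 1
  · refine (norm_sub_le _ _).trans (add_le_add ?_ (norm_perronKernel_le_of_small hb hT h))
    split_ifs <;> simp
  · push Not at h
    have hL : L ≠ 0 := by rintro rfl; simp at h; linarith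
    refine (norm_perronKernel_sub_step_le hb hT hL).trans ?_
    have : Real.exp (b * L) / (T * |L|) ≤ Real.exp (b * L) := div_le_self hE.le h.le
    linarith

lemma hasSum_perron {a : ℕ → ℂ} (ha : ∀ n, ‖a n‖ ≤ 1) {b x : ℝ} (hb : 1 < b) (hx : 0 < x)
    (T : ℝ) :
    HasSum (fun n : ℕ => if n = 0 then 0 else a n * perronKernel b T (Real.log (x / n)))
      (1 / (2 * Real.pi) * ∫ t in (-T)..T,
        LSeries a (b + t * I) * (x : ℂ) ^ (b + t * I : ℂ) / (b + t * I)) := by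
  have hb0 : 0 < b := by linarith
  have hne := add_mul_I_ne_zero_of_re hb0.ne'
  have hf : ∀ n : ℕ, n ≠ 0 → ∀ t : ℝ, LSeries.term a (b + t * I) n * (x : ℂ) ^ (b + t * I : ℂ) / (b + t * I) =
      a n * (Complex.exp ((b + t * I) * Real.log (x / n)) / (b + t * I)) := by
    intro n hn t
    have hn' : (0 : ℝ) < n := by positivity
    rw [LSeries.term_of_ne_zero hn, Complex.cpow_def_of_ne_zero (by exact_mod_cast hn),
      Complex.cpow_def_of_ne_zero (by exact_mod_cast hx.ne'), Real.log_div hx.ne' hn'.ne',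
      ← Complex.ofReal_log hx.le, ← Complex.natCast_log, div_mul_eq_mul_div, mul_div_assoc (a n), ← Complex.exp_sub,
      ← mul_div_assoc]
    congr 3
    push_cast
    ring
  have key : HasSum (fun n : ℕ => ∫ t in (-T)..T, LSeries.term a (b + t * I) n * (x : ℂ) ^ (b + t * I : ℂ) / (b + t * I))
      (∫ t in (-T)..T, LSeries a (b + t * I) * (x : ℂ) ^ (b + t * I : ℂ) / (b + t * I)) := by
    have hsumm : Summable fun n : ℕ => (n : ℝ) ^ (-b) * (x ^ b / b) :=
      (Real.summable_nat_rpow.2 (by linarith)).mul_right _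
    refine intervalIntegral.hasSum_integral_of_dominated_convergence
      (fun n _ => (n : ℝ) ^ (-b) * (x ^ b / b)) ?_ ?_ ?_ ?_ ?_
    · intro n
      refine Continuous.aestronglyMeasurable ?_
      rcases eq_or_ne n 0 with rfl | hn
      · simp only [LSeries.term_zero, zero_mul, zero_div]; exact continuous_const
      · simp only [hf n hn]
        fun_prop (disch := assumption)
    · intro n
      refine Filter.Eventually.of_forall fun t _ => ?_
      rcases eq_or_ne n 0 with rfl | hn
      · simp only [LSeries.term_zero, zero_mul, zero_div, norm_zero]; positivity
      · have hn' : (0 : ℝ) < n := by positivity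
        rw [mul_div_assoc, norm_mul, norm_div, Complex.norm_cpow_eq_rpow_re_of_pos hx,
          LSeries.term_of_ne_zero hn, norm_div, Complex.norm_natCast_cpow_of_pos (by omega)]
        have h1 : (b + t * I : ℂ).re = b := by simp
        have h2 : b ≤ ‖(b + t * I : ℂ)‖ := by
          have := (le_abs_self _).trans (Complex.abs_re_le_norm (b + t * I : ℂ))
          rwa [h1] at this
        rw [h1, Real.rpow_neg hn'.le, ← one_div]
        gcongr
        exact ha n
    · exact Filter.Eventually.of_forall fun t _ => hsumm
    · exact intervalIntegrable_const
    · refine Filter.Eventually.of_forall fun t _ => ?_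
      have hs : LSeriesSummable a (b + t * I) :=
        LSeriesSummable_of_bounded_of_one_lt_re (m := 1) (fun n _ => ha n) (by simpa using hb)
      exact (hs.hasSum.mul_right _).div_const _
  refine (key.mul_left (1 / (2 * Real.pi) : ℂ)).congr_fun fun n => ?_
  rcases eq_or_ne n 0 with rfl | hn
  · simp
  · rw [if_neg hn, perronKernel]
    simp only [hf n hn]
    rw [intervalIntegral.integral_const_mul]
    ring

lemma sum_inv_dist_le (N : ℕ) :
    ∑ n ∈ Finset.range (2 * N + 2), (((N - n : ℕ) : ℝ)⁻¹ + ((n - (N + 1) : ℕ) : ℝ)⁻¹) ≤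
      2 * (1 + Real.log N) := by
  have hH : ∑ m ∈ Finset.range (N + 1), ((m : ℕ) : ℝ)⁻¹ ≤ 1 + Real.log N := by
    have h := harmonic_le_one_add_log N
    rw [harmonic] at h
    push_cast at h
    rw [Finset.sum_range_succ']
    push_cast
    simpa using h
  have h1 : ∑ n ∈ Finset.range (N + 1), (((N - n : ℕ) : ℝ)⁻¹ + ((n - (N + 1) : ℕ) : ℝ)⁻¹) =
      ∑ m ∈ Finset.range (N + 1), ((m : ℕ) : ℝ)⁻¹ := by
    rw [← Finset.sum_range_reflect]
    refine Finset.sum_congr rfl fun n hn => ?_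
    have hn' := Finset.mem_range.1 hn
    have e1 : N - (N + 1 - 1 - n) = n := by omega
    have e2 : N + 1 - 1 - n - (N + 1) = 0 := by omega
    rw [e1, e2]; simp
  have h2 : ∑ n ∈ Finset.range (N + 1),
      (((N - (N + 1 + n) : ℕ) : ℝ)⁻¹ + ((N + 1 + n - (N + 1) : ℕ) : ℝ)⁻¹) =
      ∑ m ∈ Finset.range (N + 1), ((m : ℕ) : ℝ)⁻¹ := by
    refine Finset.sum_congr rfl fun n hn => ?_
    have e1 : N - (N + 1 + n) = 0 := by omega
    have e2 : N + 1 + n - (N + 1) = n := by omega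
    rw [e1, e2]; simp
  rw [show 2 * N + 2 = (N + 1) + (N + 1) by ring, Finset.sum_range_add, h1, h2]
  linarith

lemma exp_mul_log_div_le {x : ℝ} (hx : 2 ≤ x) {n : ℕ} (hn : 0 < n) (hnN : n ≠ ⌊x⌋₊)
    (hnN1 : n ≠ ⌊x⌋₊ + 1) :
    Real.exp ((1 + 1 / Real.log x) * Real.log (x / n)) / |Real.log (x / n)| ≤
      Real.exp 1 * x * (2 * (n : ℝ) ^ (-(1 + 1 / Real.log x)) + if n < 2 * ⌊x⌋₊ + 2 then
        (((⌊x⌋₊ - n : ℕ) : ℝ)⁻¹ + ((n - (⌊x⌋₊ + 1) : ℕ) : ℝ)⁻¹) else 0) := by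
  set N := ⌊x⌋₊ with hN
  set b := 1 + 1 / Real.log x with hb
  have hx0 : 0 < x := by linarith
  have hlx : 0 < Real.log x := Real.log_pos (by linarith)
  have hn0 : (0 : ℝ) < n := by exact_mod_cast hn
  have hn1 : (1 : ℝ) ≤ n := by exact_mod_cast hn
  have hNx : (N : ℝ) ≤ x := Nat.floor_le hx0.le
  have hxN : x < N + 1 := Nat.lt_floor_add_one x
  have hE : Real.exp (b * Real.log (x / n)) = Real.exp 1 * x * (n : ℝ) ^ (-b) := by
    rw [Real.log_div hx0.ne' hn0.ne', mul_sub, Real.exp_sub, Real.rpow_neg hn0.le,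
      Real.rpow_def_of_pos hn0, mul_comm (Real.log n) b, hb, add_mul, one_mul, one_div_mul_cancel hlx.ne',
      Real.exp_add, Real.exp_log hx0]
    field_simp
  set Q := (n : ℝ) ^ (-b) with hQ
  have hQ0 : 0 < Q := Real.rpow_pos_of_pos hn0 _
  have hQn : Q * n ≤ 1 := by
    have : Q ≤ (n : ℝ) ^ (-1 : ℝ) := by
      refine Real.rpow_le_rpow_of_exponent_le hn1 ?_
      have : 0 ≤ 1 / Real.log x := by positivity
      linarith
    rw [Real.rpow_neg_one] at this
    calc Q * n ≤ (n : ℝ)⁻¹ * n := by gcongr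
      _ = 1 := inv_mul_cancel₀ hn0.ne'
  have hEx : 0 < Real.exp 1 * x := by positivity
  rw [hE, mul_div_assoc]
  refine mul_le_mul_of_nonneg_left ?_ hEx.le
  rcases Nat.lt_or_ge n N with h | h
  · have hc : n < 2 * N + 2 := by omega
    rw [if_pos hc, show n - (N + 1) = 0 by omega, Nat.cast_sub h.le]
    simp only [Nat.cast_zero, inv_zero, add_zero]
    have hnN' : (n : ℝ) < N := by exact_mod_cast h
    have hl := Real.one_sub_inv_le_log_of_pos (div_pos hx0 hn0)
    rw [inv_div] at hl
    have e : 1 - n / x = (x - n) / x := by field_simp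
    rw [e] at hl
    have hxn : 0 < x - n := by linarith
    have hl0 : 0 < (x - n) / x := by positivity
    rw [abs_of_pos (hl0.trans_le hl)]
    calc Q / Real.log (x / n) ≤ Q / ((x - n) / x) := by gcongr
      _ = Q + Q * n / (x - n) := by field_simp; ring
      _ ≤ 2 * Q + 1 / (N - n) := by
          have : Q * n / (x - n) ≤ 1 / (N - n) := by
            gcongr
          linarith
      _ = _ := by rw [one_div]
  · have hnN2 : N + 2 ≤ n := by omega
    have hnN2' : (N : ℝ) + 2 ≤ n := by exact_mod_cast hnN2
    have hl := Real.one_sub_inv_le_log_of_pos (div_pos hn0 hx0)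
    rw [inv_div] at hl
    have e : 1 - x / n = (n - x) / n := by field_simp
    rw [e] at hl
    have hxn : 0 < n - x := by linarith
    have hl0 : 0 < (n - x) / n := by positivity
    have habs : |Real.log (x / n)| = Real.log (n / x) := by
      rw [← inv_div, Real.log_inv, abs_neg, abs_of_pos (hl0.trans_le hl)]
    rw [habs]
    have h1 : Q / Real.log (n / x) ≤ Q + Q * x / (n - x) := by
      calc Q / Real.log (n / x) ≤ Q / ((n - x) / n) := by gcongr
        _ = Q + Q * x / (n - x) := by field_simp; ring
    refine h1.trans ?_
    split_ifs with hc
    · rw [show N - n = 0 by omega, Nat.cast_sub (by omega)]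
      push_cast
      rw [inv_zero, zero_add, ← one_div]
      have : Q * x / (n - x) ≤ 1 / (n - (N + 1)) := by
        have : Q * x ≤ 1 := le_trans (by gcongr; linarith) hQn
        have : (0 : ℝ) < n - (N + 1) := by linarith
        gcongr
      linarith
    · have : (2 * N + 2 : ℝ) ≤ n := by exact_mod_cast Nat.not_lt.1 hc
      have : Q * x / (n - x) ≤ Q := by
        rw [div_le_iff₀ hxn]
        gcongr
        linarith
      linarith

theorem norm_sum_sub_perron_le {a : ℕ → ℂ} (ha : ∀ n, ‖a n‖ ≤ 1) {x T : ℝ} (hx : 2 ≤ x)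
    (hT : 0 < T) :
    ‖(∑ n ∈ Finset.Icc 1 ⌊x⌋₊, a n) - 1 / (2 * Real.pi) * ∫ t in (-T)..T,
      LSeries a ((1 + 1 / Real.log x : ℝ) + t * I) * (x : ℂ) ^ ((1 + 1 / Real.log x : ℝ) + t * I : ℂ) /
        ((1 + 1 / Real.log x : ℝ) + t * I)‖ ≤ 72 * (1 + x * Real.log x / T) := by
  have hx0 : 0 < x := by linarith
  have hlx : 0 < Real.log x := Real.log_pos (by linarith)
  have hlx2 : 0.69 ≤ Real.log x := by
    have := Real.log_le_log (by norm_num) hx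
    have := Real.log_two_gt_d9
    linarith
  set N := ⌊x⌋₊ with hN
  set b := 1 + 1 / Real.log x with hb
  have hb1 : 1 < b := by
    have : 0 < 1 / Real.log x := by positivity
    linarith
  have hNx : (N : ℝ) ≤ x := Nat.floor_le hx0.le
  have hxN : x < N + 1 := Nat.lt_floor_add_one x
  have hN2 : 2 ≤ N := Nat.le_floor (by exact_mod_cast hx)
  have hN2' : (2 : ℝ) ≤ N := by exact_mod_cast hN2
  have hP := hasSum_perron ha hb1 hx0 T
  have hS : HasSum (fun n : ℕ => if n = 0 then 0 else a n * (if 0 ≤ Real.log (x / n) then (1 : ℂ) else 0))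
      (∑ n ∈ Finset.Icc 1 N, a n) := by
    have hz : ∀ n ∉ Finset.Icc 1 N,
        (if n = 0 then 0 else a n * (if 0 ≤ Real.log (x / n) then (1 : ℂ) else 0)) = 0 := by
      intro n hn
      rcases eq_or_ne n 0 with rfl | h0
      · simp
      · rw [if_neg h0, if_neg, mul_zero]
        have hnN : N + 1 ≤ n := by
          rw [Finset.mem_Icc] at hn; omega
        have : (N + 1 : ℝ) ≤ n := by exact_mod_cast hnN
        push Not
        exact Real.log_neg (by positivity) ((div_lt_one (by linarith)).2 (by linarith))
    have he : ∑ n ∈ Finset.Icc 1 N, a n = ∑ n ∈ Finset.Icc 1 N,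
        (if n = 0 then 0 else a n * (if 0 ≤ Real.log (x / n) then (1 : ℂ) else 0)) := by
      refine Finset.sum_congr rfl fun n hn => ?_
      rw [Finset.mem_Icc] at hn
      have h1 : (0 : ℝ) < n := by exact_mod_cast hn.1
      have h2 : (n : ℝ) ≤ N := by exact_mod_cast hn.2
      rw [if_neg (by omega), if_pos, mul_one]
      exact Real.log_nonneg ((one_le_div h1).2 (by linarith))
    rw [he]
    exact hasSum_sum_of_ne_finset_zero hz
  set d : ℕ → ℝ := fun n => ((N - n : ℕ) : ℝ)⁻¹ + ((n - (N + 1) : ℕ) : ℝ)⁻¹ with hd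
  have hd0 : ∀ n, 0 ≤ d n := fun n => by positivity
  set κ := 2 * (Real.exp 1 * x) / T with hκ
  have hκ0 : 0 ≤ κ := by positivity
  have hsumm : Summable fun n : ℕ => (n : ℝ) ^ (-b) := Real.summable_nat_rpow.2 (by linarith)
  have hg1 : HasSum (fun n : ℕ => κ * (2 * (n : ℝ) ^ (-b))) (κ * (2 * ∑' n : ℕ, (n : ℝ) ^ (-b))) :=
    (hsumm.hasSum.mul_left 2).mul_left κ
  have hg2 : HasSum (fun n : ℕ => κ * if n < 2 * N + 2 then d n else 0)
      (κ * ∑ n ∈ Finset.range (2 * N + 2), d n) := by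
    refine HasSum.mul_left κ ?_
    have : HasSum (fun n : ℕ => if n < 2 * N + 2 then d n else 0)
        (∑ n ∈ Finset.range (2 * N + 2), if n < 2 * N + 2 then d n else 0) :=
      hasSum_sum_of_ne_finset_zero fun n hn => if_neg (by simpa using hn)
    have he : ∑ n ∈ Finset.range (2 * N + 2), d n =
        ∑ n ∈ Finset.range (2 * N + 2), if n < 2 * N + 2 then d n else 0 :=
      Finset.sum_congr rfl fun n hn => (if_pos (Finset.mem_range.1 hn)).symm
    rw [he]
    exact this
  have hg3 : HasSum (fun n : ℕ => (if n = N then (28 : ℝ) else 0) + if n = N + 1 then (28 : ℝ) else 0) (28 + 28) :=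
    (hasSum_ite_eq N (28 : ℝ)).add (hasSum_ite_eq (N + 1) (28 : ℝ))
  have hbound := tsum_of_norm_bounded ((hg1.add hg2).add hg3)
    (f := fun n : ℕ => (if n = 0 then 0 else a n * (if 0 ≤ Real.log (x / n) then (1 : ℂ) else 0)) -
      (if n = 0 then 0 else a n * perronKernel b T (Real.log (x / n)))) ?_
  · rw [(hS.sub hP).tsum_eq] at hbound
    refine hbound.trans ?_
    have s1 : ∑' n : ℕ, (n : ℝ) ^ (-b) ≤ 1 + Real.log x := by
      have := tsum_nat_rpow_neg_le hb1
      rwa [hb, add_sub_cancel_left, one_div_one_div] at this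
    have s2 : ∑ n ∈ Finset.range (2 * N + 2), d n ≤ 2 * (1 + Real.log x) := by
      refine (sum_inv_dist_le N).trans ?_
      have := Real.log_le_log (by linarith) hNx
      linarith
    have s3 : κ * (2 * ∑' n : ℕ, (n : ℝ) ^ (-b)) + κ * ∑ n ∈ Finset.range (2 * N + 2), d n ≤
        κ * (10 * Real.log x) := by
      rw [← mul_add]
      refine mul_le_mul_of_nonneg_left ?_ hκ0
      linarith
    have s4 : κ * (10 * Real.log x) ≤ 72 * (x * Real.log x / T) := by
      have := Real.exp_one_lt_d9
      have h0 : 0 ≤ x * Real.log x / T := by positivity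
      calc κ * (10 * Real.log x) = (20 * Real.exp 1) * (x * Real.log x / T) := by rw [hκ]; ring
        _ ≤ _ := by gcongr; linarith
    linarith
  · intro n
    have hq : 0 ≤ (n : ℝ) ^ (-b) := by positivity
    rcases eq_or_ne n 0 with rfl | h0
    · simp only [if_true, sub_self, norm_zero]
      have : 0 ≤ (if 0 < 2 * N + 2 then d 0 else 0) := by split_ifs; exacts [hd0 0, le_rfl]
      split_ifs <;> positivity
    · simp only [if_neg h0]
      rw [← mul_sub, norm_mul]
      have hn : 0 < n := Nat.pos_of_ne_zero h0
      have hn0 : (0 : ℝ) < n := by exact_mod_cast hn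
      have hd0' : 0 ≤ (if n < 2 * N + 2 then d n else 0) := by split_ifs; exacts [hd0 n, le_rfl]
      refine (mul_le_mul_of_nonneg_right (ha n) (norm_nonneg _)).trans ?_
      rw [one_mul]
      by_cases hnear : n = N ∨ n = N + 1
      · have h28 : (28 : ℝ) ≤ (if n = N then (28 : ℝ) else 0) + if n = N + 1 then (28 : ℝ) else 0 := by
          rcases hnear with h | h
          · rw [if_pos h]; split_ifs <;> norm_num
          · rw [if_pos h]; split_ifs <;> norm_num
        have hE : Real.exp (b * Real.log (x / n)) ≤ 9 := by
          have hxn : x / n ≤ 2 := by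
            rw [div_le_iff₀ hn0]
            have : (N : ℝ) ≤ n := by exact_mod_cast (by omega : N ≤ n)
            linarith
          have hl : Real.log (x / n) ≤ Real.log 2 := Real.log_le_log (by positivity) hxn
          have h2 : b * Real.log (x / n) ≤ 2 := by
            calc b * Real.log (x / n) ≤ b * Real.log 2 := by gcongr
              _ = Real.log 2 + Real.log 2 / Real.log x := by rw [hb]; ring
              _ ≤ 1 + 1 := by
                  have := Real.log_two_lt_d9
                  have : Real.log 2 / Real.log x ≤ 1 :=
                    (div_le_one hlx).2 (Real.log_le_log (by norm_num) hx)
                  linarith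
              _ = 2 := by norm_num
          calc Real.exp (b * Real.log (x / n)) ≤ Real.exp 2 := Real.exp_le_exp.2 h2
            _ = Real.exp 1 ^ 2 := by rw [← Real.exp_nat_mul]; norm_num
            _ ≤ 9 := by
              have := Real.exp_one_lt_d9
              have := Real.exp_pos 1
              nlinarith
        have := norm_perronKernel_sub_step_le_const (b := b) (L := Real.log (x / n)) (by linarith) hT
        have : 0 ≤ κ * (2 * (n : ℝ) ^ (-b)) := by positivity
        have : 0 ≤ κ * (if n < 2 * N + 2 then d n else 0) := by positivity
        linarith
      · push Not at hnear
        have hL : Real.log (x / n) ≠ 0 := by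
          rw [Real.log_ne_zero]
          refine ⟨by positivity, ?_, by have : 0 < x / n := by positivity
                                        linarith⟩
          intro h
          rw [div_eq_one_iff_eq hn0.ne'] at h
          exact hnear.1 (by rw [hN, h, Nat.floor_natCast])
        have e1 := norm_perronKernel_sub_step_le (by linarith : 0 < b) hT hL
        have e2 := exp_mul_log_div_le hx hn hnear.1 hnear.2
        have e3 : 2 * (Real.exp (b * Real.log (x / n)) / (T * |Real.log (x / n)|)) ≤
            κ * (2 * (n : ℝ) ^ (-b) + if n < 2 * N + 2 then d n else 0) := by
          calc _ = 2 / T * (Real.exp (b * Real.log (x / n)) / |Real.log (x / n)|) := by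
                field_simp
            _ ≤ 2 / T * _ := mul_le_mul_of_nonneg_left e2 (by positivity)
            _ = _ := by rw [hκ]; ring
        rw [mul_add] at e3
        rw [if_neg hnear.1, if_neg hnear.2]
        linarith

/-- The half-plane `re > 1/4` with horizontal cuts to the left of `re = 1/2` at heights in `P`. -/
def cutSet (P : ℝ → Prop) : Set ℂ := {s : ℂ | 1 / 4 < s.re ∧ (s.re ≤ 1 / 2 → ¬ P s.im)}

lemma mk_mem_cutSet {P : ℝ → Prop} {σ t : ℝ} :
    (σ + t * I : ℂ) ∈ cutSet P ↔ 1 / 4 < σ ∧ (σ ≤ 1 / 2 → ¬ P t) := by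
  simp [cutSet]

/-- The integral of `g` over the horizontal segment from `α + ih` to `β + ih`. -/
def horizontalIntegral (g : ℂ → ℂ) (α β h : ℝ) : ℂ := ∫ σ in α..β, g (σ + h * I)

/-- The integral of `g(σ+it) i dt` for `t` from `u` to `v`. -/
def verticalIntegral (g : ℂ → ℂ) (σ u v : ℝ) : ℂ := I * ∫ t in u..v, g (σ + t * I)

lemma rect_integral_eq {P : ℝ → Prop} {g : ℂ → ℂ} (hg : DifferentiableOn ℂ g (cutSet P))
    {α β h₁ h₂ : ℝ} (hα : 1 / 4 < α) (hαβ : α ≤ β) (hh : h₁ ≤ h₂)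
    (hfree : ∀ t, h₁ ≤ t → t ≤ h₂ → α ≤ 1 / 2 → ¬ P t) :
    horizontalIntegral g α β h₁ - horizontalIntegral g α β h₂ + verticalIntegral g β h₁ h₂ -
      verticalIntegral g α h₁ h₂ = 0 := by
  have hd : DifferentiableOn ℂ g (Set.uIcc α β ×ℂ Set.uIcc h₁ h₂) := by
    refine hg.mono fun s hs => ?_
    have h1 := hs.1
    have h2 := hs.2
    rw [Set.mem_preimage, Set.uIcc_of_le hαβ] at h1
    rw [Set.mem_preimage, Set.uIcc_of_le hh] at h2
    exact ⟨by linarith [h1.1], fun h => hfree _ h2.1 h2.2 (h1.1.trans h)⟩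
  have hrect := Complex.integral_boundary_rect_eq_zero_of_differentiableOn g
    (α + h₁ * I) (β + h₂ * I) (by simpa using hd)
  simpa [horizontalIntegral, verticalIntegral] using hrect

lemma intervalIntegrable_horizontal {P : ℝ → Prop} {g : ℂ → ℂ}
    (hg : DifferentiableOn ℂ g (cutSet P)) {h α β : ℝ} (hα : 1 / 4 < α) (hαβ : α ≤ β)
    (hh : α ≤ 1 / 2 → ¬ P h) :
    IntervalIntegrable (fun σ : ℝ => g (σ + h * I)) MeasureTheory.volume α β := by
  refine ContinuousOn.intervalIntegrable ?_
  rw [Set.uIcc_of_le hαβ]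
  refine hg.continuousOn.comp (by fun_prop) fun σ hσ => ?_
  exact mk_mem_cutSet.2 ⟨by linarith [hσ.1], fun h => hh (hσ.1.trans h)⟩

lemma horizontalIntegral_add {P : ℝ → Prop} {g : ℂ → ℂ} (hg : DifferentiableOn ℂ g (cutSet P))
    {h α β κ : ℝ} (hα : 1 / 4 < α) (hαβ : α ≤ β) (hβ : β ≤ κ) (hh : ¬ P h) :
    horizontalIntegral g α κ h = horizontalIntegral g α β h + horizontalIntegral g β κ h :=
  (intervalIntegral.integral_add_adjacent_intervals
    (intervalIntegrable_horizontal hg hα hαβ fun _ => hh)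
    (intervalIntegrable_horizontal hg (hα.trans_le hαβ) hβ fun _ => hh)).symm

lemma intervalIntegrable_vertical {P : ℝ → Prop} (hP : ∀ T : ℝ, {t : ℝ | P t ∧ |t| ≤ T}.Finite)
    (hopen : IsOpen (cutSet P)) {g : ℂ → ℂ} (hg : DifferentiableOn ℂ g (cutSet P))
    {σ : ℝ} (hσ : 1 / 4 < σ)
    (hbd : ∀ T : ℝ, ∃ M : ℝ, ∀ t : ℝ, |t| ≤ T → (σ + t * I : ℂ) ∈ cutSet P → ‖g (σ + t * I)‖ ≤ M)
    (u v : ℝ) : IntervalIntegrable (fun t : ℝ => g (σ + t * I)) MeasureTheory.volume u v := by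
  rw [intervalIntegrable_iff]
  set V : Set ℝ := {t : ℝ | (σ + t * I : ℂ) ∈ cutSet P} with hV
  have hVo : IsOpen V := hopen.preimage (by fun_prop : Continuous fun t : ℝ => (σ + t * I : ℂ))
  have hcont : ContinuousOn (fun t : ℝ => g (σ + t * I)) V :=
    hg.continuousOn.comp (by fun_prop) fun t ht => ht
  obtain ⟨M, hM⟩ := hbd (max |u| |v|)
  have hin : ∀ t ∈ Set.uIoc u v, |t| ≤ max |u| |v| := by
    intro t ht
    have h1 := Set.uIoc_subset_uIcc ht
    rw [Set.mem_uIcc] at h1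
    rcases h1 with h | h
    · exact abs_le_max_abs_abs h.1 h.2
    · rw [max_comm]; exact abs_le_max_abs_abs h.1 h.2
  have hnull : MeasureTheory.volume (Set.uIoc u v \ (Set.uIoc u v ∩ V)) = 0 := by
    refine Set.Finite.measure_zero ((hP (max |u| |v|)).subset ?_) _
    rintro t ⟨ht1, ht2⟩
    refine ⟨?_, hin t ht1⟩
    by_contra hPt
    exact ht2 ⟨ht1, mk_mem_cutSet.2 ⟨hσ, fun _ => hPt⟩⟩
  have hmeas : MeasurableSet (Set.uIoc u v ∩ V) := measurableSet_uIoc.inter hVo.measurableSet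
  have hint : MeasureTheory.IntegrableOn (fun t : ℝ => g (σ + t * I)) (Set.uIoc u v ∩ V) := by
    refine MeasureTheory.IntegrableOn.of_bound ?_ ?_ M ?_
    · refine lt_of_le_of_lt (MeasureTheory.measure_mono Set.inter_subset_left) ?_
      rw [Real.volume_uIoc]
      exact ENNReal.ofReal_lt_top
    · exact (hcont.mono Set.inter_subset_right).aestronglyMeasurable hmeas
    · filter_upwards [MeasureTheory.ae_restrict_mem hmeas] with t ht
      exact hM t (hin t ht.1) ht.2
  refine hint.congr_set_ae ?_
  refine MeasureTheory.ae_eq_set.2 ⟨hnull, ?_⟩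
  rw [Set.sdiff_eq_empty.2 Set.inter_subset_left, MeasureTheory.measure_empty]

/-- The jump of `g` across the cut at height `γ`, measured at distance `ε`. -/
def cutJump (g : ℂ → ℂ) (α β γ ε : ℝ) : ℂ :=
  horizontalIntegral g α β (γ - ε) - horizontalIntegral g α β (γ + ε)

lemma verticalIntegral_add {g : ℂ → ℂ} {σ : ℝ}
    (hi : ∀ u v, IntervalIntegrable (fun t : ℝ => g (σ + t * I)) MeasureTheory.volume u v)
    (u v w : ℝ) : verticalIntegral g σ u w = verticalIntegral g σ u v + verticalIntegral g σ v w := by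
  rw [verticalIntegral, verticalIntegral, verticalIntegral, ← mul_add,
    intervalIntegral.integral_add_adjacent_intervals (hi u v) (hi v w)]

lemma tendsto_verticalIntegral_zero {g : ℂ → ℂ} {σ : ℝ}
    (hi : ∀ u v, IntervalIntegrable (fun t : ℝ => g (σ + t * I)) MeasureTheory.volume u v) (γ : ℝ) :
    Tendsto (fun ε => verticalIntegral g σ (γ - ε) (γ + ε)) (nhdsWithin 0 (Set.Ioi 0)) (nhds 0) := by
  have hc : Continuous fun v => ∫ t in γ..v, g (σ + t * I) :=
    intervalIntegral.continuous_primitive hi γ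
  have h : Tendsto (fun ε : ℝ => I * ((∫ t in γ..(γ + ε), g (σ + t * I)) - ∫ t in γ..(γ - ε), g (σ + t * I)))
      (nhds 0) (nhds (I * ((∫ t in γ..(γ + 0), g (σ + t * I)) - ∫ t in γ..(γ - 0), g (σ + t * I)))) := by
    refine Continuous.tendsto (x := (0 : ℝ)) ?_
    exact continuous_const.mul ((hc.comp (by fun_prop)).sub (hc.comp (by fun_prop)))
  simp only [add_zero, sub_zero, intervalIntegral.integral_same, mul_zero] at h
  refine (h.mono_left nhdsWithin_le_nhds).congr fun ε => ?_
  rw [verticalIntegral, ← intervalIntegral.integral_add_adjacent_intervals (hi (γ - ε) γ) (hi γ (γ + ε)),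
    intervalIntegral.integral_symm γ (γ - ε)]
  ring

/-- The jump across a cut, corrected by the vertical integrals, is independent of the distance. -/
lemma cutJump_add_verticalIntegral {P : ℝ → Prop} {g : ℂ → ℂ}
    (hg : DifferentiableOn ℂ g (cutSet P)) {α β : ℝ} (hα : 1 / 4 < α) (hαβ : α ≤ β)
    (hiα : ∀ u v, IntervalIntegrable (fun t : ℝ => g (α + t * I)) MeasureTheory.volume u v)
    (hiβ : ∀ u v, IntervalIntegrable (fun t : ℝ => g (β + t * I)) MeasureTheory.volume u v)
    {γ ε₀ ε : ℝ} (hε : 0 < ε) (hεε : ε ≤ ε₀) (hfree : ∀ t, |t - γ| ≤ ε₀ → t ≠ γ → ¬ P t) :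
    cutJump g α β γ ε + verticalIntegral g β (γ - ε) (γ + ε) - verticalIntegral g α (γ - ε) (γ + ε) =
    cutJump g α β γ ε₀ + verticalIntegral g β (γ - ε₀) (γ + ε₀) -
      verticalIntegral g α (γ - ε₀) (γ + ε₀) := by
  have r1 := rect_integral_eq hg (h₁ := γ - ε₀) (h₂ := γ - ε) hα hαβ (by linarith)
    fun t h1 h2 _ => hfree t (abs_le.2 ⟨by linarith, by linarith⟩) (by rintro rfl; linarith)
  have r2 := rect_integral_eq hg (h₁ := γ + ε) (h₂ := γ + ε₀) hα hαβ (by linarith)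
    fun t h1 h2 _ => hfree t (abs_le.2 ⟨by linarith, by linarith⟩) (by rintro rfl; linarith)
  have e1 := verticalIntegral_add hiα (γ - ε₀) (γ - ε) (γ + ε₀)
  have e2 := verticalIntegral_add hiα (γ - ε) (γ + ε) (γ + ε₀)
  have e3 := verticalIntegral_add hiβ (γ - ε₀) (γ - ε) (γ + ε₀)
  have e4 := verticalIntegral_add hiβ (γ - ε) (γ + ε) (γ + ε₀)
  rw [cutJump, cutJump]
  linear_combination (-1 : ℂ) * r1 - r2 + e1 + e2 - e3 - e4

lemma tendsto_cutJump {P : ℝ → Prop} {g : ℂ → ℂ}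
    (hg : DifferentiableOn ℂ g (cutSet P)) {α β : ℝ} (hα : 1 / 4 < α) (hαβ : α ≤ β)
    (hiα : ∀ u v, IntervalIntegrable (fun t : ℝ => g (α + t * I)) MeasureTheory.volume u v)
    (hiβ : ∀ u v, IntervalIntegrable (fun t : ℝ => g (β + t * I)) MeasureTheory.volume u v)
    {γ ε₀ : ℝ} (hε₀ : 0 < ε₀) (hfree : ∀ t, |t - γ| ≤ ε₀ → t ≠ γ → ¬ P t) :
    Tendsto (cutJump g α β γ) (nhdsWithin 0 (Set.Ioi 0)) (nhds (cutJump g α β γ ε₀ +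
      verticalIntegral g β (γ - ε₀) (γ + ε₀) - verticalIntegral g α (γ - ε₀) (γ + ε₀))) := by
  set J := cutJump g α β γ ε₀ +
      verticalIntegral g β (γ - ε₀) (γ + ε₀) - verticalIntegral g α (γ - ε₀) (γ + ε₀) with hJ
  have h := ((tendsto_const_nhds (x := J)).sub (tendsto_verticalIntegral_zero hiβ γ)).add
    (tendsto_verticalIntegral_zero hiα γ)
  rw [sub_zero, add_zero] at h
  refine h.congr' ?_
  filter_upwards [Ioc_mem_nhdsGT hε₀] with ε hε
  have := cutJump_add_verticalIntegral hg hα hαβ hiα hiβ hε.1 hε.2 hfree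
  linear_combination -this

lemma tendsto_cutJump_zero {P : ℝ → Prop} {g : ℂ → ℂ}
    (hg : DifferentiableOn ℂ g (cutSet P)) {α β : ℝ} (hα : 1 / 2 < α) (hαβ : α ≤ β)
    (hiα : ∀ u v, IntervalIntegrable (fun t : ℝ => g (α + t * I)) MeasureTheory.volume u v)
    (hiβ : ∀ u v, IntervalIntegrable (fun t : ℝ => g (β + t * I)) MeasureTheory.volume u v) (γ : ℝ) :
    Tendsto (cutJump g α β γ) (nhdsWithin 0 (Set.Ioi 0)) (nhds 0) := by
  have h := (tendsto_verticalIntegral_zero hiα γ).sub (tendsto_verticalIntegral_zero hiβ γ)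
  rw [sub_zero] at h
  refine h.congr' ?_
  filter_upwards [self_mem_nhdsWithin] with ε hε
  have := rect_integral_eq hg (h₁ := γ - ε) (h₂ := γ + ε) (by linarith) hαβ
    (by have : 0 < ε := hε
        linarith) fun t _ _ h => absurd h (by linarith)
  rw [cutJump]
  linear_combination -this

/-- Decomposition of the total change of a function that is constant off a finite set. -/
lemma sub_eq_sum_jumps (Ψ J : ℝ → ℂ) (Z : Finset ℝ) : ∀ u v : ℝ, u ≤ v → (∀ z ∈ Z, u < z ∧ z < v) →
    (∀ h₁ h₂, u ≤ h₁ → h₁ ≤ h₂ → h₂ ≤ v → (∀ z ∈ Z, ¬ (h₁ ≤ z ∧ z ≤ h₂)) → Ψ h₁ = Ψ h₂) →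
    (∀ z ∈ Z, ∃ ε₀ > 0, ∀ ε, 0 < ε → ε ≤ ε₀ → Ψ (z - ε) - Ψ (z + ε) = J z) →
    Ψ u - Ψ v = ∑ z ∈ Z, J z := by
  induction Z using Finset.induction_on_max with
  | empty =>
    intro u v huv _ hc _
    rw [hc u v le_rfl huv le_rfl (by simp), sub_self, Finset.sum_empty]
  | insert m Z hm ih =>
    intro u v huv hZ hc hJ
    have hmZ : m ∉ Z := fun h => lt_irrefl _ (hm m h)
    obtain ⟨ε₀, hε₀, hJm⟩ := hJ m (Finset.mem_insert_self _ _)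
    have hmuv := hZ m (Finset.mem_insert_self _ _)
    obtain ⟨ε, hε, hε1, hε2, hε3, hε4⟩ : ∃ ε : ℝ, 0 < ε ∧ ε ≤ ε₀ ∧ u ≤ m - ε ∧ m + ε ≤ v ∧
        ∀ z ∈ Z, z < m - ε := by
      have h1 : ∀ᶠ ε : ℝ in nhdsWithin 0 (Set.Ioi 0), ∀ z ∈ Z, z < m - ε := by
        rw [Filter.eventually_all_finset]
        intro z hz
        filter_upwards [Ioo_mem_nhdsGT (sub_pos.2 (hm z hz))] with ε hε
        linarith [hε.2]
      obtain ⟨ε, h2, h3, h4, h5⟩ := (h1.and ((Filter.Eventually.and (Ioc_mem_nhdsGT hε₀))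
        ((Filter.Eventually.and (Ioc_mem_nhdsGT (sub_pos.2 hmuv.1))
          (Ioc_mem_nhdsGT (sub_pos.2 hmuv.2)))))).exists
      exact ⟨ε, h3.1, h3.2, by linarith [h4.2], by linarith [h5.2], h2⟩
    have e1 := ih u (m - ε) hε2
      (fun z hz => ⟨(hZ z (Finset.mem_insert_of_mem hz)).1, hε4 z hz⟩)
      (fun h₁ h₂ a1 a2 a3 a4 => hc h₁ h₂ a1 a2 (by linarith) (by
        intro z hz
        rcases Finset.mem_insert.1 hz with rfl | hz
        · intro h; linarith
        · exact a4 z hz))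
      (fun z hz => hJ z (Finset.mem_insert_of_mem hz))
    have e2 := hJm ε hε hε1
    have e3 := hc (m + ε) v (by linarith) hε3 le_rfl (by
      intro z hz h
      rcases Finset.mem_insert.1 hz with rfl | hz
      · linarith
      · linarith [hm z hz])
    rw [Finset.sum_insert hmZ, ← e1, ← e2, e3]
    ring

lemma exists_isolating_radius {P : ℝ → Prop} (hP : ∀ T : ℝ, {t : ℝ | P t ∧ |t| ≤ T}.Finite) (γ : ℝ) :
    ∃ ε₀ > 0, ∀ t, |t - γ| ≤ ε₀ → t ≠ γ → ¬ P t := by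
  have hfin : ({t : ℝ | P t ∧ |t| ≤ |γ| + 1} \ {γ}).Finite := (hP (|γ| + 1)).subset Set.sdiff_subset
  have hopen := hfin.isClosed.isOpen_compl
  have hmem : γ ∈ ({t : ℝ | P t ∧ |t| ≤ |γ| + 1} \ {γ})ᶜ := by simp
  obtain ⟨ε, hε, hball⟩ := Metric.isOpen_iff.1 hopen γ hmem
  refine ⟨min (ε / 2) 1, by positivity, fun t ht hne hPt => ?_⟩
  have h1 : |t - γ| ≤ ε / 2 := ht.trans (min_le_left _ _)
  have h2 : |t - γ| ≤ 1 := ht.trans (min_le_right _ _)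
  have h3 : t ∈ Metric.ball γ ε := by
    rw [Metric.mem_ball, Real.dist_eq]; linarith
  refine hball h3 ⟨⟨hPt, ?_⟩, hne⟩
  have := abs_add_le (t - γ) γ
  rw [sub_add_cancel] at this
  linarith

lemma intervalIntegrable_abs_rpow (r : ℝ) :
    IntervalIntegrable (fun u : ℝ => |u| ^ (-(1 / 4) : ℝ)) MeasureTheory.volume 0 r := by
  have h : ∀ r : ℝ, 0 ≤ r →
      IntervalIntegrable (fun u : ℝ => |u| ^ (-(1 / 4) : ℝ)) MeasureTheory.volume 0 r := by
    intro r hr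
    refine (intervalIntegral.intervalIntegrable_rpow' (r := -(1 / 4)) (by norm_num) (a := 0)
      (b := r)).congr ?_
    rw [Set.uIoc_of_le hr]
    intro u hu
    simp [abs_of_pos hu.1]
  rcases le_total 0 r with hr | hr
  · exact h r hr
  · have := (IntervalIntegrable.iff_comp_neg (by finiteness)).1 (h (-r) (by linarith))
    simpa using this

lemma integral_abs_rpow {r : ℝ} (hr : 0 < r) :
    ∫ u in (-r)..r, |u| ^ (-(1 / 4) : ℝ) = 8 / 3 * r ^ (3 / 4 : ℝ) := by
  have h1 : ∫ u in (0 : ℝ)..r, |u| ^ (-(1 / 4) : ℝ) = 4 / 3 * r ^ (3 / 4 : ℝ) := by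
    have : ∫ u in (0 : ℝ)..r, |u| ^ (-(1 / 4) : ℝ) = ∫ u in (0 : ℝ)..r, u ^ (-(1 / 4) : ℝ) := by
      refine intervalIntegral.integral_congr fun u hu => ?_
      rw [Set.uIcc_of_le hr.le] at hu
      simp [abs_of_nonneg hu.1]
    rw [this, integral_rpow (Or.inl (by norm_num)), Real.zero_rpow (by norm_num)]
    norm_num
    ring
  have h2 : ∫ u in (-r)..0, |u| ^ (-(1 / 4) : ℝ) = 4 / 3 * r ^ (3 / 4 : ℝ) := by
    rw [← h1]
    have := intervalIntegral.integral_comp_neg (a := -r) (b := 0)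
      (fun u : ℝ => |u| ^ (-(1 / 4) : ℝ))
    simpa using this
  rw [← intervalIntegral.integral_add_adjacent_intervals (intervalIntegrable_abs_rpow (-r)).symm
    (intervalIntegrable_abs_rpow r), h1, h2]
  ring

lemma norm_horizontalIntegral_le_of_near {P : ℝ → Prop} {g : ℂ → ℂ} {γ K δ : ℝ} (hK : 0 ≤ K)
    (hloc : ∀ s ∈ cutSet P, s ≠ 1 / 2 + γ * I → ‖s - (1 / 2 + γ * I)‖ < δ →
      ‖g s‖ ≤ K * ‖s - (1 / 2 + γ * I)‖ ^ (-(1 / 4) : ℝ))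
    {r h : ℝ} (hr : 0 < r) (hr1 : r < 1 / 8) (hPh : ¬ P h) (hrδ : r + |h - γ| < δ) :
    ‖horizontalIntegral g (1 / 2 - r) (1 / 2 + r) h‖ ≤ K * (8 / 3 * r ^ (3 / 4 : ℝ)) := by
  have hint : IntervalIntegrable (fun u : ℝ => K * |u| ^ (-(1 / 4) : ℝ)) MeasureTheory.volume (-r) r :=
    ((intervalIntegrable_abs_rpow (-r)).symm.trans (intervalIntegrable_abs_rpow r)).const_mul K
  have e : ∫ u in (-r)..r, g ((1 / 2 + u : ℝ) + h * I) =
      horizontalIntegral g (1 / 2 - r) (1 / 2 + r) h := by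
    rw [horizontalIntegral]
    have := intervalIntegral.integral_comp_add_left (a := -r) (b := r)
      (fun σ : ℝ => g (σ + h * I)) (1 / 2)
    rw [← sub_eq_add_neg] at this
    exact this
  rw [← e, ← integral_abs_rpow hr, ← intervalIntegral.integral_const_mul]
  refine intervalIntegral.norm_integral_le_of_norm_le (by linarith) ?_ hint
  filter_upwards [MeasureTheory.compl_mem_ae_iff.2 (MeasureTheory.measure_singleton (0 : ℝ))]
    with u hu0 hu
  have hu0' : u ≠ 0 := hu0
  have ed : ((1 / 2 + u : ℝ) + h * I : ℂ) - (1 / 2 + γ * I) = u + ((h - γ : ℝ) : ℂ) * I := by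
    push_cast; ring
  have hre : |u| ≤ ‖(u + ((h - γ : ℝ) : ℂ) * I : ℂ)‖ := by
    simpa using Complex.abs_re_le_norm (u + ((h - γ : ℝ) : ℂ) * I)
  have hle : ‖(u + ((h - γ : ℝ) : ℂ) * I : ℂ)‖ ≤ |u| + |h - γ| := by
    refine (norm_add_le _ _).trans ?_
    rw [norm_mul, Complex.norm_I, mul_one, Complex.norm_real, Complex.norm_real, Real.norm_eq_abs,
      Real.norm_eq_abs]
  have hur : |u| ≤ r := abs_le.2 ⟨hu.1.le, hu.2⟩
  have hupos : 0 < |u| := abs_pos.2 hu0'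
  have hb := hloc ((1 / 2 + u : ℝ) + h * I) (mk_mem_cutSet.2 ⟨by linarith [hu.1], fun _ => hPh⟩)
    (by
      intro heq
      rw [heq, sub_self] at ed
      rw [← ed, norm_zero] at hre
      linarith) (by rw [ed]; linarith)
  rw [ed] at hb
  refine hb.trans ?_
  refine mul_le_mul_of_nonneg_left ?_ hK
  exact Real.rpow_le_rpow_of_nonpos hupos hre (by norm_num)

lemma norm_circle_le_of_near {P : ℝ → Prop} {g : ℂ → ℂ} {γ K δ : ℝ}
    (hloc : ∀ s ∈ cutSet P, s ≠ 1 / 2 + γ * I → ‖s - (1 / 2 + γ * I)‖ < δ →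
      ‖g s‖ ≤ K * ‖s - (1 / 2 + γ * I)‖ ^ (-(1 / 4) : ℝ))
    {r : ℝ} (hr : 0 < r) (hr1 : r < 1 / 8) (hrδ : r < δ) (hfree : ∀ t, |t - γ| ≤ r → t ≠ γ → ¬ P t) :
    ‖∫ θ in (-Real.pi)..Real.pi, g (1 / 2 + γ * I + r * Complex.exp (θ * I)) *
      (I * r * Complex.exp (θ * I))‖ ≤ 2 * Real.pi * (K * r ^ (3 / 4 : ℝ)) := by
  have h := intervalIntegral.norm_integral_le_of_norm_le_const_ae (a := -Real.pi) (b := Real.pi)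
    (C := K * r ^ (3 / 4 : ℝ)) (f := fun θ : ℝ => g (1 / 2 + γ * I + r * Complex.exp (θ * I)) *
      (I * r * Complex.exp (θ * I))) ?_
  · refine h.trans (le_of_eq ?_)
    rw [sub_neg_eq_add, abs_of_pos (by have := Real.pi_pos; positivity)]
    ring
  filter_upwards [MeasureTheory.compl_mem_ae_iff.2 (MeasureTheory.measure_singleton Real.pi)]
    with θ hθ hmem
  rw [Set.uIoc_of_le (by linarith [Real.pi_pos])] at hmem
  have hθ1 : θ < Real.pi := lt_of_le_of_ne hmem.2 hθ
  have hn : ‖(r * Complex.exp (θ * I) : ℂ)‖ = r := by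
    rw [norm_mul, Complex.norm_exp_ofReal_mul_I, mul_one, Complex.norm_real, Real.norm_of_nonneg hr.le]
  have hpt : (1 / 2 + γ * I + r * Complex.exp (θ * I) : ℂ) =
      ((1 / 2 + r * Real.cos θ : ℝ) : ℂ) + ((γ + r * Real.sin θ : ℝ) : ℂ) * I := by
    rw [Complex.exp_mul_I]
    push_cast
    ring
  have hmemcut : (1 / 2 + γ * I + r * Complex.exp (θ * I) : ℂ) ∈ cutSet P := by
    rw [hpt, mk_mem_cutSet]
    refine ⟨by nlinarith [Real.neg_one_le_cos θ], fun hle => ?_⟩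
    have hcos : Real.cos θ ≤ 0 := by
      by_contra hc
      push Not at hc
      have := mul_pos hr hc
      linarith
    refine hfree _ ?_ ?_
    · rw [add_sub_cancel_left, abs_mul, abs_of_pos hr]
      nlinarith [Real.abs_sin_le_one θ]
    · intro he
      have hs : Real.sin θ = 0 := by
        have : r * Real.sin θ = 0 := by linarith
        rcases mul_eq_zero.1 this with h | h
        · exact absurd h hr.ne'
        · exact h
      have hθ0 := (Real.sin_eq_zero_iff_of_lt_of_lt hmem.1 hθ1).1 hs
      rw [hθ0, Real.cos_zero] at hcos
      linarith
  have hb := hloc _ hmemcut (by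
    intro heq
    have : (r * Complex.exp (θ * I) : ℂ) = 0 := by linear_combination heq
    rw [this, norm_zero] at hn
    linarith) (by rw [add_sub_cancel_left, hn]; exact hrδ)
  rw [add_sub_cancel_left, hn] at hb
  have hn2 : ‖(I * r * Complex.exp (θ * I) : ℂ)‖ = r := by
    rw [mul_assoc, norm_mul, Complex.norm_I, one_mul, hn]
  rw [norm_mul, hn2]
  calc _ ≤ K * r ^ (-(1 / 4) : ℝ) * r := by gcongr
    _ = K * r ^ (3 / 4 : ℝ) := by
        rw [mul_assoc, ← Real.rpow_add_one hr.ne']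
        norm_num

/-- The truncated Hankel integral at height `γ` tends to the jump across the cut when `r → 0`. -/
lemma exists_norm_sub_hankelIntegral_le {P : ℝ → Prop}
    (hP : ∀ T : ℝ, {t : ℝ | P t ∧ |t| ≤ T}.Finite) {g : ℂ → ℂ} (hg : DifferentiableOn ℂ g (cutSet P))
    (hi : ∀ σ : ℝ, 3 / 8 ≤ σ → σ ≠ 1 / 2 →
      ∀ u v, IntervalIntegrable (fun t : ℝ => g (σ + t * I)) MeasureTheory.volume u v)
    {γ K δ : ℝ} (hK : 0 ≤ K) (hδ : 0 < δ)
    (hloc : ∀ s ∈ cutSet P, s ≠ 1 / 2 + γ * I → ‖s - (1 / 2 + γ * I)‖ < δ →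
      ‖g s‖ ≤ K * ‖s - (1 / 2 + γ * I)‖ ^ (-(1 / 4) : ℝ))
    {c b : ℝ} (hc : 0 < c) (hc1 : c < 1 / 8) (hb : 1 < b) {J : ℂ}
    (hJ : Tendsto (cutJump g (1 / 2 - c) b γ) (nhdsWithin 0 (Set.Ioi 0)) (nhds J))
    {η : ℝ} (hη : 0 < η) :
    ∃ r₀ > 0, ∀ r, 0 < r → r < r₀ → ‖J - hankelIntegral g (1 / 2 + γ * I) c r‖ ≤ η := by
  obtain ⟨ε₀, hε₀, hfree⟩ := exists_isolating_radius hP γ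
  obtain ⟨r₁, hr₁, hsmall⟩ : ∃ r₁ > 0, ∀ r, 0 < r → r < r₁ →
      (6 + 2 * Real.pi) * (K * r ^ (3 / 4 : ℝ)) ≤ η := by
    have ht : Tendsto (fun r : ℝ => (6 + 2 * Real.pi) * (K * r ^ (3 / 4 : ℝ))) (nhds 0)
        (nhds ((6 + 2 * Real.pi) * (K * 0 ^ (3 / 4 : ℝ)))) :=
      Continuous.tendsto (by
        have : Continuous fun r : ℝ => r ^ (3 / 4 : ℝ) :=
          Real.continuous_rpow_const (by norm_num)
        fun_prop) 0
    rw [Real.zero_rpow (by norm_num), mul_zero, mul_zero] at ht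
    obtain ⟨r₁, hr₁, hh⟩ := Metric.eventually_nhds_iff.1 (ht.eventually (gt_mem_nhds hη))
    refine ⟨r₁, hr₁, fun r h0 h1 => (hh ?_).le⟩
    rw [Real.dist_eq, sub_zero, abs_of_pos h0]
    exact h1
  refine ⟨min (min r₁ (δ / 2)) (min c ε₀), by positivity, fun r hr hrr => ?_⟩
  have hr1 : r < r₁ := hrr.trans_le ((min_le_left _ _).trans (min_le_left _ _))
  have hrδ : r < δ / 2 := hrr.trans_le ((min_le_left _ _).trans (min_le_right _ _))
  have hrc : r < c := hrr.trans_le ((min_le_right _ _).trans (min_le_left _ _))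
  have hrε : r < ε₀ := hrr.trans_le ((min_le_right _ _).trans (min_le_right _ _))
  have hi1 := hi (1 / 2 - c) (by linarith) (by linarith)
  have hi2 := hi (1 / 2 - r) (by linarith) (by linarith)
  have hi3 := hi (1 / 2 + r) (by linarith) (by linarith)
  have hi4 := hi b (by linarith) (by linarith)
  set circ := ∫ θ in (-Real.pi)..Real.pi, g (1 / 2 + γ * I + r * Complex.exp (θ * I)) *
      (I * r * Complex.exp (θ * I)) with hcirc
  have hcircle : ‖circ‖ ≤ 2 * Real.pi * (K * r ^ (3 / 4 : ℝ)) :=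
    norm_circle_le_of_near hloc hr (by linarith) (by linarith)
      (fun t ht => hfree t (by linarith))
  have ht1 := tendsto_cutJump hg (α := 1 / 2 - c) (β := 1 / 2 - r) (by linarith) (by linarith)
    hi1 hi2 hε₀ hfree
  set J₁ := cutJump g (1 / 2 - c) (1 / 2 - r) γ ε₀ +
      verticalIntegral g (1 / 2 - r : ℝ) (γ - ε₀) (γ + ε₀) -
      verticalIntegral g (1 / 2 - c : ℝ) (γ - ε₀) (γ + ε₀) with hJ₁
  have hH : hankelIntegral g (1 / 2 + γ * I) c r = J₁ + circ := by
    rw [hankelIntegral]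
    refine Tendsto.limUnder_eq ?_
    refine (ht1.add_const circ).congr fun ε => ?_
    have e1 : (1 / 2 + γ * I : ℂ).re = 1 / 2 := by simp
    have e2 : (1 / 2 + γ * I : ℂ).im = γ := by simp
    rw [e1, e2, cutJump, horizontalIntegral, horizontalIntegral, hcirc]
    push_cast
    ring
  have ht0 := tendsto_cutJump_zero hg (α := 1 / 2 + r) (β := b) (by linarith) (by linarith) hi3 hi4 γ
  have htm : Tendsto (cutJump g (1 / 2 - r) (1 / 2 + r) γ) (nhdsWithin 0 (Set.Ioi 0))
      (nhds (J - J₁)) := by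
    have := (hJ.sub ht1).sub ht0
    rw [sub_zero] at this
    refine this.congr' ?_
    filter_upwards [Ioc_mem_nhdsGT hε₀] with ε hε
    have hm : ¬ P (γ - ε) := hfree _ (by
      rw [show γ - ε - γ = -ε by ring, abs_neg, abs_of_pos hε.1]; exact hε.2) (by linarith [hε.1])
    have hp : ¬ P (γ + ε) := hfree _ (by
      rw [add_sub_cancel_left, abs_of_pos hε.1]; exact hε.2) (by linarith [hε.1])
    have a1 := horizontalIntegral_add hg (α := 1 / 2 - c) (β := 1 / 2 - r) (κ := b)
      (by linarith) (by linarith) (by linarith) hm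
    have a2 := horizontalIntegral_add hg (α := 1 / 2 - r) (β := 1 / 2 + r) (κ := b)
      (by linarith) (by linarith) (by linarith) hm
    have a3 := horizontalIntegral_add hg (α := 1 / 2 - c) (β := 1 / 2 - r) (κ := b)
      (by linarith) (by linarith) (by linarith) hp
    have a4 := horizontalIntegral_add hg (α := 1 / 2 - r) (β := 1 / 2 + r) (κ := b)
      (by linarith) (by linarith) (by linarith) hp
    simp only [cutJump]
    linear_combination a1 + a2 - a3 - a4
  have hmid : ‖J - J₁‖ ≤ 6 * (K * r ^ (3 / 4 : ℝ)) := by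
    refine le_of_tendsto htm.norm ?_
    filter_upwards [Ioc_mem_nhdsGT hε₀, Ioo_mem_nhdsGT (half_pos hδ)] with ε hε hε2
    have hm : |γ - ε - γ| = ε := by
      rw [show γ - ε - γ = -ε by ring, abs_neg, abs_of_pos hε.1]
    have hp : |γ + ε - γ| = ε := by rw [add_sub_cancel_left, abs_of_pos hε.1]
    have b1 := norm_horizontalIntegral_le_of_near hK hloc hr (by linarith)
      (hfree (γ - ε) (by rw [hm]; exact hε.2) (by linarith [hε.1])) (by rw [hm]; linarith [hε2.2])
    have b2 := norm_horizontalIntegral_le_of_near hK hloc hr (by linarith)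
      (hfree (γ + ε) (by rw [hp]; exact hε.2) (by linarith [hε.1])) (by rw [hp]; linarith [hε2.2])
    rw [cutJump]
    refine (norm_sub_le _ _).trans ((add_le_add b1 b2).trans ?_)
    have : 0 ≤ K * r ^ (3 / 4 : ℝ) := by positivity
    linarith
  rw [hH]
  calc ‖J - (J₁ + circ)‖ = ‖(J - J₁) - circ‖ := by rw [sub_add_eq_sub_sub]
    _ ≤ 6 * (K * r ^ (3 / 4 : ℝ)) + 2 * Real.pi * (K * r ^ (3 / 4 : ℝ)) :=
        (norm_sub_le _ _).trans (add_le_add hmid hcircle)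
    _ = (6 + 2 * Real.pi) * (K * r ^ (3 / 4 : ℝ)) := by ring
    _ ≤ η := hsmall r hr hr1

/-- Shifting a vertical line integral across cuts produces truncated Hankel integrals. -/
lemma exists_norm_verticalIntegral_sub_le {P : ℝ → Prop}
    (hP : ∀ T : ℝ, {t : ℝ | P t ∧ |t| ≤ T}.Finite) {g : ℂ → ℂ} (hg : DifferentiableOn ℂ g (cutSet P))
    (hi : ∀ σ : ℝ, 3 / 8 ≤ σ → σ ≠ 1 / 2 →
      ∀ u v, IntervalIntegrable (fun t : ℝ => g (σ + t * I)) MeasureTheory.volume u v)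
    (hloc : ∀ γ : ℝ, ∃ K δ : ℝ, 0 ≤ K ∧ 0 < δ ∧ ∀ s ∈ cutSet P, s ≠ 1 / 2 + γ * I →
      ‖s - (1 / 2 + γ * I)‖ < δ → ‖g s‖ ≤ K * ‖s - (1 / 2 + γ * I)‖ ^ (-(1 / 4) : ℝ))
    {c b : ℝ} (hc : 0 < c) (hc1 : c < 1 / 8) (hb : 1 < b) {u v : ℝ} (huv : u ≤ v)
    {Z : Finset ℝ} (hu : ¬ P u) (hv : ¬ P v) (hZ : ∀ γ, γ ∈ Z ↔ u < γ ∧ γ < v ∧ P γ) :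
    ∃ r₀ : ℝ, 0 < r₀ ∧ ∀ r, 0 < r → r < r₀ →
      ‖verticalIntegral g b u v - ∑ γ ∈ Z, hankelIntegral g (1 / 2 + γ * I) c r‖ ≤
        1 + ‖verticalIntegral g (1 / 2 - c : ℝ) u v‖ + ‖horizontalIntegral g (1 / 2 - c) b u‖ +
          ‖horizontalIntegral g (1 / 2 - c) b v‖ := by
  have hia := hi (1 / 2 - c) (by linarith) (by linarith)
  have hib := hi b (by linarith) (by linarith)
  have ha : (1 / 4 : ℝ) < 1 / 2 - c := by linarith
  have hab : 1 / 2 - c ≤ b := by linarith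
  choose ε₀ hε₀ hfree using exists_isolating_radius hP
  set J : ℝ → ℂ := fun γ => cutJump g (1 / 2 - c) b γ (ε₀ γ) +
    verticalIntegral g b (γ - ε₀ γ) (γ + ε₀ γ) -
    verticalIntegral g (1 / 2 - c : ℝ) (γ - ε₀ γ) (γ + ε₀ γ) with hJ
  set η : ℝ := 1 / (Z.card + 1) with hη
  have hηpos : 0 < η := by positivity
  have hH : ∀ γ : ℝ, ∃ r₀ > 0, ∀ r, 0 < r → r < r₀ →
      ‖J γ - hankelIntegral g (1 / 2 + γ * I) c r‖ ≤ η := by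
    intro γ
    obtain ⟨K, δ, hK, hδ, hb'⟩ := hloc γ
    exact exists_norm_sub_hankelIntegral_le hP hg hi hK hδ hb' hc hc1 hb
      (tendsto_cutJump hg ha hab hia hib (hε₀ γ) (hfree γ)) hηpos
  choose ρ hρ hHρ using hH
  have hsum : (horizontalIntegral g (1 / 2 - c) b u - verticalIntegral g b u u +
      verticalIntegral g (1 / 2 - c : ℝ) u u) - (horizontalIntegral g (1 / 2 - c) b v -
      verticalIntegral g b u v + verticalIntegral g (1 / 2 - c : ℝ) u v) = ∑ γ ∈ Z, J γ := by
    refine sub_eq_sum_jumps (fun h => horizontalIntegral g (1 / 2 - c) b h - verticalIntegral g b u h +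
      verticalIntegral g (1 / 2 - c : ℝ) u h) J Z u v huv
      (fun z hz => ⟨((hZ z).1 hz).1, ((hZ z).1 hz).2.1⟩) ?_ ?_
    · intro h₁ h₂ a1 a2 a3 a4
      have hr := rect_integral_eq hg ha hab a2 (by
        intro t b1 b2 _ hPt
        refine a4 t ((hZ t).2 ⟨?_, ?_, hPt⟩) ⟨b1, b2⟩
        · rcases (a1.trans b1).lt_or_eq with h | rfl
          · exact h
          · exact absurd hPt hu
        · rcases (b2.trans a3).lt_or_eq with h | rfl
          · exact h
          · exact absurd hPt hv)
      have e1 := verticalIntegral_add hia u h₁ h₂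
      have e2 := verticalIntegral_add hib u h₁ h₂
      linear_combination hr - e1 + e2
    · intro z hz
      refine ⟨ε₀ z, hε₀ z, fun ε h0 h1 => ?_⟩
      have e := cutJump_add_verticalIntegral hg ha hab hia hib h0 h1 (hfree z)
      have e1 := verticalIntegral_add hia u (z - ε) (z + ε)
      have e2 := verticalIntegral_add hib u (z - ε) (z + ε)
      simp only [hJ]
      rw [← e, cutJump]
      linear_combination e2 - e1
  have h0 : ∀ σ : ℝ, verticalIntegral g σ u u = 0 := fun σ => by simp [verticalIntegral]
  rw [h0, h0, sub_zero, add_zero] at hsum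
  have hr₀ : ∃ r₀ : ℝ, 0 < r₀ ∧ ∀ γ ∈ Z, r₀ ≤ ρ γ := by
    have h1 : ∀ᶠ r : ℝ in nhdsWithin 0 (Set.Ioi 0), ∀ γ ∈ Z, r ≤ ρ γ := by
      rw [Filter.eventually_all_finset]
      intro γ _
      filter_upwards [Ioc_mem_nhdsGT (hρ γ)] with r hr using hr.2
    obtain ⟨r, h2, h3⟩ := (h1.and self_mem_nhdsWithin).exists
    exact ⟨r, h3, h2⟩
  obtain ⟨r₀, hr₀, hle⟩ := hr₀
  refine ⟨r₀, hr₀, fun r h1 h2 => ?_⟩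
  have hdiff : ‖∑ γ ∈ Z, J γ - ∑ γ ∈ Z, hankelIntegral g (1 / 2 + γ * I) c r‖ ≤ 1 := by
    rw [← Finset.sum_sub_distrib]
    calc _ ≤ ∑ γ ∈ Z, η := norm_sum_le_of_le _ fun γ hγ => hHρ γ r h1 (h2.trans_le (hle γ hγ))
      _ = Z.card * η := by rw [Finset.sum_const, nsmul_eq_mul]
      _ ≤ 1 := by
          rw [hη, mul_one_div, div_le_one (by positivity)]
          linarith
  have key : verticalIntegral g b u v - ∑ γ ∈ Z, hankelIntegral g (1 / 2 + γ * I) c r =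
      (∑ γ ∈ Z, J γ - ∑ γ ∈ Z, hankelIntegral g (1 / 2 + γ * I) c r) +
      verticalIntegral g (1 / 2 - c : ℝ) u v - horizontalIntegral g (1 / 2 - c) b u +
      horizontalIntegral g (1 / 2 - c) b v := by
    rw [← hsum]; ring
  rw [key]
  refine (norm_add_le _ _).trans (add_le_add ?_ le_rfl)
  refine (norm_sub_le _ _).trans (add_le_add ?_ le_rfl)
  exact (norm_add_le _ _).trans (add_le_add hdiff le_rfl)

lemma norm_mul_cpow_div {x : ℝ} (hx : 0 < x) (w s : ℂ) :
    ‖w * (x : ℂ) ^ s / s‖ = ‖w‖ * x ^ s.re / ‖s‖ := by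
  rw [norm_div, norm_mul, Complex.norm_cpow_eq_rpow_re_of_pos hx]

lemma rpow_mul_rpow_le_add {x U c σ : ℝ} (hx : 1 ≤ x) (hU : 1 ≤ U) (h1 : 1 / 2 - c ≤ σ)
    (h2 : σ ≤ 1 / 2) : U ^ (1 / 2 - σ) * x ^ σ ≤ x + x ^ (1 / 2 - c) * U ^ c := by
  have hx0 : 0 < x := by linarith
  have hU0 : 0 < U := by linarith
  rcases le_total U x with h | h
  · have e : U ^ (1 / 2 - σ) * x ^ σ ≤ x := by
      calc U ^ (1 / 2 - σ) * x ^ σ ≤ x ^ (1 / 2 - σ) * x ^ σ := by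
            gcongr
        _ = x ^ (1 / 2 : ℝ) := by rw [← Real.rpow_add hx0]; ring_nf
        _ ≤ x ^ (1 : ℝ) := Real.rpow_le_rpow_of_exponent_le hx (by norm_num)
        _ = x := Real.rpow_one x
    have : 0 ≤ x ^ (1 / 2 - c) * U ^ c := by positivity
    linarith
  · have e : U ^ (1 / 2 - σ) * x ^ σ ≤ x ^ (1 / 2 - c) * U ^ c := by
      have e1 : x ^ σ = x ^ (1 / 2 - c) * x ^ (σ - (1 / 2 - c)) := by
        rw [← Real.rpow_add hx0]; ring_nf
      have e2 : U ^ c = U ^ (1 / 2 - σ) * U ^ (σ - (1 / 2 - c)) := by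
        rw [← Real.rpow_add hU0]; ring_nf
      have e3 : x ^ (σ - (1 / 2 - c)) ≤ U ^ (σ - (1 / 2 - c)) :=
        Real.rpow_le_rpow hx0.le h (by linarith)
      rw [e1, e2]
      calc U ^ (1 / 2 - σ) * (x ^ (1 / 2 - c) * x ^ (σ - (1 / 2 - c)))
          ≤ U ^ (1 / 2 - σ) * (x ^ (1 / 2 - c) * U ^ (σ - (1 / 2 - c))) := by gcongr
        _ = _ := by ring
    linarith

lemma norm_horizontalIntegral_perron_le {F : ℂ → ℂ} {x U c B h : ℝ} (hx : 2 ≤ x) (hU : 1 ≤ U)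
    (hc : 0 < c) (hc1 : c < 1 / 8) (hB : 0 ≤ B) (hh : h ≠ 0)
    (hF : ∀ σ : ℝ, 1 / 2 - c ≤ σ → ‖F (σ + h * I)‖ ≤ B * U ^ (max 0 (1 / 2 - σ))) :
    ‖horizontalIntegral (fun s => F s * (x : ℂ) ^ s / s) (1 / 2 - c) (1 + 1 / Real.log x) h‖ ≤
      9 * B * (x + x ^ (1 / 2 - c) * U ^ c) / |h| := by
  have hx0 : 0 < x := by linarith
  have hlog2 : 0.6931471803 < Real.log 2 := Real.log_two_gt_d9
  have hlog : Real.log 2 ≤ Real.log x := Real.log_le_log (by norm_num) hx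
  have hlogpos : 0 < Real.log x := by linarith
  have hinv : 1 / Real.log x ≤ 3 / 2 := by
    rw [div_le_iff₀ hlogpos]; linarith
  have hinv0 : 0 < 1 / Real.log x := by positivity
  have hxb : x ^ (1 + 1 / Real.log x) ≤ 3 * x := by
    rw [Real.rpow_add hx0, Real.rpow_one, Real.rpow_def_of_pos hx0, mul_one_div_cancel hlogpos.ne']
    have := Real.exp_one_lt_d9
    nlinarith
  have hW : 0 ≤ x ^ (1 / 2 - c) * U ^ c := by positivity
  have habs : 0 < |h| := abs_pos.2 hh
  have hbd := intervalIntegral.norm_integral_le_of_norm_le_const (a := 1 / 2 - c)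
    (b := 1 + 1 / Real.log x) (C := 3 * B * (x + x ^ (1 / 2 - c) * U ^ c) / |h|)
    (f := fun σ : ℝ => F (σ + h * I) * (x : ℂ) ^ (σ + h * I : ℂ) / (σ + h * I)) ?_
  · rw [horizontalIntegral]
    refine hbd.trans ?_
    have hlen : |1 + 1 / Real.log x - (1 / 2 - c)| ≤ 3 := abs_le.2 ⟨by linarith, by linarith⟩
    have h0 : 0 ≤ 3 * B * (x + x ^ (1 / 2 - c) * U ^ c) / |h| := by positivity
    refine (mul_le_mul_of_nonneg_left hlen h0).trans (le_of_eq ?_)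
    ring
  intro σ hσ
  rw [Set.uIoc_of_le (by linarith)] at hσ
  have hb := hF σ hσ.1.le
  rw [norm_mul_cpow_div hx0]
  have hre : (σ + h * I : ℂ).re = σ := by simp
  have him : |h| ≤ ‖(σ + h * I : ℂ)‖ := by
    simpa using Complex.abs_im_le_norm (σ + h * I : ℂ)
  rw [hre]
  have hnum : ‖F (σ + h * I)‖ * x ^ σ ≤ 3 * B * (x + x ^ (1 / 2 - c) * U ^ c) := by
    rcases le_total σ (1 / 2) with hs | hs
    · rw [max_eq_right (by linarith)] at hb
      have := rpow_mul_rpow_le_add (x := x) (U := U) (c := c) (by linarith) hU hσ.1.le hs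
      calc _ ≤ B * U ^ (1 / 2 - σ) * x ^ σ := by gcongr
        _ = B * (U ^ (1 / 2 - σ) * x ^ σ) := by ring
        _ ≤ B * (x + x ^ (1 / 2 - c) * U ^ c) := by gcongr
        _ ≤ _ := by
          have : 0 ≤ B * (x + x ^ (1 / 2 - c) * U ^ c) := by positivity
          linarith
    · rw [max_eq_left (by linarith), Real.rpow_zero, mul_one] at hb
      have hxσ : x ^ σ ≤ 3 * x :=
        (Real.rpow_le_rpow_of_exponent_le (by linarith) hσ.2).trans hxb
      calc _ ≤ B * (3 * x) := by gcongr
        _ ≤ _ := by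
          have : 0 ≤ B * (x ^ (1 / 2 - c) * U ^ c) := by positivity
          linarith
  gcongr

lemma integral_inv_one_add_abs {τ : ℝ} (hτ : 0 ≤ τ) :
    ∫ t in (-τ)..τ, (1 + |t|)⁻¹ = 2 * Real.log (1 + τ) := by
  have hc : Continuous fun t : ℝ => (1 + |t|)⁻¹ :=
    Continuous.inv₀ (by fun_prop) fun t => by positivity
  have h1 : ∫ t in (0 : ℝ)..τ, (1 + |t|)⁻¹ = Real.log (1 + τ) := by
    have e : ∫ t in (0 : ℝ)..τ, (1 + |t|)⁻¹ = ∫ t in (0 : ℝ)..τ, (1 + t)⁻¹ := by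
      refine intervalIntegral.integral_congr fun t ht => ?_
      rw [Set.uIcc_of_le hτ] at ht
      simp [abs_of_nonneg ht.1]
    rw [e, intervalIntegral.integral_comp_add_left (fun t : ℝ => t⁻¹),
      integral_inv_of_pos (by norm_num) (by linarith)]
    simp
  have h2 : ∫ t in (-τ)..0, (1 + |t|)⁻¹ = Real.log (1 + τ) := by
    rw [← h1]
    have := intervalIntegral.integral_comp_neg (a := -τ) (b := 0) (fun t : ℝ => (1 + |t|)⁻¹)
    simpa using this
  rw [← intervalIntegral.integral_add_adjacent_intervals (hc.intervalIntegrable _ _)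
    (hc.intervalIntegrable _ _), h1, h2]
  ring

lemma norm_verticalIntegral_perron_le {F : ℂ → ℂ} {x c B τ : ℝ} (hx : 0 < x)
    (hc1 : c < 1 / 8) (hB : 0 ≤ B) (hτ : 0 ≤ τ)
    (hF : ∀ᵐ t : ℝ, |t| ≤ τ → ‖F ((1 / 2 - c : ℝ) + t * I)‖ ≤ B) :
    ‖verticalIntegral (fun s => F s * (x : ℂ) ^ s / s) (1 / 2 - c : ℝ) (-τ) τ‖ ≤
      8 * B * x ^ (1 / 2 - c) * Real.log (1 + τ) := by
  have hc : Continuous fun t : ℝ => (1 + |t|)⁻¹ :=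
    Continuous.inv₀ (by fun_prop) fun t => by positivity
  rw [verticalIntegral, norm_mul, Complex.norm_I, one_mul]
  have hbd := intervalIntegral.norm_integral_le_of_norm_le (a := -τ) (b := τ)
    (μ := MeasureTheory.volume)
    (g := fun t => 4 * B * x ^ (1 / 2 - c) * (1 + |t|)⁻¹)
    (f := fun t : ℝ => F ((1 / 2 - c : ℝ) + t * I) * (x : ℂ) ^ ((1 / 2 - c : ℝ) + t * I : ℂ) /
      ((1 / 2 - c : ℝ) + t * I)) (by linarith) ?_ ((hc.const_mul _).intervalIntegrable _ _)
  · refine hbd.trans (le_of_eq ?_)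
    rw [intervalIntegral.integral_const_mul, integral_inv_one_add_abs hτ]
    ring
  filter_upwards [hF] with t ht hmem
  have hb := ht (abs_le.2 ⟨hmem.1.le, hmem.2⟩)
  rw [norm_mul_cpow_div hx]
  have hre : (((1 / 2 - c : ℝ) : ℂ) + t * I).re = 1 / 2 - c := by simp
  have him : (((1 / 2 - c : ℝ) : ℂ) + t * I).im = t := by simp
  have e1 := Complex.abs_re_le_norm (((1 / 2 - c : ℝ) : ℂ) + t * I)
  have e2 := Complex.abs_im_le_norm (((1 / 2 - c : ℝ) : ℂ) + t * I)
  rw [hre, abs_of_pos (by linarith)] at e1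
  rw [him] at e2
  rw [hre]
  have hden : (1 + |t|) / 4 ≤ ‖((1 / 2 - c : ℝ) : ℂ) + t * I‖ := by linarith
  calc _ ≤ B * x ^ (1 / 2 - c) / ((1 + |t|) / 4) := by gcongr
    _ = _ := by field_simp

lemma log_le_exp_log_div_log_log {U : ℝ} (hU : 4 ≤ U) :
    Real.log U ≤ Real.exp (Real.log U / Real.log (Real.log U)) := by
  have h4 : 1 < Real.log U := by
    have h := Real.log_le_log (by norm_num) hU
    rw [show (4 : ℝ) = 2 ^ 2 by norm_num, Real.log_pow] at h
    have := Real.log_two_gt_d9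
    push_cast at h
    linarith
  set L := Real.log U with hL
  have hLpos : 0 < L := by linarith
  have hy : 0 < Real.log L := Real.log_pos h4
  set y := Real.log L with hyd
  have hexp : Real.exp y = L := Real.exp_log hLpos
  have hq := Real.quadratic_le_exp_of_nonneg (x := y / 2) (by positivity)
  have hsq : y ^ 2 ≤ L := by
    rw [← hexp, show y = y / 2 + y / 2 by ring, Real.exp_add]
    have : y ≤ Real.exp (y / 2) := by nlinarith [sq_nonneg (y - 2)]
    nlinarith
  calc L = Real.exp y := hexp.symm
    _ ≤ _ := by
      refine Real.exp_le_exp.2 ?_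
      rw [le_div_iff₀ hy]
      nlinarith

lemma exists_nonsingular_height {P : ℝ → Prop} (hP : ∀ T : ℝ, {t : ℝ | P t ∧ |t| ≤ T}.Finite)
    {T : ℝ} (hT : 1 ≤ T) : ∃ τ, T - 1 ≤ τ ∧ τ ≤ T ∧ ¬ P τ ∧ ¬ P (-τ) := by
  have hfin : ({t : ℝ | P t ∧ |t| ≤ T} ∪ Neg.neg '' {t : ℝ | P t ∧ |t| ≤ T}).Finite :=
    (hP T).union ((hP T).image _)
  obtain ⟨τ, hτ, hτn⟩ := (Set.Icc_infinite (show T - 1 < T by linarith)).exists_notMem_finite hfin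
  have habs : |τ| ≤ T := abs_le.2 ⟨by linarith [hτ.1], hτ.2⟩
  refine ⟨τ, hτ.1, hτ.2, fun h => hτn (Or.inl ⟨h, habs⟩), fun h => hτn (Or.inr ?_)⟩
  exact ⟨-τ, ⟨h, by rwa [abs_neg]⟩, neg_neg τ⟩

/-- Comparison of the error terms of the contour shift with the stated error term. -/
lemma exists_error_le {A B T₀ c : ℝ} (hB : 0 ≤ B) (hT₀ : 4 ≤ T₀) (hc : 0 < c) :
    ∃ C : ℝ, ∀ T : ℝ, 2 ≤ T → ∀ x : ℝ, 2 ≤ x →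
      B * Real.exp (A * (Real.log (max T T₀) / Real.log (Real.log (max T T₀)))) *
        (x / T + x ^ (1 / 2 - c) * (max T T₀) ^ c / T + x ^ (1 / 2 - c) * (max T T₀) ^ c) ≤
      C * (x * Real.log (x * T) / T + (x + max x T ^ ((1 : ℝ) / 2) + x ^ (1 / 2 - c) * T ^ (c + 1)) *
        Real.exp (A * Real.log T / Real.log (Real.log T)) / T) := by
  set E₀ := Real.exp (A * (Real.log T₀ / Real.log (Real.log T₀))) with hE₀
  refine ⟨2 * B + B * E₀ * (1 + 2 * T₀ ^ c * T₀), fun T hT x hx => ?_⟩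
  have hT0 : 0 < T := by linarith
  have hx0 : 0 < x := by linarith
  have hT₀0 : 0 < T₀ := by linarith
  have hlog : 1 ≤ Real.log (x * T) := by
    have h := Real.log_le_log (by norm_num) (show (4 : ℝ) ≤ x * T by nlinarith)
    rw [show (4 : ℝ) = 2 ^ 2 by norm_num, Real.log_pow] at h
    have := Real.log_two_gt_d9
    push_cast at h
    linarith
  have hmax : 0 ≤ max x T ^ ((1 : ℝ) / 2) := by positivity
  rw [mul_div_assoc A]
  rcases le_total T₀ T with h | h
  · rw [max_eq_left h]
    set E := Real.exp (A * (Real.log T / Real.log (Real.log T))) with hE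
    have hpow : T ^ (c + 1) = T ^ c * T := Real.rpow_add_one hT0.ne' c
    rw [hpow]
    set W := x ^ (1 / 2 - c) * T ^ c with hW
    have hW0 : 0 ≤ W := by positivity
    have e1 : (x + max x T ^ ((1 : ℝ) / 2) + x ^ (1 / 2 - c) * (T ^ c * T)) * E / T =
        E * (x / T) + max x T ^ ((1 : ℝ) / 2) * E / T + E * W := by
      rw [hW]; field_simp
    rw [e1]
    have e2 : W / T ≤ W := div_le_self hW0 (by linarith)
    have p1 : 0 ≤ x * Real.log (x * T) / T := by positivity
    have p2 : 0 ≤ max x T ^ ((1 : ℝ) / 2) * E / T := by positivity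
    have p3 : 0 ≤ E * (x / T) := by positivity
    have p4 : 0 ≤ B * E₀ * (1 + 2 * T₀ ^ c * T₀) := by positivity
    calc B * E * (x / T + W / T + W) ≤ B * E * (x / T + W + W) := by gcongr
      _ ≤ 2 * B * (E * (x / T) + E * W) := by nlinarith [mul_nonneg hB p3]
      _ ≤ 2 * B * (x * Real.log (x * T) / T + (E * (x / T) + max x T ^ ((1 : ℝ) / 2) * E / T + E * W)) := by
          refine mul_le_mul_of_nonneg_left (by linarith) (by positivity)
      _ ≤ _ := by
          refine mul_le_mul_of_nonneg_right (by linarith) ?_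
          positivity
  · rw [max_eq_right h]
    have hW : x ^ (1 / 2 - c) ≤ x := by
      calc x ^ (1 / 2 - c) ≤ x ^ (1 : ℝ) :=
            Real.rpow_le_rpow_of_exponent_le (by linarith) (by linarith)
        _ = x := Real.rpow_one x
    set Y := x * Real.log (x * T) / T with hY
    have hxY : x / T ≤ Y := by
      rw [hY]
      gcongr
      nlinarith
    have hxY' : x ≤ T₀ * (x / T) := by
      rw [mul_div_assoc', le_div_iff₀ hT0]
      nlinarith
    have hT₀c : 0 ≤ T₀ ^ c := by positivity
    have hW1 : x ^ (1 / 2 - c) * T₀ ^ c ≤ T₀ * (x / T) * T₀ ^ c := by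
      gcongr
      exact hW.trans hxY'
    have hW2 : x ^ (1 / 2 - c) * T₀ ^ c / T ≤ x ^ (1 / 2 - c) * T₀ ^ c :=
      div_le_self (by positivity) (by linarith)
    have hsum : x / T + x ^ (1 / 2 - c) * T₀ ^ c / T + x ^ (1 / 2 - c) * T₀ ^ c ≤
        (1 + 2 * T₀ ^ c * T₀) * Y := by
      calc _ ≤ (1 + 2 * T₀ ^ c * T₀) * (x / T) := by linarith
        _ ≤ _ := by gcongr
    have hY0 : 0 ≤ Y := by positivity
    calc _ ≤ B * E₀ * ((1 + 2 * T₀ ^ c * T₀) * Y) := by gcongr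
      _ = B * E₀ * (1 + 2 * T₀ ^ c * T₀) * Y := by ring
      _ ≤ (2 * B + B * E₀ * (1 + 2 * T₀ ^ c * T₀)) * Y := by
          gcongr
          linarith
      _ ≤ _ := by
          refine mul_le_mul_of_nonneg_left ?_ (by positivity)
          have : 0 ≤ (x + max x T ^ ((1 : ℝ) / 2) + x ^ (1 / 2 - c) * T ^ (c + 1)) *
            Real.exp (A * (Real.log T / Real.log (Real.log T))) / T := by positivity
          linarith

/-- The Perron integrand is bounded on vertical segments off the line `re = 1/2`. -/
lemma exists_norm_perron_le_on_vertical {q : ℕ} [NeZero q] {χ : DirichletCharacter ℂ q} (hχ : χ ≠ 1)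
    (hχ4 : mulChiNeg4 χ ≠ 1) (h1 : GRH χ) (h2 : GRH (mulChiNeg4 χ)) (h3 : GRH (χ ^ 2))
    (h4 : GRH (mulChiNeg4 (χ ^ 2))) {F : ℂ → ℂ}
    (hFser : ∀ s : ℂ, 1 < s.re → F s = LSeries (STwist χ) s)
    (hFan : DifferentiableOn ℂ F (cutHalfPlane χ)) {x : ℝ} (hx : 0 < x) {σ : ℝ} (hσ : 3 / 8 ≤ σ)
    (hσ2 : σ ≠ 1 / 2) (T : ℝ) :
    ∃ M : ℝ, ∀ t : ℝ, |t| ≤ T → (σ + t * I : ℂ) ∈ cutHalfPlane χ →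
      ‖F (σ + t * I) * (x : ℂ) ^ (σ + t * I : ℂ) / (σ + t * I)‖ ≤ M := by
  obtain ⟨A, C, T₀, hA, hC, hT₀, hb⟩ := exists_norm_le_of_dist_half hχ hχ4 h1 h2 h3 h4 hFser hFan
    (abs_pos.2 (sub_ne_zero.2 hσ2))
  set U := max T T₀ with hU
  have hU0 : 0 < U := by have := le_max_right T T₀; linarith
  refine ⟨C * U ^ (max 0 (1 / 2 - σ)) * Real.exp (A * (Real.log U / Real.log (Real.log U))) *
    x ^ σ / (1 / 4), fun t ht hs => ?_⟩
  have hre : (σ + t * I : ℂ).re = σ := by simp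
  have him : (σ + t * I : ℂ).im = t := by simp
  have hd : |σ - 1 / 2| ≤ ‖(σ + t * I : ℂ) - 1 / 2‖ := by
    have := Complex.abs_re_le_norm ((σ + t * I : ℂ) - 1 / 2)
    simpa using this
  have hF := hb U (le_max_right _ _) _ hs hd (by rw [hre]; exact hσ)
    (by rw [him]; exact ht.trans (le_max_left _ _))
  rw [hre] at hF
  rw [norm_mul_cpow_div hx, hre]
  have hn := Complex.abs_re_le_norm (σ + t * I : ℂ)
  rw [hre, abs_of_pos (by linarith)] at hn
  gcongr
  linarith

/-- Near a singularity the Perron integrand grows at most like the inverse fourth root. -/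
lemma exists_norm_perron_le_near_half {q : ℕ} [NeZero q] {χ : DirichletCharacter ℂ q} (hχ : χ ≠ 1)
    (hχ4 : mulChiNeg4 χ ≠ 1) (h1 : GRH χ) (h2 : GRH (mulChiNeg4 χ)) (h3 : GRH (χ ^ 2))
    (h4 : GRH (mulChiNeg4 (χ ^ 2))) {F : ℂ → ℂ}
    (hFser : ∀ s : ℂ, 1 < s.re → F s = LSeries (STwist χ) s)
    (hFan : DifferentiableOn ℂ F (cutHalfPlane χ)) {x : ℝ} (hx : 1 ≤ x) (γ : ℝ) :
    ∃ K δ : ℝ, 0 ≤ K ∧ 0 < δ ∧ ∀ s ∈ cutHalfPlane χ, s ≠ 1 / 2 + γ * I →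
      ‖s - (1 / 2 + γ * I)‖ < δ →
      ‖F s * (x : ℂ) ^ s / s‖ ≤ K * ‖s - (1 / 2 + γ * I)‖ ^ (-(1 / 4) : ℝ) := by
  obtain ⟨K, δ, hK, hδ, hb⟩ := exists_norm_le_near_half hχ hχ4 h1 h2 h3 h4 hFser hFan γ
  have hx0 : 0 < x := by linarith
  refine ⟨K * x ^ (2 : ℝ) / (1 / 4), min δ 1, by positivity, by positivity, fun s hs hne hdist => ?_⟩
  have hF := hb s hs hne (hdist.trans_le (min_le_left _ _))
  have hd1 : ‖s - (1 / 2 + γ * I)‖ < 1 := hdist.trans_le (min_le_right _ _)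
  have hre := Complex.re_le_norm (s - (1 / 2 + γ * I))
  have e : (s - (1 / 2 + γ * I)).re = s.re - 1 / 2 := by simp
  rw [e] at hre
  have hxs : x ^ s.re ≤ x ^ (2 : ℝ) := Real.rpow_le_rpow_of_exponent_le hx (by linarith)
  have hn : 1 / 4 ≤ ‖s‖ := hs.1.le.trans (Complex.re_le_norm s)
  rw [norm_mul_cpow_div hx0]
  calc ‖F s‖ * x ^ s.re / ‖s‖ ≤ (K * ‖s - (1 / 2 + γ * I)‖ ^ (-(1 / 4) : ℝ)) * x ^ (2 : ℝ) / (1 / 4) := by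
        gcongr
    _ = _ := by ring

set_option maxHeartbeats 1000000 in
/-- **Lemma 3.6:** shifting the Perron contour to truncated Hankel loops around the
singularities on `Re s = 1/2`. -/
theorem perron_shifted_to_hankel
    (q : ℕ) (hq : 0 < q) (χ : DirichletCharacter ℂ q) (hχ : χ ≠ 1)
    (h1 : GRH χ) (h2 : GRH (mulChiNeg4 χ)) (h3 : GRH (χ ^ 2)) (h4 : GRH (mulChiNeg4 (χ ^ 2)))
    (c : ℝ) (hc0 : 0 < c) (hc1 : c < 1 / 8)
    (F : ℂ → ℂ)
    (hFser : ∀ s : ℂ, 1 < s.re → F s = LSeries (STwist χ) s)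
    (hFan : DifferentiableOn ℂ F {s : ℂ | 1 / 4 < s.re ∧ (s.re ≤ 1 / 2 →
      LVal χ (1 / 2 + s.im * I) * LVal (mulChiNeg4 χ) (1 / 2 + s.im * I) ≠ 0 ∧
      ¬(s.im = 0 ∧ (χ ^ 2 = 1 ∨ mulChiNeg4 (χ ^ 2) = 1)))}) :
    ∃ A C : ℝ, ∀ T : ℝ, 2 ≤ T →
      ∃ T' T'' : ℝ, T - 1 ≤ T' ∧ T' ≤ T ∧ T - 1 ≤ T'' ∧ T'' ≤ T ∧
        ∃ Z : Finset ℝ,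
          (∀ γ : ℝ, γ ∈ Z ↔ (-T'' < γ ∧ γ < T' ∧
            (LVal χ (1 / 2 + γ * I) * LVal (mulChiNeg4 χ) (1 / 2 + γ * I) = 0 ∨
              (γ = 0 ∧ (χ ^ 2 = 1 ∨ mulChiNeg4 (χ ^ 2) = 1))))) ∧
          ∀ x : ℝ, 2 ≤ x → ∃ r₀ : ℝ, 0 < r₀ ∧ ∀ r : ℝ, 0 < r → r < r₀ →
            ‖SSum χ x - ∑ γ ∈ Z, (1 / (2 * Real.pi * I)) *
                hankelIntegral (fun s => F s * (x : ℂ) ^ s / s) (1 / 2 + γ * I) c r‖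
            ≤ C * (1 + x * Real.log (x * T) / T +
                (x + max x T ^ ((1 : ℝ) / 2) + x ^ (1 / 2 - c) * T ^ (c + 1)) *
                  Real.exp (A * Real.log T / Real.log (Real.log T)) / T) := by
  have : NeZero q := ⟨hq.ne'⟩
  have hd : DifferentiableOn ℂ F (cutHalfPlane χ) :=
    hFan.mono fun s hs => ⟨hs.1, fun h => not_or.1 (hs.2 h)⟩
  have hcont : ContinuousAt F 1 := by
    refine (hFan.mono (s := {s : ℂ | 1 / 2 < s.re}) ?_).continuousOn.continuousAt ?_
    · intro s hs
      have hs' : 1 / 2 < s.re := hs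
      exact ⟨by linarith, fun h => absurd h (by linarith)⟩
    · refine (isOpen_lt continuous_const Complex.continuous_re).mem_nhds ?_
      norm_num
  have hχ4 : mulChiNeg4 χ ≠ 1 := mulChiNeg4_ne_one hχ hFser hcont
  have hP : ∀ T : ℝ, {t : ℝ | IsSingularHeight χ t ∧ |t| ≤ T}.Finite :=
    finite_singularHeights hχ hχ4
  have hopen : IsOpen (cutSet (IsSingularHeight χ)) := isOpen_cutHalfPlane hχ hχ4
  obtain ⟨A₁, C₁, T₀, hA₁, hC₁, hT₀, hb⟩ :=
    exists_norm_le_of_dist_half hχ hχ4 h1 h2 h3 h4 hFser hd hc0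
  obtain ⟨C₂, hC₂⟩ := exists_error_le (A := A₁ + 1) (B := 36 * C₁) (by linarith) hT₀ hc0
  refine ⟨A₁ + 1, 217 + |C₂|, fun T hT => ?_⟩
  obtain ⟨τ, hτ1, hτ2, hτ3, hτ4⟩ := exists_nonsingular_height hP (T := T) (by linarith)
  have hτ0 : 1 ≤ τ := by linarith
  refine ⟨τ, τ, hτ1, hτ2, hτ1, hτ2, (hP τ).toFinset.filter (fun γ => -τ < γ ∧ γ < τ), ?_, ?_⟩
  · intro γ
    rw [Finset.mem_filter, Set.Finite.mem_toFinset]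
    constructor
    · rintro ⟨⟨h, -⟩, h5, h6⟩
      exact ⟨h5, h6, h⟩
    · rintro ⟨h5, h6, h⟩
      exact ⟨⟨h, abs_le.2 ⟨h5.le, h6.le⟩⟩, h5, h6⟩
  intro x hx
  have hx0 : 0 < x := by linarith
  set Z := (hP τ).toFinset.filter (fun γ => -τ < γ ∧ γ < τ) with hZdef
  have hZ : ∀ γ, γ ∈ Z ↔ -τ < γ ∧ γ < τ ∧ IsSingularHeight χ γ := by
    intro γ
    rw [hZdef, Finset.mem_filter, Set.Finite.mem_toFinset]
    constructor
    · rintro ⟨⟨h, -⟩, h5, h6⟩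
      exact ⟨h5, h6, h⟩
    · rintro ⟨h5, h6, h⟩
      exact ⟨⟨h, abs_le.2 ⟨h5.le, h6.le⟩⟩, h5, h6⟩
  have hlogx : 0 < Real.log x := Real.log_pos (by linarith)
  have hb1 : 1 < 1 + 1 / Real.log x := by
    have : 0 < 1 / Real.log x := by positivity
    linarith
  set g : ℂ → ℂ := fun s => F s * (x : ℂ) ^ s / s with hg
  have hgd : DifferentiableOn ℂ g (cutSet (IsSingularHeight χ)) := by
    have hne : ∀ s ∈ cutSet (IsSingularHeight χ), s ≠ 0 := by
      rintro s hs rfl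
      have := hs.1
      norm_num at this
    refine DifferentiableOn.div (hd.mul ?_) differentiableOn_id hne
    exact (differentiable_id.const_cpow (Or.inl (by exact_mod_cast hx0.ne'))).differentiableOn
  have hi : ∀ σ : ℝ, 3 / 8 ≤ σ → σ ≠ 1 / 2 →
      ∀ u v, IntervalIntegrable (fun t : ℝ => g (σ + t * I)) MeasureTheory.volume u v :=
    fun σ hσ hσ2 => intervalIntegrable_vertical hP hopen hgd (by linarith)
      (exists_norm_perron_le_on_vertical hχ hχ4 h1 h2 h3 h4 hFser hd hx0 hσ hσ2)
  obtain ⟨r₀, hr₀, hshift⟩ := exists_norm_verticalIntegral_sub_le hP hgd hi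
    (exists_norm_perron_le_near_half hχ hχ4 h1 h2 h3 h4 hFser hd (by linarith))
    hc0 hc1 hb1 (by linarith : -τ ≤ τ) hτ4 hτ3 hZ
  refine ⟨r₀, hr₀, fun r hr hrr => ?_⟩
  have hmain := hshift r hr hrr
  have hperron := norm_sum_sub_perron_le (norm_STwist_le χ) hx (show 0 < τ by linarith)
  set V := verticalIntegral g (1 + 1 / Real.log x : ℝ) (-τ) τ with hV
  set S := ∑ γ ∈ Z, hankelIntegral g (1 / 2 + γ * I) c r with hS
  have hVeq : 1 / (2 * Real.pi) * ∫ t in (-τ)..τ,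
      LSeries (STwist χ) ((1 + 1 / Real.log x : ℝ) + t * I) *
        (x : ℂ) ^ ((1 + 1 / Real.log x : ℝ) + t * I : ℂ) / ((1 + 1 / Real.log x : ℝ) + t * I) =
      1 / (2 * Real.pi * I) * V := by
    have hint : ∫ t in (-τ)..τ,
        LSeries (STwist χ) ((1 + 1 / Real.log x : ℝ) + t * I) *
          (x : ℂ) ^ ((1 + 1 / Real.log x : ℝ) + t * I : ℂ) / ((1 + 1 / Real.log x : ℝ) + t * I) =
        ∫ t in (-τ)..τ, g ((1 + 1 / Real.log x : ℝ) + t * I) := by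
      refine intervalIntegral.integral_congr fun t _ => ?_
      simp only [hg]
      rw [hFser _ (by
        rw [Complex.add_re, Complex.ofReal_re, Complex.re_ofReal_mul, Complex.I_re, mul_zero, add_zero]
        exact hb1)]
    have hpi : (Real.pi : ℂ) ≠ 0 := by exact_mod_cast Real.pi_ne_zero
    rw [hint, hV, verticalIntegral]
    generalize ∫ t in (-τ)..τ, g ((1 + 1 / Real.log x : ℝ) + t * I) = Q
    field_simp
  rw [hVeq] at hperron
  have hscal : ‖(1 / (2 * Real.pi * I) : ℂ)‖ ≤ 1 := by
    rw [norm_div, norm_mul, norm_mul, Complex.norm_I, Complex.norm_real,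
      Real.norm_of_nonneg Real.pi_pos.le, norm_one, mul_one, show ‖(2 : ℂ)‖ = 2 by norm_num, div_le_one (by positivity)]
    linarith [Real.pi_gt_three]
  set U := max T T₀ with hU
  have hTU : T ≤ U := le_max_left _ _
  have hU4 : 4 ≤ U := hT₀.trans (le_max_right _ _)
  set M := Real.log U / Real.log (Real.log U) with hM
  have hM0 : 0 ≤ M := log_div_log_log_nonneg hU4
  set W := x ^ (1 / 2 - c) * U ^ c with hW
  have hW0 : 0 ≤ W := by positivity
  have hB0 : 0 ≤ C₁ * Real.exp (A₁ * M) := by positivity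
  have hhor : ∀ h : ℝ, |h| = τ → ¬ IsSingularHeight χ h →
      ‖horizontalIntegral g (1 / 2 - c) (1 + 1 / Real.log x) h‖ ≤
        9 * (C₁ * Real.exp (A₁ * M)) * (x + W) / τ := by
    intro h habs hPh
    rw [← habs]
    refine norm_horizontalIntegral_perron_le hx (by linarith) hc0 hc1 hB0
      (abs_pos.1 (by linarith)) fun σ hσ => ?_
    have hre : (σ + h * I : ℂ).re = σ := by simp
    have him : (σ + h * I : ℂ).im = h := by simp
    have hd1 : c ≤ ‖(σ + h * I : ℂ) - 1 / 2‖ := by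
      have := Complex.abs_im_le_norm ((σ + h * I : ℂ) - 1 / 2)
      have e : ((σ + h * I : ℂ) - 1 / 2).im = h := by simp
      rw [e] at this
      linarith
    have hF := hb U (le_max_right _ _) (σ + h * I)
      (mk_mem_cutSet.2 ⟨by linarith, fun _ => hPh⟩) hd1 (by rw [hre]; linarith)
      (by rw [him]; linarith)
    rw [hre] at hF
    refine hF.trans (le_of_eq ?_)
    ring
  have hver : ‖verticalIntegral g (1 / 2 - c : ℝ) (-τ) τ‖ ≤
      16 * (C₁ * Real.exp (A₁ * M)) * W * Real.exp M := by
    have hbound := norm_verticalIntegral_perron_le (F := F) (x := x) (c := c)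
      (B := C₁ * Real.exp (A₁ * M) * U ^ c) (τ := τ) hx0 hc1 (by positivity) (by linarith) ?_
    · have hlog : Real.log (1 + τ) ≤ 2 * Real.exp M := by
        calc Real.log (1 + τ) ≤ Real.log (U ^ 2) := Real.log_le_log (by linarith) (by nlinarith)
          _ = 2 * Real.log U := by rw [Real.log_pow]; norm_num
          _ ≤ 2 * Real.exp M := by
              have := log_le_exp_log_div_log_log hU4
              linarith
      refine hbound.trans ?_
      calc _ ≤ 8 * (C₁ * Real.exp (A₁ * M) * U ^ c) * x ^ (1 / 2 - c) * (2 * Real.exp M) := by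
            gcongr
        _ = _ := by rw [hW]; ring
    · filter_upwards [MeasureTheory.compl_mem_ae_iff.2 ((hP τ).measure_zero MeasureTheory.volume)]
        with t ht htτ
      have hPt : ¬ IsSingularHeight χ t := fun h => ht ⟨h, htτ⟩
      have hre : (((1 / 2 - c : ℝ) : ℂ) + t * I).re = 1 / 2 - c := by simp
      have him : (((1 / 2 - c : ℝ) : ℂ) + t * I).im = t := by simp
      have hd1 : c ≤ ‖((1 / 2 - c : ℝ) : ℂ) + t * I - 1 / 2‖ := by
        have := Complex.abs_re_le_norm (((1 / 2 - c : ℝ) : ℂ) + t * I - 1 / 2)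
        have e : (((1 / 2 - c : ℝ) : ℂ) + t * I - 1 / 2).re = -c := by
          rw [Complex.sub_re, hre]
          norm_num
        rw [e, abs_neg, abs_of_pos hc0] at this
        exact this
      have hF := hb U (le_max_right _ _) (((1 / 2 - c : ℝ) : ℂ) + t * I)
        (mk_mem_cutSet.2 ⟨by linarith, fun _ => hPt⟩) hd1 (by rw [hre]; linarith)
        (by rw [him]; linarith)
      rw [hre, sub_sub_cancel, max_eq_right hc0.le] at hF
      refine hF.trans (le_of_eq ?_)
      ring
  have hτT : T / 2 ≤ τ := by linarith
  have hexp : Real.exp ((A₁ + 1) * M) = Real.exp (A₁ * M) * Real.exp M := by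
    rw [← Real.exp_add]
    ring_nf
  have hexpM : 1 ≤ Real.exp M := Real.one_le_exp hM0
  have hhor2 : 9 * (C₁ * Real.exp (A₁ * M)) * (x + W) / τ ≤
      18 * C₁ * Real.exp ((A₁ + 1) * M) * (x / T + W / T) := by
    rw [hexp]
    calc 9 * (C₁ * Real.exp (A₁ * M)) * (x + W) / τ
        ≤ 9 * (C₁ * (Real.exp (A₁ * M) * Real.exp M)) * (x + W) / (T / 2) := by
          gcongr
          exact le_mul_of_one_le_right (Real.exp_pos _).le hexpM
      _ = _ := by field_simp; ring
  have herr := hC₂ T hT x hx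
  have hshift2 : ‖V - S‖ ≤ 1 + 36 * C₁ * Real.exp ((A₁ + 1) * M) * (x / T + W / T + W) := by
    have b1 := hhor (-τ) (by rw [abs_neg, abs_of_pos (by linarith)]) hτ4
    have b2 := hhor τ (abs_of_pos (by linarith)) hτ3
    have b3 : 16 * (C₁ * Real.exp (A₁ * M)) * W * Real.exp M ≤
        36 * C₁ * Real.exp ((A₁ + 1) * M) * W := by
      rw [hexp]
      have : 0 ≤ C₁ * (Real.exp (A₁ * M) * Real.exp M) * W := by positivity
      linarith
    linarith
  set X := x * Real.log (x * T) / T with hX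
  set R := (x + max x T ^ ((1 : ℝ) / 2) + x ^ (1 / 2 - c) * T ^ (c + 1)) *
    Real.exp ((A₁ + 1) * Real.log T / Real.log (Real.log T)) / T with hR
  have hX0 : 0 ≤ X := by
    have : 0 ≤ Real.log (x * T) := Real.log_nonneg (by nlinarith)
    positivity
  have hR0 : 0 ≤ R := by positivity
  have hpx : x * Real.log x / τ ≤ 2 * X := by
    have hl : Real.log x ≤ Real.log (x * T) := Real.log_le_log hx0 (by nlinarith)
    calc x * Real.log x / τ ≤ x * Real.log (x * T) / (T / 2) := by
          gcongr
          exact mul_nonneg hx0.le (hlogx.le.trans hl)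
      _ = 2 * X := by rw [hX]; field_simp
  have hC₂' : C₂ * (X + R) ≤ |C₂| * (X + R) :=
    mul_le_mul_of_nonneg_right (le_abs_self _) (by linarith)
  rw [← Finset.mul_sum]
  have hsplit : SSum χ x - 1 / (2 * Real.pi * I) * S =
      (SSum χ x - 1 / (2 * Real.pi * I) * V) + 1 / (2 * Real.pi * I) * (V - S) := by ring
  have hlast : ‖(1 / (2 * Real.pi * I) : ℂ) * (V - S)‖ ≤ ‖V - S‖ := by
    rw [norm_mul]
    exact mul_le_of_le_one_left (norm_nonneg _) hscal
  have hfin : ‖SSum χ x - 1 / (2 * Real.pi * I) * S‖ ≤ 72 * (1 + x * Real.log x / τ) + ‖V - S‖ := by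
    rw [hsplit]
    exact (norm_add_le _ _).trans (add_le_add hperron hlast)
  have habs : 0 ≤ |C₂| := abs_nonneg _
  linarith

end
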